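/- Let d ≥ 3. For every function F : ℚ_S^d × ℚ_S^d → ℝ that is bounded, compactly supported, and semicontinuous, and for every admissible measure μ on G_d/Γ_d, the function F̂ defined on G_d/Γ_d by F̂(gΓ_d) = ∑_{(v¹, v²) ∈ P(ℤ_S^d) × P(ℤ_S^d)} F(g·v¹, g·v²) is μ-integrable, and ∫_{G_d/Γ_d} F̂ dμ = ζ_S(d)^{−2} ∬_{ℚ_S^d × ℚ_S^d} F(x, y) dvol_S(x) dvol_S(y) + ζ_S(d)^{−1} ∑_{k ∈ ℤ_S^×} ∫_{ℚ_S^d} F(x, k·x) dvol_S(x). -/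

import Mathlib

open MeasureTheory Matrix

noncomputable section

noncomputable instance Padic.instMeasurableSpace' {p : ℕ} [Fact p.Prime] :
    MeasurableSpace ℚ_[p] := borel _

instance Padic.instBorelSpace' {p : ℕ} [Fact p.Prime] : BorelSpace ℚ_[p] := ⟨rfl⟩

instance Matrix.SpecialLinearGroup.instTopologicalSpace'
    {n : Type*} [DecidableEq n] [Fintype n] {R : Type*} [CommRing R] [TopologicalSpace R] :
    TopologicalSpace (SpecialLinearGroup n R) :=
  show TopologicalSpace {A : Matrix n n R // A.det = 1} from inferInstance

noncomputable instance Matrix.SpecialLinearGroup.instMeasurableSpace'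
    {n : Type*} [DecidableEq n] [Fintype n] {R : Type*} [CommRing R] [TopologicalSpace R] :
    MeasurableSpace (SpecialLinearGroup n R) := borel _

/-- A finite set of distinct primes `p 0, …, p (s-1)`. -/
structure PrimeTup where
  s : ℕ
  p : Fin s → ℕ
  hp : ∀ i, (p i).Prime
  inj : Function.Injective p

namespace PrimeTup

instance (S : PrimeTup) (i : Fin S.s) : Fact (S.p i).Prime := ⟨S.hp i⟩

/-- The `p i`-adic field. -/
abbrev Qp (S : PrimeTup) (i : Fin S.s) : Type := ℚ_[S.p i]

/-- The space `ℚ_S^d = ℝ^d × ∏ᵢ ℚ_{pᵢ}^d`. -/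
abbrev QS (S : PrimeTup) (d : ℕ) : Type :=
  (Fin d → ℝ) × ((i : Fin S.s) → Fin d → S.Qp i)

/-- The ring `ℤ_S = ℤ[1/p₁, …, 1/p_s] ⊆ ℚ`. -/
def Zs (S : PrimeTup) : Subring ℚ :=
  Subring.closure (Set.range fun i : Fin S.s => ((S.p i : ℚ))⁻¹)

/-- The group `G_d = SL_d(ℝ) × ∏ᵢ SL_d(ℚ_{pᵢ})`. -/
abbrev G (S : PrimeTup) (d : ℕ) : Type :=
  SpecialLinearGroup (Fin d) ℝ × ((i : Fin S.s) → SpecialLinearGroup (Fin d) (S.Qp i))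

/-- Diagonal embedding of `SL_d(ℤ_S)` into `G_d`. -/
def toG (S : PrimeTup) (d : ℕ) : SpecialLinearGroup (Fin d) S.Zs →* S.G d :=
  MonoidHom.prod
    (SpecialLinearGroup.map ((Rat.castHom ℝ).comp S.Zs.subtype))
    (Pi.monoidHom fun i => SpecialLinearGroup.map ((Rat.castHom (S.Qp i)).comp S.Zs.subtype))

/-- The lattice `Γ_d`, the diagonally embedded copy of `SL_d(ℤ_S)` in `G_d`. -/
def Gamma (S : PrimeTup) (d : ℕ) : Subgroup (S.G d) := (S.toG d).range

/-- The componentwise linear action of `G_d` on `ℚ_S^d`. -/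
def act (S : PrimeTup) {d : ℕ} (g : S.G d) (x : S.QS d) : S.QS d :=
  ((g.1 : Matrix (Fin d) (Fin d) ℝ).mulVec x.1,
   fun i => ((g.2 i : Matrix (Fin d) (Fin d) (S.Qp i))).mulVec (x.2 i))

/-- Diagonal embedding of rational vectors into `ℚ_S^d`. -/
def diag (S : PrimeTup) {d : ℕ} (v : Fin d → ℚ) : S.QS d :=
  (fun j => (v j : ℝ), fun i j => (v j : S.Qp i))

/-- The first standard basis vector of `ℤ_S^d`. -/
def e1 (S : PrimeTup) (d : ℕ) : Fin d → S.Zs := fun j => if j.1 = 0 then 1 else 0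

/-- The set of `S`-primitive vectors `P(ℤ_S^d) = SL_d(ℤ_S)·e₁` inside `(ℤ_S)^d`. -/
def primZs (S : PrimeTup) (d : ℕ) : Set (Fin d → S.Zs) :=
  {w | ∃ γ : SpecialLinearGroup (Fin d) S.Zs,
    w = (γ : Matrix (Fin d) (Fin d) S.Zs).mulVec (S.e1 d)}

/-- The set of `S`-primitive vectors regarded inside `ℚ_S^d` via the diagonal embedding. -/
def prim (S : PrimeTup) (d : ℕ) : Set (S.QS d) :=
  (fun w : Fin d → S.Zs => S.diag fun j => ((w j : ℚ))) '' S.primZs d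

/-- Multiplication of a vector of `ℚ_S^d` by a (diagonally embedded) rational scalar. -/
def ratSMul (S : PrimeTup) {d : ℕ} (q : ℚ) (x : S.QS d) : S.QS d :=
  (fun j => (q : ℝ) * x.1 j, fun i j => (q : S.Qp i) * x.2 i j)

/-- `ℕ_S`: positive integers coprime to all the primes of `S`. -/
def NS (S : PrimeTup) : Set ℕ := {m | 0 < m ∧ ∀ i, ¬ (S.p i ∣ m)}

/-- The `S`-arithmetic zeta value `ζ_S(d)`. -/
def zetaS (S : PrimeTup) (d : ℕ) : ℝ := ∑' m : S.NS, (1 : ℝ) / ((m : ℕ) : ℝ) ^ d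

/-- The "unit box" `[0,1]^d × ∏ᵢ ℤ_{pᵢ}^d` used to normalize the volume on `ℚ_S^d`. -/
def unitBox (S : PrimeTup) (d : ℕ) : Set (S.QS d) :=
  {x | (∀ j, x.1 j ∈ Set.Icc (0:ℝ) 1) ∧ ∀ i j, ‖x.2 i j‖ ≤ 1}

/-- `v` is the measure `vol_S` on `ℚ_S^d`: the (unique) translation-invariant regular Borel
measure giving the unit box `[0,1]^d × ∏ᵢ ℤ_{pᵢ}^d` measure one; equivalently, the product of
Lebesgue measure on `ℝ^d` and the normalized Haar measures on the `ℚ_{pᵢ}^d`. -/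
def IsVolS (S : PrimeTup) (d : ℕ) (v : Measure (S.QS d)) : Prop :=
  v.IsAddHaarMeasure ∧ v.Regular ∧ v (S.unitBox d) = 1

/-- `μ` is an admissible measure on `G_d/Γ_d`: a regular Borel probability measure invariant
under the left `G_d`-action. -/
def Admissible (S : PrimeTup) (d : ℕ) (μ : Measure (S.G d ⧸ S.Gamma d)) : Prop :=
  IsProbabilityMeasure μ ∧ μ.Regular ∧ SMulInvariantMeasure (S.G d) (S.G d ⧸ S.Gamma d) μ

end PrimeTup

end

section CosetSums

open scoped ENNReal NNReal Topology Pointwise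

variable {G : Type*} [Group G] {X : Type*} [MeasurableSpace X] {ι : Type*}

/-- The measure on `X` attached to a coset `gΓ` which sums the point masses at `h i g`. -/
noncomputable def cosetSum (Γ : Subgroup G) (h : ι → G → X) (x : G ⧸ Γ) : Measure X :=
  Measure.sum fun i => Measure.dirac (h i x.out)

variable {Γ : Subgroup G}

theorem cosetSum_mk (h : ι → G → X)
    (hΓ : ∀ g, ∀ γ ∈ Γ, ∃ e : ι ≃ ι, ∀ i, h i (g * γ) = h (e i) g) (g : G) :
    cosetSum Γ h (QuotientGroup.mk g) = Measure.sum fun i => Measure.dirac (h i g) := by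
  obtain ⟨γ, hγ⟩ := QuotientGroup.mk_out_eq_mul Γ g
  obtain ⟨e, he⟩ := hΓ g γ γ.2
  unfold cosetSum
  rw [hγ]
  ext s hs
  rw [Measure.sum_apply _ hs, Measure.sum_apply _ hs]
  simp_rw [he]
  exact e.tsum_eq fun i => Measure.dirac (h i g) s

theorem lintegral_cosetSum_mk (h : ι → G → X)
    (hΓ : ∀ g, ∀ γ ∈ Γ, ∃ e : ι ≃ ι, ∀ i, h i (g * γ) = h (e i) g) (g : G)
    {f : X → ℝ≥0∞} (hf : Measurable f) :
    ∫⁻ y, f y ∂(cosetSum Γ h (QuotientGroup.mk g)) = ∑' i, f (h i g) := by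
  rw [cosetSum_mk h hΓ, lintegral_sum_measure]
  simp [lintegral_dirac' _ hf]

theorem mul_mem_orbit_reindex (g γ : G) (hγ : γ ∈ Γ) :
    ∃ e : Γ ≃ Γ, ∀ i : Γ, (g * γ) * (i : G) = g * (e i : Γ) :=
  ⟨Equiv.mulLeft ⟨γ, hγ⟩, fun i => by simp [mul_assoc]⟩

variable [MeasurableSpace G] [Countable ι]

theorem measurable_cosetSum (h : ι → G → X) (hm : ∀ i, Measurable (h i))
    (hΓ : ∀ g, ∀ γ ∈ Γ, ∃ e : ι ≃ ι, ∀ i, h i (g * γ) = h (e i) g) :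
    Measurable (cosetSum Γ h) := by
  refine measurable_from_quotient.2 (Measure.measurable_of_measurable_coe _ fun s hs => ?_)
  have h1 : (fun g : G => (cosetSum Γ h (QuotientGroup.mk g)) s) =
      fun g => ∑' i, s.indicator 1 (h i g) := funext fun g => by
    rw [cosetSum_mk h hΓ, Measure.sum_apply _ hs]
    simp [Measure.dirac_apply' _ hs]
  exact h1 ▸ Measurable.tsum fun i => (measurable_one.indicator hs).comp (hm i)

variable [MeasurableMul G]

theorem measurable_smul_quotient (a : G) : Measurable fun x : G ⧸ Γ => a • x :=
  measurable_from_quotient.2 (measurable_quotient_mk''.comp (measurable_const_mul a) :)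

theorem map_bind_cosetSum (μ : Measure (G ⧸ Γ)) [SMulInvariantMeasure G (G ⧸ Γ) μ]
    (h : ι → G → X) (hm : ∀ i, Measurable (h i))
    (hΓ : ∀ g, ∀ γ ∈ Γ, ∃ e : ι ≃ ι, ∀ i, h i (g * γ) = h (e i) g)
    (a : G) (t : X → X) (ht : Measurable t) (hat : ∀ i g, h i (a * g) = t (h i g)) :
    (μ.bind (cosetSum Γ h)).map t = μ.bind (cosetSum Γ h) := by
  have hk := measurable_cosetSum h hm hΓ
  refine Measure.ext_of_lintegral _ fun f hf => ?_
  rw [lintegral_map hf ht, Measure.lintegral_bind hk.aemeasurable (by fun_prop),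
    Measure.lintegral_bind hk.aemeasurable (by fun_prop)]
  have hinv : MeasurePreserving (fun x : G ⧸ Γ => a • x) μ μ :=
    ⟨measurable_smul_quotient a, by
      ext s hs
      rw [Measure.map_apply (measurable_smul_quotient a) hs]
      exact SMulInvariantMeasure.measure_preimage_smul a hs⟩
  have hmeas : Measurable fun x => ∫⁻ y, f y ∂cosetSum Γ h x :=
    (Measure.measurable_lintegral hf).comp hk
  rw [← hinv.lintegral_comp hmeas]
  refine lintegral_congr fun x => ?_
  induction x using QuotientGroup.induction_on with
  | H g =>
    rw [lintegral_cosetSum_mk h hΓ g (f := fun x => f (t x)) (hf.comp ht)]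
    have : a • (QuotientGroup.mk g : G ⧸ Γ) = QuotientGroup.mk (a * g) := rfl
    rw [this, lintegral_cosetSum_mk h hΓ _ hf]
    simp_rw [hat]

end CosetSums

section Uniqueness

open scoped ENNReal NNReal Topology Pointwise

variable {G : Type*} [Group G] [TopologicalSpace G] [IsTopologicalGroup G]
  [MeasurableSpace G] [BorelSpace G] {Γ : Subgroup G}

variable [Countable Γ]

/-- The lift to `G` of a measure on `G ⧸ Γ`, giving each point of a fibre mass one. -/
noncomputable def cosetLift (μ : Measure (G ⧸ Γ)) : Measure G :=
  μ.bind (cosetSum Γ fun (γ : Γ) g => g * γ)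

theorem cosetLift_apply (μ : Measure (G ⧸ Γ)) {W : Set G} (hW : IsOpen W)
    (hinj : ∀ x ∈ W, ∀ γ ∈ Γ, x * γ ∈ W → γ = 1) {A : Set (G ⧸ Γ)} (hA : MeasurableSet A) :
    cosetLift μ (QuotientGroup.mk ⁻¹' A ∩ W) = μ (A ∩ (QuotientGroup.mk '' W)) := by
  have hΓ : ∀ g : G, ∀ γ ∈ Γ, ∃ e : Γ ≃ Γ, ∀ i : Γ, (g * γ) * (i : G) = g * (e i : Γ) :=
    fun g γ h => mul_mem_orbit_reindex g γ h
  have hm : ∀ i : Γ, Measurable fun g : G => g * i := fun i => measurable_mul_const _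
  have hπ : Measurable (QuotientGroup.mk : G → G ⧸ Γ) := measurable_quotient_mk''
  have hk := measurable_cosetSum (fun (γ : Γ) g => g * (γ : G)) hm hΓ
  have hWm : MeasurableSet (QuotientGroup.mk '' W : Set (G ⧸ Γ)) := by
    refine measurableSet_quotient.2 ?_
    have : ((QuotientGroup.mk : G → G ⧸ Γ) ⁻¹' ((QuotientGroup.mk : G → G ⧸ Γ) '' W)) =
        ⋃ γ : Γ, (fun x : G => x * γ) ⁻¹' W := by
      rw [QuotientGroup.preimage_image_mk_eq_iUnion_image]
      ext x
      simp only [Set.mem_iUnion, Set.mem_image, Set.mem_preimage]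
      constructor
      · rintro ⟨γ, y, hy, rfl⟩
        exact ⟨γ⁻¹, by simpa using hy⟩
      · rintro ⟨γ, hy⟩
        exact ⟨γ⁻¹, _, hy, by simp⟩
    refine
      (?_ : MeasurableSet ((QuotientGroup.mk : G → G ⧸ Γ) ⁻¹'
        ((QuotientGroup.mk : G → G ⧸ Γ) '' W)))
    rw [this]
    exact MeasurableSet.iUnion fun γ => (hm γ) hW.measurableSet
  have hB : MeasurableSet (QuotientGroup.mk ⁻¹' A ∩ W) := (hπ hA).inter hW.measurableSet
  rw [cosetLift, Measure.bind_apply hB hk.aemeasurable, ← lintegral_indicator_one (hA.inter hWm)]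
  refine lintegral_congr fun x => ?_
  induction x using QuotientGroup.induction_on with
  | H g =>
    rw [← lintegral_indicator_one hB, lintegral_cosetSum_mk (fun (γ : Γ) g => g * (γ : G)) hΓ g
      (measurable_one.indicator hB)]
    by_cases hx : (QuotientGroup.mk g : G ⧸ Γ) ∈ A ∩ (QuotientGroup.mk '' W)
    · rw [Set.indicator_of_mem hx, Pi.one_apply]
      obtain ⟨hgA, y, hy, hyg⟩ := hx
      have hγ : g⁻¹ * y ∈ Γ := by
        rw [← QuotientGroup.eq]; exact hyg.symm
      rw [tsum_eq_single (⟨g⁻¹ * y, hγ⟩ : Γ)]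
      · have h1 : g * (g⁻¹ * y) ∈ QuotientGroup.mk ⁻¹' A ∩ W := by
          rw [mul_inv_cancel_left]
          refine ⟨?_, hy⟩
          rw [Set.mem_preimage, hyg]; exact hgA
        rw [Set.indicator_of_mem h1, Pi.one_apply]
      · intro γ hne
        refine Set.indicator_of_notMem (fun hmem => hne ?_) _
        have h2 := hinj y hy ((g⁻¹ * y)⁻¹ * γ) (Γ.mul_mem (Γ.inv_mem hγ) γ.2) (by
          have : y * ((g⁻¹ * y)⁻¹ * γ) = g * γ := by group
          rw [this]; exact hmem.2)
        ext
        exact (inv_mul_eq_one.1 h2).symm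
    · rw [Set.indicator_of_notMem hx, ENNReal.tsum_eq_zero]
      intro γ
      refine Set.indicator_of_notMem (fun hmem => hx ?_) _
      have h3 : (QuotientGroup.mk (g * γ) : G ⧸ Γ) = QuotientGroup.mk g :=
        QuotientGroup.mk_mul_of_mem g γ.2
      exact ⟨h3 ▸ hmem.1, ⟨_, hmem.2, h3⟩⟩

variable [LocallyCompactSpace G] [SecondCountableTopology G]

/-- A quotient by a countable discrete subgroup carries at most one invariant probability
measure. -/
theorem eq_of_smulInvariant_of_isProbability {U : Set G} (hU : U ∈ 𝓝 (1 : G))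
    (hUΓ : ∀ γ ∈ Γ, γ ∈ U → γ = 1)
    (μ μ' : Measure (G ⧸ Γ)) [IsProbabilityMeasure μ] [IsProbabilityMeasure μ']
    [SMulInvariantMeasure G (G ⧸ Γ) μ] [SMulInvariantMeasure G (G ⧸ Γ) μ'] : μ = μ' := by
  obtain ⟨W', hW', hdiv⟩ : ∃ V ∈ 𝓝 (1 : G), ∀ v ∈ V, ∀ w ∈ V, v⁻¹ * w ∈ U := by
    have : Filter.Tendsto (fun p : G × G => p.1⁻¹ * p.2) (𝓝 1 ×ˢ 𝓝 1) (𝓝 1) := by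
      have hc : Continuous fun p : G × G => p.1⁻¹ * p.2 := by fun_prop
      have := hc.tendsto (1, 1)
      rwa [nhds_prod_eq, inv_one, one_mul] at this
    obtain ⟨V, hV, hsub⟩ := Filter.mem_prod_same_iff.1 (this hU)
    exact ⟨V, hV, fun v hv w hw => hsub (Set.mk_mem_prod hv hw)⟩
  obtain ⟨W, hWW', hWo, h1W⟩ := mem_nhds_iff.1 hW'
  have hkW : ∀ k : G, IsOpen (k • W) := fun k => hWo.smul k
  have hinj : ∀ k : G, ∀ x ∈ k • W, ∀ γ ∈ Γ, x * γ ∈ k • W → γ = 1 := by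
    rintro k _ ⟨x, hx, rfl⟩ γ hγ ⟨y, hy, hxy⟩
    refine hUΓ γ hγ ?_
    have : γ = x⁻¹ * y := by
      simp only [smul_eq_mul] at hxy
      rw [mul_assoc] at hxy
      rw [mul_left_cancel hxy]; group
    rw [this]
    exact hdiv x (hWW' hx) y (hWW' hy)
  have hinv : ∀ (ν : Measure (G ⧸ Γ)) [SMulInvariantMeasure G (G ⧸ Γ) ν],
      (cosetLift ν).IsMulLeftInvariant := fun ν _ => ⟨fun a =>
    map_bind_cosetSum ν _ (fun i => measurable_mul_const _)
      (fun g γ h => mul_mem_orbit_reindex g γ h) a (fun x => a * x) (measurable_const_mul a)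
      fun i g => mul_assoc _ _ _⟩
  have hfin : ∀ (ν : Measure (G ⧸ Γ)) [IsProbabilityMeasure ν],
      IsFiniteMeasureOnCompacts (cosetLift ν) := fun ν _ => by
    have : IsLocallyFiniteMeasure (cosetLift ν) := ⟨fun k =>
      ⟨k • W, (hkW k).mem_nhds ⟨1, h1W, by simp⟩, by
        have := cosetLift_apply ν (hkW k) (hinj k) MeasurableSet.univ
        rw [Set.preimage_univ, Set.univ_inter] at this
        rw [this]
        exact measure_lt_top _ _⟩⟩
    infer_instance
  obtain ⟨T, hTc, hT⟩ : ∃ T : Set G, T.Countable ∧ ⋃ k ∈ T, k • W = Set.univ := by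
    have := TopologicalSpace.countable_cover_nhds (f := fun k => k • W)
      (fun k => (hkW k).mem_nhds ⟨1, h1W, by simp⟩)
    exact this
  have := hinv μ
  have := hinv μ'
  have := hfin μ
  have := hfin μ'
  have e1 := Measure.isMulLeftInvariant_eq_smul (cosetLift μ) (Measure.haar : Measure G)
  have e2 := Measure.isMulLeftInvariant_eq_smul (cosetLift μ') (Measure.haar : Measure G)
  set c := Measure.haarScalarFactor (cosetLift μ) (Measure.haar : Measure G)
  set c' := Measure.haarScalarFactor (cosetLift μ') (Measure.haar : Measure G)
  have key : ∀ ν ν' : Measure (G ⧸ Γ), cosetLift ν = cosetLift ν' → ν = ν' := by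
    intro ν ν' h
    have : Countable T := hTc
    refine Measure.ext_of_iUnion_eq_univ (s := fun k : T => QuotientGroup.mk '' ((k : G) • W))
      ?_ fun k => ?_
    · rw [← Set.image_iUnion, ← Set.biUnion_eq_iUnion T fun k _ => k • W, hT,
        Set.image_univ, QuotientGroup.mk_surjective.range_eq]
    · ext A hA
      rw [Measure.restrict_apply hA, Measure.restrict_apply hA,
        ← cosetLift_apply ν (hkW k) (hinj k) hA, ← cosetLift_apply ν' (hkW k) (hinj k) hA, h]
  have hsm : ∀ (r : ℝ≥0) (ν : Measure (G ⧸ Γ)), cosetLift (r • ν) = r • cosetLift ν := by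
    intro r ν
    ext s hs
    have hk := measurable_cosetSum (fun (γ : Γ) g => g * (γ : G)) (fun i => measurable_mul_const _)
      (fun g γ h => mul_mem_orbit_reindex g γ h)
    rw [cosetLift, Measure.bind_apply hs hk.aemeasurable, Measure.smul_apply, cosetLift,
      Measure.bind_apply hs hk.aemeasurable, lintegral_smul_measure]
  have hcc : c' • μ = c • μ' := key _ _ (by
    rw [hsm, hsm, e1, e2, smul_smul, smul_smul, mul_comm])
  have hc : c' = c := by
    have := congrArg (fun ν : Measure (G ⧸ Γ) => ν Set.univ) hcc
    simp only [Measure.smul_apply, measure_univ, ENNReal.smul_def, smul_eq_mul, mul_one] at this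
    exact ENNReal.coe_injective this
  have hc0 : c ≠ 0 := by
    intro h0
    have : μ = (0 : ℝ≥0) • μ := key _ _ (by rw [hsm, e1, h0, zero_smul, zero_smul])
    have h1 : μ Set.univ = 0 := by rw [this]; simp
    simp at h1
  rw [hc] at hcc
  have := congrArg (fun ν => c⁻¹ • ν) hcc
  simpa [smul_smul, inv_mul_cancel₀ hc0] using this

end Uniqueness

namespace Matrix.SpecialLinearGroup

variable {n : Type*} [DecidableEq n] [Fintype n] {R : Type*} [CommRing R] [TopologicalSpace R]

theorem isTopologicalGroup_of_subtype [IsTopologicalRing R] :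
    IsTopologicalGroup (SpecialLinearGroup n R) :=
  topologicalGroup

theorem isClosedEmbedding_coe_matrix [T1Space R] [IsTopologicalRing R] :
    Topology.IsClosedEmbedding (fun g : SpecialLinearGroup n R => (g : Matrix n n R)) :=
  Topology.IsClosedEmbedding.subtypeVal (p := fun A : Matrix n n R => A.det = 1)
    (isClosed_singleton.preimage continuous_id.matrix_det)

theorem borelSpace_of_subtype : BorelSpace (SpecialLinearGroup n R) := ⟨rfl⟩

theorem secondCountableTopology_of_subtype [SecondCountableTopology R] :
    SecondCountableTopology (SpecialLinearGroup n R) :=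
  haveI : SecondCountableTopology (Matrix n n R) :=
    inferInstanceAs (SecondCountableTopology (n → n → R))
  Topology.IsEmbedding.subtypeVal.secondCountableTopology

theorem locallyCompactSpace_of_subtype [T1Space R] [IsTopologicalRing R] [LocallyCompactSpace R] :
    LocallyCompactSpace (SpecialLinearGroup n R) :=
  haveI : LocallyCompactSpace (Matrix n n R) :=
    inferInstanceAs (LocallyCompactSpace (n → n → R))
  isClosedEmbedding_coe_matrix.locallyCompactSpace

end Matrix.SpecialLinearGroup

attribute [instance] Matrix.SpecialLinearGroup.isTopologicalGroup_of_subtype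
  Matrix.SpecialLinearGroup.borelSpace_of_subtype
  Matrix.SpecialLinearGroup.secondCountableTopology_of_subtype
  Matrix.SpecialLinearGroup.locallyCompactSpace_of_subtype

namespace PrimeTup

variable (S : PrimeTup) (d : ℕ)

instance : Countable (SpecialLinearGroup (Fin d) S.Zs) :=
  haveI : Countable (Matrix (Fin d) (Fin d) S.Zs) :=
    inferInstanceAs (Countable (Fin d → Fin d → S.Zs))
  Subtype.countable

instance : Countable (S.Gamma d) :=
  (Set.countable_range (S.toG d)).to_subtype

end PrimeTup

namespace PrimeTup

section Arithmetic

variable (S : PrimeTup)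

/-- All prime factors of `n` belong to `S`. -/
def Smooth (n : ℕ) : Prop := ∀ q : ℕ, q.Prime → q ∣ n → ∃ i, q = S.p i

variable {S}

theorem Smooth.mul {m n : ℕ} (hm : S.Smooth m) (hn : S.Smooth n) : S.Smooth (m * n) :=
  fun q hq h => ((Nat.Prime.dvd_mul hq).1 h).elim (hm q hq) (hn q hq)

theorem Smooth.of_dvd {m n : ℕ} (hn : S.Smooth n) (h : m ∣ n) : S.Smooth m :=
  fun q hq hqm => hn q hq (hqm.trans h)

theorem smooth_one : S.Smooth 1 := fun _ hq h => absurd (Nat.dvd_one.1 h) hq.ne_one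

theorem smooth_p (i : Fin S.s) : S.Smooth (S.p i) := fun _ hq h =>
  ⟨i, (Nat.prime_dvd_prime_iff_eq hq (S.hp i)).1 h⟩

theorem Smooth.coprime {m n : ℕ} (hm : S.Smooth m) (hn : n ∈ S.NS) : Nat.Coprime m n := by
  refine Nat.Coprime.symm (Nat.coprime_of_dvd fun q hq hqn hqm => ?_)
  obtain ⟨i, rfl⟩ := hm q hq hqm
  exact hn.2 i hqn

theorem inv_mem_Zs {n : ℕ} (h0 : n ≠ 0) (hn : S.Smooth n) : ((n : ℚ))⁻¹ ∈ S.Zs := by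
  induction n using induction_on_primes with
  | zero => exact absurd rfl h0
  | one => simp
  | prime_mul q m hq ih =>
    obtain ⟨i, rfl⟩ := hn q hq (dvd_mul_right _ _)
    push_cast
    rw [mul_inv]
    exact S.Zs.mul_mem (Subring.subset_closure ⟨i, rfl⟩)
      (ih (right_ne_zero_of_mul h0) (hn.of_dvd (dvd_mul_left _ _)))

theorem mem_Zs_iff {x : ℚ} : x ∈ S.Zs ↔ S.Smooth x.den := by
  constructor
  · intro hx
    induction hx using Subring.closure_induction with
    | mem x hx =>
      obtain ⟨i, rfl⟩ := hx
      have : ((S.p i : ℚ)⁻¹).den = S.p i := Rat.inv_natCast_den_of_pos (S.hp i).pos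
      rw [this]
      exact smooth_p i
    | zero => exact smooth_one
    | one => exact smooth_one
    | add x y _ _ hx hy => exact (hx.mul hy).of_dvd (Rat.add_den_dvd x y)
    | neg x _ hx => rwa [Rat.neg_den]
    | mul x y _ _ hx hy => exact (hx.mul hy).of_dvd (Rat.mul_den_dvd x y)
  · intro h
    rw [← Rat.num_div_den x, div_eq_mul_inv]
    exact S.Zs.mul_mem (intCast_mem _ _) (inv_mem_Zs x.den_nz h)

theorem den_eq_one_of_norm_le_one {x : ℚ} (hx : x ∈ S.Zs)
    (h : ∀ i, ‖(x : S.Qp i)‖ ≤ 1) : x.den = 1 := by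
  by_contra hne
  obtain ⟨q, hq, hqd⟩ := Nat.exists_prime_and_dvd hne
  obtain ⟨i, rfl⟩ := mem_Zs_iff.1 hx q hq hqd
  have h1 := PadicInt.isUnit_iff.1 (PadicInt.isUnit_den x (h i))
  rw [PadicInt.norm_natCast_eq_one_iff] at h1
  exact ((S.hp i).coprime_iff_not_dvd.1 h1) hqd

theorem norm_le_one_of_mem_Zs {x : ℚ} (hx : x ∈ S.Zs) {p : ℕ} [Fact p.Prime]
    (hp : ∀ i, p ≠ S.p i) : ‖(x : ℚ_[p])‖ ≤ 1 :=
  Padic.norm_rat_le_one fun h => by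
    obtain ⟨i, hi⟩ := mem_Zs_iff.1 hx p Fact.out h
    exact hp i hi

theorem inv_norm_le_one_p {i j : Fin S.s} (h : i ≠ j) (n : ℕ) :
    ‖(((S.p i : ℚ)⁻¹ ^ n : ℚ) : S.Qp j)‖ = 1 := by
  push_cast
  rw [norm_pow, norm_inv, Padic.norm_natCast_eq_one_iff.2, inv_one, one_pow]
  exact (Nat.coprime_primes (S.hp j) (S.hp i)).2 fun h' => h (S.inj h').symm

/-- Every element is the product of a unit and an element of `ℕ_S`. -/
theorem exists_smooth_mul_NS {n : ℕ} (hn : n ≠ 0) :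
    ∃ a m : ℕ, n = a * m ∧ a ≠ 0 ∧ S.Smooth a ∧ m ∈ S.NS := by
  induction n using induction_on_primes with
  | zero => exact absurd rfl hn
  | one => exact ⟨1, 1, rfl, one_ne_zero, smooth_one, one_pos, fun i h =>
      (S.hp i).ne_one (Nat.dvd_one.1 h)⟩
  | prime_mul q k hq ih =>
    obtain ⟨a, m, rfl, ha, hs, hm⟩ := ih (right_ne_zero_of_mul hn)
    by_cases h : ∃ i, q = S.p i
    · obtain ⟨i, rfl⟩ := h
      exact ⟨S.p i * a, m, by ring, mul_ne_zero (S.hp i).ne_zero ha, (smooth_p i).mul hs, hm⟩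
    · refine ⟨a, q * m, by ring, ha, hs, Nat.mul_pos hq.pos hm.1, fun i hd => ?_⟩
      rcases (S.hp i).dvd_mul.1 hd with h1 | h1
      · exact h ⟨i, ((Nat.prime_dvd_prime_iff_eq (S.hp i) hq).1 h1).symm⟩
      · exact hm.2 i h1

theorem isUnit_natCast_of_smooth {n : ℕ} (h0 : n ≠ 0) (hn : S.Smooth n) :
    IsUnit (n : S.Zs) := by
  refine IsUnit.of_mul_eq_one (⟨(n : ℚ)⁻¹, inv_mem_Zs h0 hn⟩ : S.Zs) (Subtype.ext ?_)
  push_cast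
  exact mul_inv_cancel₀ (by exact_mod_cast h0)

theorem exists_unit_mul_NS {x : S.Zs} (hx : x ≠ 0) :
    ∃ (u : (S.Zs)ˣ) (m : ℕ), m ∈ S.NS ∧ x = u * (m : S.Zs) := by
  have hx0 : (x : ℚ) ≠ 0 := fun h => hx (Subtype.ext h)
  obtain ⟨a, m, hn, ha, hs, hm⟩ := exists_smooth_mul_NS (S := S)
    (Int.natAbs_ne_zero.2 (Rat.num_ne_zero.2 hx0))
  obtain ⟨ua, hua⟩ := isUnit_natCast_of_smooth ha hs
  obtain ⟨ud, hud⟩ := isUnit_natCast_of_smooth (x : ℚ).den_nz (mem_Zs_iff.1 x.2)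
  have hxd : x * ud = ((x : ℚ).num : S.Zs) := by
    rw [hud]; apply Subtype.ext; push_cast; exact Rat.mul_den_eq_num _
  have key : ∀ e : (S.Zs)ˣ, ((x : ℚ).num : S.Zs) = e * (a * m : ℕ) →
      ∃ (u : (S.Zs)ˣ) (m : ℕ), m ∈ S.NS ∧ x = u * (m : S.Zs) := fun e he =>
    ⟨e * ua * ud⁻¹, m, hm, by
      rw [he] at hxd
      refine ((Units.eq_mul_inv_iff_mul_eq ud).2 hxd).trans ?_
      push_cast
      rw [hua]; ring⟩
  rcases Int.natAbs_eq (x : ℚ).num with h | h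
  · exact key 1 (by rw [h, hn]; push_cast; simp)
  · exact key (-1) (by rw [h, hn]; push_cast; simp)

/-- Divisibility in `ℤ_S` by elements of `ℕ_S`. -/
theorem dvd_of_mul_eq_of_mem_NS {m n : ℕ} (hm : m ∈ S.NS) {x : S.Zs}
    (h : (n : S.Zs) = m * x) : m ∣ n := by
  have h1 : (n : ℚ) = m * (x : ℚ) := by exact_mod_cast congrArg Subtype.val h
  have h2 : (n : ℚ) * (x : ℚ).den = m * (x : ℚ).num := by
    rw [h1, mul_assoc, Rat.mul_den_eq_num]
  have h3 : (n : ℤ) * ((x : ℚ).den : ℤ) = m * (x : ℚ).num := by exact_mod_cast h2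
  have h4 : (m : ℤ) ∣ n * ((x : ℚ).den : ℤ) := ⟨_, h3⟩
  rw [← Nat.cast_mul, Int.natCast_dvd_natCast] at h4
  exact ((mem_Zs_iff.1 x.2).coprime hm).symm.dvd_of_dvd_mul_right h4

theorem eq_one_of_mem_NS_of_isUnit {m : ℕ} (hm : m ∈ S.NS) (h : IsUnit (m : S.Zs)) : m = 1 := by
  obtain ⟨x, hx⟩ := h.exists_right_inv
  exact Nat.dvd_one.1 (dvd_of_mul_eq_of_mem_NS (n := 1) hm (by rw [Nat.cast_one, hx]))

theorem NS_ne_zero {m : ℕ} (hm : m ∈ S.NS) : (m : S.Zs) ≠ 0 := by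
  have := hm.1.ne'
  exact_mod_cast this

end Arithmetic

end PrimeTup

theorem Matrix.SpecialLinearGroup.transvection_mulVec {n R : Type*} [DecidableEq n] [Fintype n]
    [CommRing R] {i j : n} (h : i ≠ j) (c : R) (w : n → R) :
    (SpecialLinearGroup.transvection h c : Matrix n n R).mulVec w =
      Function.update w i (w i + c * w j) := by
  rw [SpecialLinearGroup.transvection_coe]
  ext k
  rcases eq_or_ne k i with rfl | hk
  · simp [Matrix.add_mulVec, Matrix.single_mulVec]
  · simp [Matrix.add_mulVec, Matrix.single_mulVec, hk]

theorem Matrix.SpecialLinearGroup.inv_mulVec_mulVec {n R : Type*} [DecidableEq n] [Fintype n]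
    [CommRing R] (γ : SpecialLinearGroup n R) (v : n → R) :
    ((γ⁻¹ : SpecialLinearGroup n R) : Matrix n n R).mulVec ((γ : Matrix n n R).mulVec v) = v := by
  rw [mulVec_mulVec, ← Matrix.SpecialLinearGroup.coe_mul, inv_mul_cancel,
    Matrix.SpecialLinearGroup.coe_one,
    one_mulVec]

theorem Matrix.SpecialLinearGroup.mulVec_inv_mulVec {n R : Type*} [DecidableEq n] [Fintype n]
    [CommRing R] (γ : SpecialLinearGroup n R) (v : n → R) :
    (γ : Matrix n n R).mulVec (((γ⁻¹ : SpecialLinearGroup n R) : Matrix n n R).mulVec v) = v := by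
  simpa using inv_mulVec_mulVec γ⁻¹ v

namespace PrimeTup

section Primitive

variable {S : PrimeTup} {d : ℕ}

theorem e1_eq_single (hd : 0 < d) : S.e1 d = Pi.single (⟨0, hd⟩ : Fin d) 1 := by
  ext j
  rcases eq_or_ne j ⟨0, hd⟩ with rfl | h
  · simp [e1]
  · have : j.1 ≠ 0 := fun h' => h (Fin.ext h')
    simp [e1, this, h]

/-- `v` is a multiple of a primitive vector. -/
def IsMulPrim (v : Fin d → S.Zs) : Prop :=
  ∃ (γ : SpecialLinearGroup (Fin d) S.Zs) (c : S.Zs),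
    v = c • (γ : Matrix (Fin d) (Fin d) S.Zs).mulVec (S.e1 d)

theorem IsMulPrim.of_mulVec (t : SpecialLinearGroup (Fin d) S.Zs) {v : Fin d → S.Zs}
    (h : IsMulPrim ((t : Matrix (Fin d) (Fin d) S.Zs).mulVec v)) : IsMulPrim v := by
  obtain ⟨γ, c, hv⟩ := h
  refine ⟨t⁻¹ * γ, c, ?_⟩
  rw [Matrix.SpecialLinearGroup.coe_mul, ← mulVec_mulVec, ← mulVec_smul, ← hv,
    SpecialLinearGroup.inv_mulVec_mulVec]

theorem isMulPrim_single (hd : 0 < d) (i : Fin d) (c : S.Zs) :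
    IsMulPrim (Pi.single i c : Fin d → S.Zs) := by
  rcases eq_or_ne i ⟨0, hd⟩ with rfl | h
  · refine ⟨1, c, ?_⟩
    rw [Matrix.SpecialLinearGroup.coe_one, one_mulVec, e1_eq_single hd, ← Pi.single_smul,
      smul_eq_mul,
      mul_one]
  · refine IsMulPrim.of_mulVec (SpecialLinearGroup.transvection h.symm 1) ?_
    refine IsMulPrim.of_mulVec (SpecialLinearGroup.transvection h (-1)) ?_
    refine ⟨1, c, ?_⟩
    rw [Matrix.SpecialLinearGroup.coe_one, one_mulVec, e1_eq_single hd, ← Pi.single_smul,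
      smul_eq_mul,
      mul_one, SpecialLinearGroup.transvection_mulVec, SpecialLinearGroup.transvection_mulVec]
    ext k
    rcases eq_or_ne k i with rfl | hk
    · simp [h]
    · rcases eq_or_ne k ⟨0, hd⟩ with rfl | hk0
      · simp [h.symm]
      · simp [hk, hk0]

theorem isMulPrim_int (hd : 0 < d) (n : ℕ) : ∀ w : Fin d → ℤ, ∑ j, (w j).natAbs = n →
    IsMulPrim (fun j => (w j : S.Zs)) := by
  induction n using Nat.strong_induction_on with
  | _ n ih =>
  intro w hw
  by_cases h : ∃ i j, i ≠ j ∧ w j ≠ 0 ∧ (w j).natAbs ≤ (w i).natAbs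
  · obtain ⟨i, j, hij, hj0, hle⟩ := h
    obtain ⟨s, hs⟩ : ∃ s : ℤ, (w i + s * w j).natAbs < (w i).natAbs := by
      rcases le_total 0 (w i) with h1 | h1 <;> rcases le_total 0 (w j) with h2 | h2
      · exact ⟨-1, by omega⟩
      · exact ⟨1, by omega⟩
      · exact ⟨1, by omega⟩
      · exact ⟨-1, by omega⟩
    refine IsMulPrim.of_mulVec (SpecialLinearGroup.transvection hij (s : S.Zs)) ?_
    have hlt : ∑ k, (Function.update w i (w i + s * w j) k).natAbs < n := by
      rw [← hw]
      refine Finset.sum_lt_sum (fun k _ => ?_) ⟨i, Finset.mem_univ _, by simpa using hs⟩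
      rcases eq_or_ne k i with rfl | hk
      · simpa using hs.le
      · simp [hk]
    convert ih _ hlt _ rfl using 1
    rw [SpecialLinearGroup.transvection_mulVec]
    ext k
    rcases eq_or_ne k i with rfl | hk
    · simp
    · simp [hk]
  · push Not at h
    by_cases h0 : ∃ i, w i ≠ 0
    · obtain ⟨i, hi⟩ := h0
      have : (fun j => (w j : S.Zs)) = Pi.single i (w i : S.Zs) := by
        ext j
        rcases eq_or_ne j i with rfl | hj
        · simp
        · have : w j = 0 := by
            by_contra hj0
            have h1 := h i j hj.symm hj0
            have h2 := h j i hj hi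
            omega
          simp [hj, this]
      rw [this]
      exact isMulPrim_single hd i _
    · push Not at h0
      refine ⟨1, 0, ?_⟩
      ext j
      simp [h0]

theorem exists_smooth_smul_eq_int (w : Fin d → S.Zs) :
    ∃ N : ℕ, N ≠ 0 ∧ S.Smooth N ∧ ∃ z : Fin d → ℤ, ∀ j, (N : S.Zs) * w j = z j := by
  refine ⟨∏ j, (w j : ℚ).den, Finset.prod_ne_zero_iff.2 fun j _ => (w j : ℚ).den_nz, ?_,
    fun j => (∏ k ∈ Finset.univ.erase j, ((w k : ℚ).den : ℤ)) * (w j : ℚ).num, fun j => ?_⟩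
  · refine Finset.prod_induction _ S.Smooth (fun _ _ => Smooth.mul) smooth_one
      fun j _ => mem_Zs_iff.1 (w j).2
  · rw [← Finset.mul_prod_erase _ _ (Finset.mem_univ j)]
    apply Subtype.ext
    push_cast
    rw [← Rat.den_mul_eq_num]
    ring

theorem isMulPrim (hd : 0 < d) (w : Fin d → S.Zs) : IsMulPrim w := by
  obtain ⟨N, hN0, hN, z, hz⟩ := exists_smooth_smul_eq_int w
  obtain ⟨u, hu⟩ := isUnit_natCast_of_smooth hN0 hN
  obtain ⟨γ, c, h⟩ := isMulPrim_int (S := S) hd _ z rfl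
  refine ⟨γ, (u⁻¹ : (S.Zs)ˣ) * c, ?_⟩
  rw [mul_smul, ← h]
  ext j
  simp [← hz, ← hu]

theorem unit_smul_mem_primZs (hd : 2 ≤ d) (u : (S.Zs)ˣ) {v : Fin d → S.Zs}
    (hv : v ∈ S.primZs d) : (u : S.Zs) • v ∈ S.primZs d := by
  obtain ⟨γ, rfl⟩ := hv
  have hd0 : 0 < d := by omega
  set i : Fin d := ⟨0, hd0⟩ with hi
  set j : Fin d := ⟨1, by omega⟩ with hj
  have hij : i ≠ j := by simp [hi, hj]
  set D : Fin d → S.Zs := fun k => if k = i then u else if k = j then (u⁻¹ : (S.Zs)ˣ) else 1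
    with hD
  have hdet : (diagonal D).det = 1 := by
    rw [det_diagonal, Finset.prod_eq_mul i j hij]
    · simp [hD, hij.symm]
    · rintro k - ⟨h1, h2⟩
      simp [hD, h1, h2]
    · simp
    · simp
  let D' : Matrix.SpecialLinearGroup (Fin d) S.Zs := ⟨diagonal D, hdet⟩
  refine ⟨γ * D', ?_⟩
  rw [Matrix.SpecialLinearGroup.coe_mul, ← mulVec_mulVec, ← mulVec_smul]
  congr 1
  change _ = (diagonal D).mulVec (S.e1 d)
  rw [e1_eq_single hd0]
  ext k
  simp only [mulVec_diagonal, Pi.smul_apply, smul_eq_mul]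
  rcases eq_or_ne k i with rfl | hk
  · simp [hD]
  · rw [Pi.single_eq_of_ne hk, mul_zero, mul_zero]

theorem mulVec_mem_primZs (γ : SpecialLinearGroup (Fin d) S.Zs) {v : Fin d → S.Zs}
    (hv : v ∈ S.primZs d) : (γ : Matrix (Fin d) (Fin d) S.Zs).mulVec v ∈ S.primZs d := by
  obtain ⟨γ', rfl⟩ := hv
  exact ⟨γ * γ', by rw [Matrix.SpecialLinearGroup.coe_mul, mulVec_mulVec]⟩

theorem ne_zero_of_mem_primZs (hd : 0 < d) {v : Fin d → S.Zs} (hv : v ∈ S.primZs d) : v ≠ 0 := by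
  rintro rfl
  obtain ⟨γ, h⟩ := hv
  have := SpecialLinearGroup.inv_mulVec_mulVec γ (S.e1 d)
  rw [← h, mulVec_zero, e1_eq_single hd] at this
  simpa using congrFun this ⟨0, hd⟩

/-- A primitive vector is moved to `e₁` by an element of `SL_d(ℤ_S)`. -/
theorem exists_mulVec_eq_e1 {v : Fin d → S.Zs} (hv : v ∈ S.primZs d) :
    ∃ γ : SpecialLinearGroup (Fin d) S.Zs,
      (γ : Matrix (Fin d) (Fin d) S.Zs).mulVec v = S.e1 d := by
  obtain ⟨γ, rfl⟩ := hv
  exact ⟨γ⁻¹, SpecialLinearGroup.inv_mulVec_mulVec γ _⟩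

/-- If `a v = b w` with `v` primitive then `b` divides `a`. -/
theorem dvd_of_smul_eq_smul (hd : 0 < d) {v w : Fin d → S.Zs} (hv : v ∈ S.primZs d)
    {a b : S.Zs} (h : a • v = b • w) : b ∣ a := by
  obtain ⟨γ, hγ⟩ := exists_mulVec_eq_e1 hv
  have h1 := congrArg (fun x => (γ : Matrix (Fin d) (Fin d) S.Zs).mulVec x ⟨0, hd⟩) h
  simp only [mulVec_smul, hγ, e1_eq_single hd, Pi.smul_apply, Pi.single_eq_same, smul_eq_mul,
    mul_one] at h1
  exact ⟨_, h1⟩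

theorem exists_NS_smul_prim (hd : 2 ≤ d) {w : Fin d → S.Zs} (hw : w ≠ 0) :
    ∃ m ∈ S.NS, ∃ v ∈ S.primZs d, w = (m : S.Zs) • v := by
  obtain ⟨γ, c, rfl⟩ := isMulPrim (by omega) w
  have hc : c ≠ 0 := by rintro rfl; simp at hw
  obtain ⟨u, m, hm, rfl⟩ := exists_unit_mul_NS hc
  exact ⟨m, hm, _, unit_smul_mem_primZs hd u ⟨γ, rfl⟩, by rw [smul_smul, mul_comm]⟩

theorem NS_smul_prim_unique (hd : 0 < d) {m m' : ℕ} (hm : m ∈ S.NS) (hm' : m' ∈ S.NS)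
    {v v' : Fin d → S.Zs} (hv : v ∈ S.primZs d) (hv' : v' ∈ S.primZs d)
    (h : (m : S.Zs) • v = (m' : S.Zs) • v') : m = m' ∧ v = v' := by
  obtain ⟨x, hx⟩ := dvd_of_smul_eq_smul hd hv h
  obtain ⟨y, hy⟩ := dvd_of_smul_eq_smul hd hv' h.symm
  have e := Nat.dvd_antisymm (dvd_of_mul_eq_of_mem_NS hm hy) (dvd_of_mul_eq_of_mem_NS hm' hx)
  subst e
  exact ⟨rfl, smul_right_injective _ (NS_ne_zero hm) h⟩

end Primitive

end PrimeTup

namespace PrimeTup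

section Hecke

variable {S : PrimeTup} {d : ℕ}

theorem exists_unit_of_minors_eq_zero (hd : 0 < d) {v w : Fin d → S.Zs} (hv : v ∈ S.primZs d)
    (hw : w ∈ S.primZs d) (h : ∀ i j, v i * w j = v j * w i) :
    ∃ u : (S.Zs)ˣ, w = (u : S.Zs) • v := by
  obtain ⟨i, hi⟩ := Function.ne_iff.1 (ne_zero_of_mem_primZs hd hv)
  have h1 : w i • v = v i • w := by
    ext j
    simp only [Pi.smul_apply, smul_eq_mul]
    rw [h i j, mul_comm]
  obtain ⟨x, hx⟩ := dvd_of_smul_eq_smul hd hv h1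
  have h2 : w = x • v := by
    refine smul_right_injective _ hi ?_
    simp only
    rw [← h1, hx, smul_smul]
  obtain ⟨y, hy⟩ := dvd_of_smul_eq_smul hd hw ((one_smul S.Zs w).trans h2)
  exact ⟨Units.mkOfMulEqOne x y hy.symm, h2⟩

variable {p : ℕ} [Fact p.Prime]

/-- Reduction of `ℤ_S` modulo a prime outside `S`. -/
noncomputable def red (hp : ∀ i, p ≠ S.p i) : S.Zs →+* ZMod p :=
  PadicInt.toZMod.comp (((Rat.castHom ℚ_[p]).comp S.Zs.subtype).codRestrict (PadicInt.subring p)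
    fun x => norm_le_one_of_mem_Zs x.2 hp)

theorem red_eq_zero_iff (hp : ∀ i, p ≠ S.p i) (x : S.Zs) : red hp x = 0 ↔ (p : S.Zs) ∣ x := by
  constructor
  · intro h
    obtain ⟨z, hz, h1⟩ : ∃ z : ℤ_[p], (z : ℚ_[p]) = ((x : ℚ) : ℚ_[p]) ∧
        z ∈ RingHom.ker (PadicInt.toZMod : ℤ_[p] →+* ZMod p) :=
      ⟨⟨((x : ℚ) : ℚ_[p]), norm_le_one_of_mem_Zs x.2 hp⟩, rfl, h⟩
    rw [PadicInt.ker_toZMod, IsLocalRing.mem_maximalIdeal, PadicInt.mem_nonunits] at h1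
    have h2 : ‖((x : ℚ) : ℚ_[p])‖ < 1 := hz ▸ h1
    have h3 : ‖((x : ℚ).num : ℚ_[p])‖ < 1 := by
      have : ((x : ℚ).num : ℚ_[p]) = ((x : ℚ) : ℚ_[p]) * ((x : ℚ).den : ℕ) := by
        exact_mod_cast congrArg (fun y : ℚ => (y : ℚ_[p])) (Rat.mul_den_eq_num (x : ℚ)).symm
      rw [this, norm_mul]
      refine lt_of_le_of_lt (mul_le_of_le_one_right (norm_nonneg _) ?_) h2
      exact_mod_cast Padic.norm_int_le_one (p := p) ((x : ℚ).den : ℤ)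
    obtain ⟨y, hy⟩ := Padic.norm_intCast_lt_one_iff.1 h3
    refine ⟨(y : S.Zs) * ⟨((x : ℚ).den : ℚ)⁻¹,
      inv_mem_Zs (x : ℚ).den_nz (mem_Zs_iff.1 x.2)⟩, Subtype.ext ?_⟩
    push_cast
    conv_lhs => rw [← Rat.num_div_den (x : ℚ), hy]
    push_cast
    ring
  · rintro ⟨y, rfl⟩
    rw [map_mul, map_natCast, ZMod.natCast_self, zero_mul]

theorem mem_NS_of_ne (hp : ∀ i, p ≠ S.p i) : p ∈ S.NS :=
  ⟨(Fact.out : p.Prime).pos, fun i h =>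
    hp i ((Nat.prime_dvd_prime_iff_eq (S.hp i) Fact.out).1 h).symm⟩

theorem red_ne_zero_of_mem_primZs (hd : 0 < d) (hp : ∀ i, p ≠ S.p i) {v : Fin d → S.Zs}
    (hv : v ∈ S.primZs d) : (fun j => red hp (v j)) ≠ 0 := by
  intro h
  choose y hy using fun j => (red_eq_zero_iff hp (v j)).1 (congrFun h j)
  have h1 : (1 : S.Zs) • v = (p : S.Zs) • y := by
    ext j; simp [hy j]
  exact (Fact.out : p.Prime).ne_one
    (eq_one_of_mem_NS_of_isUnit (mem_NS_of_ne hp)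
      (isUnit_of_dvd_one (dvd_of_smul_eq_smul hd hv h1)))

theorem exists_heckeMatrix (hp : ∀ i, p ≠ S.p i) {c : Fin d → ZMod p} (hc : c ≠ 0) :
    ∃ h : Matrix (Fin d) (Fin d) S.Zs, h.det = p ∧
      ∀ v, (∃ u, v = h.mulVec u) ↔ c ⬝ᵥ (fun j => red hp (v j)) = 0 := by
  obtain ⟨i, hi⟩ := Function.ne_iff.1 hc
  simp only [Pi.zero_apply] at hi
  let a : Fin d → S.Zs := fun j => if j = i then p else (((-c j / c i).val : ℕ) : S.Zs)
  have hai : a i = p := by simp [a]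
  have haj : ∀ j, j ≠ i → red hp (a j) = - c j / c i := fun j hj => by
    simp [a, hj]
  have hmul : ∀ u : Fin d → S.Zs, (updateRow (1 : Matrix (Fin d) (Fin d) S.Zs) i a).mulVec u =
      Function.update u i (a ⬝ᵥ u) := fun u => by
    ext j
    rcases eq_or_ne j i with rfl | hj
    · simp [mulVec]
    · have h1 : ((updateRow (1 : Matrix (Fin d) (Fin d) S.Zs) i a).mulVec u) j =
          ((1 : Matrix (Fin d) (Fin d) S.Zs).mulVec u) j := by
        rw [mulVec, mulVec, updateRow_ne hj]
      rw [h1, one_mulVec, Function.update_of_ne hj]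
  have hred : ∀ u : Fin d → S.Zs, c i * red hp (a ⬝ᵥ u) =
      - ∑ j ∈ Finset.univ.erase i, c j * red hp (u j) := fun u => by
    rw [dotProduct, ← Finset.add_sum_erase _ _ (Finset.mem_univ i), hai, map_add, map_mul,
      map_natCast, ZMod.natCast_self, zero_mul, zero_add, map_sum, Finset.mul_sum,
      ← Finset.sum_neg_distrib]
    refine Finset.sum_congr rfl fun j hj => ?_
    rw [map_mul, haj j (Finset.ne_of_mem_erase hj)]
    field_simp
  refine ⟨updateRow 1 i a, ?_, fun v => ?_⟩
  · have := cramer_transpose_apply (1 : Matrix (Fin d) (Fin d) S.Zs) a i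
    rw [← this, transpose_one, cramer_one, hai.symm]
    rfl
  · have hsum : c ⬝ᵥ (fun j => red hp (v j)) =
        c i * red hp (v i) + ∑ j ∈ Finset.univ.erase i, c j * red hp (v j) := by
      rw [dotProduct, ← Finset.add_sum_erase _ _ (Finset.mem_univ i)]
    constructor
    · rintro ⟨u, hu⟩
      rw [hmul] at hu
      rw [hsum]
      have h1 : v i = a ⬝ᵥ u := by rw [hu]; simp
      rw [h1, hred, neg_add_eq_zero]
      refine Finset.sum_congr rfl fun j hj => ?_
      rw [hu, Function.update_of_ne (Finset.ne_of_mem_erase hj)]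
    · intro h0
      rw [hsum] at h0
      have h1 : red hp (v i - a ⬝ᵥ Function.update v i 0) = 0 := by
        refine (mul_eq_zero.1 (?_ : c i * _ = 0)).resolve_left hi
        rw [map_sub, mul_sub, hred, sub_neg_eq_add, ← h0]
        congr 1
        refine Finset.sum_congr rfl fun j hj => ?_
        rw [Function.update_of_ne (Finset.ne_of_mem_erase hj)]
      obtain ⟨y, hy⟩ := (red_eq_zero_iff hp _).1 h1
      refine ⟨Function.update v i y, ?_⟩
      rw [hmul]
      ext j
      rcases eq_or_ne j i with rfl | hj
      · have h2 : a ⬝ᵥ Function.update v j y = p * y + a ⬝ᵥ Function.update v j 0 := by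
          rw [dotProduct, dotProduct, ← Finset.add_sum_erase _ _ (Finset.mem_univ j),
            ← Finset.add_sum_erase _ _ (Finset.mem_univ j)]
          simp only [Function.update_self, hai, mul_zero, zero_add]
          congr 1
          refine Finset.sum_congr rfl fun k hk => ?_
          rw [Function.update_of_ne (Finset.ne_of_mem_erase hk),
            Function.update_of_ne (Finset.ne_of_mem_erase hk)]
        rw [Function.update_self, h2, ← hy, sub_add_cancel]
      · simp [hj]

/-- A matrix of determinant `p` whose image is the sublattice `{v | c · v ≡ 0 mod p}`. -/
noncomputable def heckeMatrix (hp : ∀ i, p ≠ S.p i) (c : {c : Fin d → ZMod p // c ≠ 0}) :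
    Matrix (Fin d) (Fin d) S.Zs :=
  (exists_heckeMatrix hp c.2).choose

theorem det_heckeMatrix (hp : ∀ i, p ≠ S.p i) (c : {c : Fin d → ZMod p // c ≠ 0}) :
    (heckeMatrix hp c).det = p := (exists_heckeMatrix hp c.2).choose_spec.1

theorem exists_eq_heckeMatrix_mulVec_iff (hp : ∀ i, p ≠ S.p i)
    (c : {c : Fin d → ZMod p // c ≠ 0}) (v : Fin d → S.Zs) :
    (∃ u, v = (heckeMatrix hp c).mulVec u) ↔ c.1 ⬝ᵥ (fun j => red hp (v j)) = 0 :=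
  (exists_heckeMatrix hp c.2).choose_spec.2 v

theorem p_ne_zero_Zs : (p : S.Zs) ≠ 0 := by
  have := (Fact.out : p.Prime).ne_zero
  exact_mod_cast this

theorem heckeMatrix_mulVec_injective (hp : ∀ i, p ≠ S.p i)
    (c : {c : Fin d → ZMod p // c ≠ 0}) :
    Function.Injective fun v : Fin d → S.Zs => (heckeMatrix hp c).mulVec v :=
  mulVec_injective_of_det_ne_zero (by rw [det_heckeMatrix]; exact p_ne_zero_Zs)

theorem vecMul_SL_vecMul_inv {R : Type*} [CommRing R] (γ : SpecialLinearGroup (Fin d) R)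
    (c : Fin d → R) :
    vecMul (vecMul c (γ : Matrix (Fin d) (Fin d) R))
      ((γ⁻¹ : SpecialLinearGroup (Fin d) R) : Matrix (Fin d) (Fin d) R) = c := by
  rw [vecMul_vecMul, ← Matrix.SpecialLinearGroup.coe_mul, mul_inv_cancel,
    Matrix.SpecialLinearGroup.coe_one, vecMul_one]

theorem vecMul_SL_ne_zero {R : Type*} [CommRing R] (γ : SpecialLinearGroup (Fin d) R)
    {c : Fin d → R} (hc : c ≠ 0) : vecMul c (γ : Matrix (Fin d) (Fin d) R) ≠ 0 := fun h => by
  have := vecMul_SL_vecMul_inv γ c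
  rw [h, zero_vecMul] at this
  exact hc this.symm

/-- The permutation of the hyperplanes modulo `p` induced by an element of `SL_d(ℤ_S)`. -/
noncomputable def hyperplaneEquiv (hp : ∀ i, p ≠ S.p i) (γ : SpecialLinearGroup (Fin d) S.Zs) :
    {c : Fin d → ZMod p // c ≠ 0} ≃ {c : Fin d → ZMod p // c ≠ 0} where
  toFun c := ⟨vecMul c.1 (SpecialLinearGroup.map (red hp) γ⁻¹).1,
    vecMul_SL_ne_zero _ c.2⟩
  invFun c := ⟨vecMul c.1 (SpecialLinearGroup.map (red hp) γ).1,
    vecMul_SL_ne_zero _ c.2⟩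
  left_inv c := Subtype.ext (by
    simp only [map_inv]
    simpa using vecMul_SL_vecMul_inv (SpecialLinearGroup.map (red hp) γ)⁻¹ c.1)
  right_inv c := Subtype.ext (by
    simp only [map_inv]
    exact vecMul_SL_vecMul_inv (SpecialLinearGroup.map (red hp) γ) c.1)

theorem hyperplaneEquiv_dotProduct (hp : ∀ i, p ≠ S.p i) (γ : SpecialLinearGroup (Fin d) S.Zs)
    (c : {c : Fin d → ZMod p // c ≠ 0}) (v : Fin d → S.Zs) :
    (hyperplaneEquiv hp γ c).1 ⬝ᵥ
      (fun j => red hp ((γ : Matrix (Fin d) (Fin d) S.Zs).mulVec v j)) =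
    c.1 ⬝ᵥ (fun j => red hp (v j)) := by
  have h1 : (fun j => red hp ((γ : Matrix (Fin d) (Fin d) S.Zs).mulVec v j)) =
      (SpecialLinearGroup.map (red hp) γ : Matrix (Fin d) (Fin d) (ZMod p)).mulVec
        (fun j => red hp (v j)) := by
    ext j
    exact RingHom.map_mulVec (red hp) _ _ _
  rw [h1, dotProduct_mulVec]
  congr 1
  exact congrArg Subtype.val ((hyperplaneEquiv hp γ).left_inv c)

theorem exists_mul_heckeMatrix (hp : ∀ i, p ≠ S.p i) (γ : SpecialLinearGroup (Fin d) S.Zs)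
    (c : {c : Fin d → ZMod p // c ≠ 0}) :
    ∃ δ : SpecialLinearGroup (Fin d) S.Zs, (γ : Matrix (Fin d) (Fin d) S.Zs) * heckeMatrix hp c =
      heckeMatrix hp (hyperplaneEquiv hp γ c) * (δ : Matrix (Fin d) (Fin d) S.Zs) := by
  have h1 : ∀ u, ∃ u', (γ : Matrix (Fin d) (Fin d) S.Zs).mulVec ((heckeMatrix hp c).mulVec u) =
      (heckeMatrix hp (hyperplaneEquiv hp γ c)).mulVec u' := fun u => by
    rw [exists_eq_heckeMatrix_mulVec_iff, hyperplaneEquiv_dotProduct,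
      ← exists_eq_heckeMatrix_mulVec_iff]
    exact ⟨u, rfl⟩
  choose δ hδ using fun j => h1 (Pi.single j 1)
  have h2 : (γ : Matrix (Fin d) (Fin d) S.Zs) * heckeMatrix hp c =
      heckeMatrix hp (hyperplaneEquiv hp γ c) * (Matrix.of δ)ᵀ := by
    refine Matrix.ext fun i j => ?_
    have := congrFun (hδ j) i
    rw [mulVec_mulVec, mulVec_single_one] at this
    exact this
  refine ⟨⟨(Matrix.of δ)ᵀ, ?_⟩, h2⟩
  have h3 := congrArg det h2
  rw [det_mul, det_mul, det_heckeMatrix, det_heckeMatrix, γ.det_coe, one_mul] at h3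
  exact mul_left_cancel₀ p_ne_zero_Zs (h3.symm.trans (mul_one _).symm)

theorem exists_prim_eq_heckeMatrix_mulVec (hd : 2 ≤ d) (hp : ∀ i, p ≠ S.p i)
    (c : {c : Fin d → ZMod p // c ≠ 0}) {w : Fin d → S.Zs} (hw : w ∈ S.primZs d)
    (h : c.1 ⬝ᵥ (fun j => red hp (w j)) = 0) :
    ∃ v ∈ S.primZs d, w = (heckeMatrix hp c).mulVec v := by
  obtain ⟨u, rfl⟩ := (exists_eq_heckeMatrix_mulVec_iff hp c w).2 h
  have hu : u ≠ 0 := by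
    rintro rfl
    exact ne_zero_of_mem_primZs (by omega) hw (mulVec_zero _)
  obtain ⟨m, hm, v, hv, rfl⟩ := exists_NS_smul_prim hd hu
  have h1 : m = 1 := by
    refine eq_one_of_mem_NS_of_isUnit hm (isUnit_of_dvd_one ?_)
    refine dvd_of_smul_eq_smul (w := (heckeMatrix hp c).mulVec v) (by omega) hw ?_
    rw [one_smul, mulVec_smul]
  subst h1
  exact ⟨v, hv, by simp⟩

theorem prim_or_eq_smul_of_heckeMatrix_mulVec (hd : 2 ≤ d) (hp : ∀ i, p ≠ S.p i)
    (c : {c : Fin d → ZMod p // c ≠ 0}) {v : Fin d → S.Zs} (hv : v ∈ S.primZs d) :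
    (heckeMatrix hp c).mulVec v ∈ S.primZs d ∨
      ∃ w ≠ 0, (heckeMatrix hp c).mulVec v = (p : S.Zs) • w := by
  have h0 : (heckeMatrix hp c).mulVec v ≠ 0 := fun h =>
    ne_zero_of_mem_primZs (by omega) hv (heckeMatrix_mulVec_injective hp c
      (h.trans (mulVec_zero _).symm))
  obtain ⟨m, hm, w, hw, h⟩ := exists_NS_smul_prim hd h0
  have h1 : (p : S.Zs) • v = (m : S.Zs) • ((heckeMatrix hp c).adjugate.mulVec w) := by
    rw [← mulVec_smul, ← h, mulVec_mulVec, adjugate_mul, det_heckeMatrix, smul_mulVec, one_mulVec]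
  obtain ⟨x, hx⟩ := dvd_of_smul_eq_smul (by omega) hv h1
  have h2 : m ∣ p := dvd_of_mul_eq_of_mem_NS hm hx
  rcases (Nat.dvd_prime (Fact.out : p.Prime)).1 h2 with rfl | rfl
  · left
    rw [h]; simpa using hw
  · exact Or.inr ⟨w, ne_zero_of_mem_primZs (by omega) hw, h⟩

end Hecke

end PrimeTup

section FiniteCount

variable {d p : ℕ} [Fact p.Prime]

theorem card_ker_mul_card_of_surjective {A B : Type*} [AddCommGroup A] [AddCommGroup B]
    (f : A →+ B) (hf : Function.Surjective f) : Nat.card f.ker * Nat.card B = Nat.card A := by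
  rw [f.ker.card_eq_card_quotient_mul_card_addSubgroup,
    Nat.card_congr (QuotientAddGroup.quotientKerEquivOfSurjective f hf).toEquiv, mul_comm]

theorem card_filter_ne_zero_add_one {A : Type*} [AddCommGroup A] [Fintype A] [DecidableEq A]
    {B : Type*} [AddCommGroup B] (f : A →+ B) [DecidablePred fun c : {c : A // c ≠ 0} => f c = 0] :
    (Finset.univ.filter fun c : {c : A // c ≠ 0} => f c = 0).card + 1 = Nat.card f.ker := by
  classical
  have h1 : Nat.card f.ker = (Finset.univ.filter fun c : A => f c = 0).card := by
    rw [← Fintype.card_subtype, ← Nat.card_eq_fintype_card]; rfl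
  rw [h1]
  have h2 : (Finset.univ.filter fun c : A => f c = 0) =
      insert 0 ((Finset.univ.filter fun c : {c : A // c ≠ 0} => f c = 0).map
        (Function.Embedding.subtype _)) := by
    ext c
    by_cases hc : c = 0 <;> simp [hc]
  rw [h2, Finset.card_insert_of_notMem (by simp), Finset.card_map]

theorem card_dotProduct_eq_zero (hd : 1 ≤ d) {a : Fin d → ZMod p} (ha : a ≠ 0) :
    (Finset.univ.filter fun c : {c : Fin d → ZMod p // c ≠ 0} => c.1 ⬝ᵥ a = 0).card + 1 =
      p ^ (d - 1) := by
  obtain ⟨i, hi⟩ := Function.ne_iff.1 ha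
  let f : (Fin d → ZMod p) →+ ZMod p :=
    { toFun := fun c => c ⬝ᵥ a, map_zero' := zero_dotProduct a,
      map_add' := fun x y => add_dotProduct x y a }
  have hf : Function.Surjective f := fun t => ⟨Pi.single i (t / a i), by
    simp only [f, AddMonoidHom.coe_mk, ZeroHom.coe_mk, single_dotProduct]
    exact div_mul_cancel₀ _ hi⟩
  have h := card_ker_mul_card_of_surjective f hf
  have h2 := card_filter_ne_zero_add_one f
  rw [Nat.card_zmod, Nat.card_eq_fintype_card (α := Fin d → ZMod p), Fintype.card_fun,
    ZMod.card, Fintype.card_fin] at h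
  refine h2.trans (Nat.eq_of_mul_eq_mul_right (Fact.out : p.Prime).pos (h.trans ?_))
  rw [← pow_succ, Nat.sub_add_cancel hd]

theorem card_dotProduct_eq_zero_and (hd : 2 ≤ d) {a b : Fin d → ZMod p} {i j : Fin d}
    (hij : a i * b j ≠ a j * b i) :
    (Finset.univ.filter fun c : {c : Fin d → ZMod p // c ≠ 0} =>
      c.1 ⬝ᵥ a = 0 ∧ c.1 ⬝ᵥ b = 0).card + 1 = p ^ (d - 2) := by
  have hD : a i * b j - a j * b i ≠ 0 := sub_ne_zero.2 hij
  let f : (Fin d → ZMod p) →+ ZMod p × ZMod p :=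
    { toFun := fun c => (c ⬝ᵥ a, c ⬝ᵥ b), map_zero' := by simp,
      map_add' := fun x y => by simp [add_dotProduct] }
  have hf : Function.Surjective f := fun ⟨s, t⟩ =>
    ⟨Pi.single i ((s * b j - t * a j) / (a i * b j - a j * b i)) +
      Pi.single j ((t * a i - s * b i) / (a i * b j - a j * b i)), by
    simp only [f, AddMonoidHom.coe_mk, ZeroHom.coe_mk, single_dotProduct, add_dotProduct]
    refine Prod.ext ?_ ?_ <;> dsimp only <;>
      rw [div_mul_eq_mul_div, div_mul_eq_mul_div, ← add_div, div_eq_iff hD] <;>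
      ring⟩
  have h := card_ker_mul_card_of_surjective f hf
  have h2 := card_filter_ne_zero_add_one f
  rw [Nat.card_prod, Nat.card_zmod, Nat.card_eq_fintype_card (α := Fin d → ZMod p),
    Fintype.card_fun, ZMod.card, Fintype.card_fin] at h
  simp only [f, AddMonoidHom.coe_mk, ZeroHom.coe_mk, Prod.mk_eq_zero] at h2
  refine h2.trans (Nat.eq_of_mul_eq_mul_right (Nat.mul_pos (Fact.out : p.Prime).pos
    (Fact.out : p.Prime).pos) (h.trans ?_))
  rw [← pow_two, ← pow_add, Nat.sub_add_cancel hd]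

theorem card_subtype_ne_zero (d : ℕ) :
    Fintype.card {c : Fin d → ZMod p // c ≠ 0} + 1 = p ^ d := by
  have h := card_filter_ne_zero_add_one (0 : (Fin d → ZMod p) →+ ZMod p)
  simpa [Fintype.card_fun, ZMod.card, Finset.card_univ] using h

end FiniteCount

namespace PrimeTup

section Discrete

variable {S : PrimeTup} {d : ℕ}

@[simp] theorem toG_fst (γ : SpecialLinearGroup (Fin d) S.Zs) (i j : Fin d) :
    ((S.toG d γ).1 : Matrix (Fin d) (Fin d) ℝ) i j = ((γ i j : ℚ) : ℝ) := rfl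

@[simp] theorem toG_snd (γ : SpecialLinearGroup (Fin d) S.Zs) (q : Fin S.s) (i j : Fin d) :
    ((S.toG d γ).2 q : Matrix (Fin d) (Fin d) (S.Qp q)) i j = ((γ i j : ℚ) : S.Qp q) := rfl

theorem exists_nhds_one_inter_Gamma (S : PrimeTup) (d : ℕ) :
    ∃ U ∈ nhds (1 : S.G d), ∀ γ ∈ S.Gamma d, γ ∈ U → γ = 1 := by
  refine ⟨{g | (∀ i j, |(g.1 : Matrix (Fin d) (Fin d) ℝ) i j -
      (1 : Matrix (Fin d) (Fin d) ℝ) i j| < 1) ∧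
    ∀ q i j, ‖(g.2 q : Matrix (Fin d) (Fin d) (S.Qp q)) i j -
      (1 : Matrix (Fin d) (Fin d) (S.Qp q)) i j‖ < 1}, ?_, ?_⟩
  · refine Filter.Eventually.and ?_ ?_
    · refine Filter.eventually_all.2 fun i => Filter.eventually_all.2 fun j => ?_
      refine Filter.Tendsto.eventually_lt_const (u := 1) (v := 0) one_pos ?_
      refine ((((continuous_subtype_val.comp continuous_fst).matrix_elem i j).sub
        continuous_const).abs.tendsto' (1 : S.G d) _ ?_)
      exact (congrArg abs (sub_self ((1 : Matrix (Fin d) (Fin d) ℝ) i j))).trans abs_zero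
    · refine Filter.eventually_all.2 fun q => Filter.eventually_all.2 fun i =>
        Filter.eventually_all.2 fun j => ?_
      refine Filter.Tendsto.eventually_lt_const (u := 1) (v := 0) one_pos ?_
      refine ((((continuous_subtype_val.comp ((continuous_apply q).comp
        continuous_snd)).matrix_elem i j).sub continuous_const).norm.tendsto' (1 : S.G d) _ ?_)
      exact (congrArg norm (sub_self ((1 : Matrix (Fin d) (Fin d) (S.Qp q)) i j))).trans norm_zero
  · rintro _ ⟨γ, rfl⟩ ⟨h1, h2⟩
    suffices γ = 1 by rw [this, map_one]
    refine Subtype.ext (Matrix.ext fun i j => Subtype.ext ?_)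
    have hden : ((γ i j : S.Zs) : ℚ).den = 1 := by
      refine den_eq_one_of_norm_le_one (γ i j).2 fun q => ?_
      have h3 := h2 q i j
      rw [toG_snd] at h3
      have h4 : ‖(1 : Matrix (Fin d) (Fin d) (S.Qp q)) i j‖ ≤ 1 := by
        rw [Matrix.one_apply]; split_ifs <;> simp
      have h5 := IsUltrametricDist.norm_add_le_max
        (((γ i j : ℚ) : S.Qp q) - (1 : Matrix (Fin d) (Fin d) (S.Qp q)) i j)
        ((1 : Matrix (Fin d) (Fin d) (S.Qp q)) i j)
      rw [sub_add_cancel] at h5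
      exact h5.trans (max_le h3.le h4)
    have h3 := h1 i j
    rw [toG_fst] at h3
    have h4 : ((γ i j : S.Zs) : ℚ) = (((γ i j : S.Zs) : ℚ).num : ℚ) :=
      (Rat.coe_int_num_of_den_eq_one hden).symm
    have h5 : (((γ i j : S.Zs) : ℚ).num - (if i = j then 1 else 0 : ℤ)) = 0 := by
      rw [← Int.abs_lt_one_iff]
      have : ((|((γ i j : S.Zs) : ℚ).num - (if i = j then 1 else 0 : ℤ)| : ℤ) : ℝ) < 1 := by
        rw [h4, Matrix.one_apply] at h3
        push_cast at h3 ⊢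
        exact h3
      exact_mod_cast this
    change ((γ i j : S.Zs) : ℚ) = ((1 : Matrix (Fin d) (Fin d) S.Zs) i j : ℚ)
    rw [h4, sub_eq_zero.1 h5, Matrix.one_apply]
    split_ifs <;> simp

theorem admissible_unique {μ μ' : Measure (S.G d ⧸ S.Gamma d)} [IsProbabilityMeasure μ]
    [IsProbabilityMeasure μ'] [SMulInvariantMeasure (S.G d) (S.G d ⧸ S.Gamma d) μ]
    [SMulInvariantMeasure (S.G d) (S.G d ⧸ S.Gamma d) μ'] : μ = μ' := by
  obtain ⟨U, hU, h⟩ := exists_nhds_one_inter_Gamma S d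
  exact eq_of_smulInvariant_of_isProbability hU h μ μ'

end Discrete

end PrimeTup

section Averaging

open Filter Topology ENNReal

/-- If `μ` is stationary for a sequence of Markov kernels `κ n` and the averages of `φ ≥ 0` converge
pointwise to a finite constant `L`, then `φ` has integral `L`. -/
theorem lintegral_eq_of_tendsto_average {X : Type*} [MeasurableSpace X] (μ : Measure X)
    [IsProbabilityMeasure μ] (κ : ℕ → X → Measure X) (hκ : ∀ n, Measurable (κ n))
    [∀ n x, IsProbabilityMeasure (κ n x)] (hμ : ∀ n, μ.bind (κ n) = μ) {φ : X → ℝ≥0∞}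
    (hφ : Measurable φ) {L : ℝ≥0∞} (hL : ∀ x, Tendsto (fun n => ∫⁻ y, φ y ∂κ n x) atTop (𝓝 L)) :
    ∫⁻ x, φ x ∂μ = L := by
  have hintg : ∀ n {ψ : X → ℝ≥0∞}, Measurable ψ →
      ∫⁻ x, ψ x ∂μ = ∫⁻ x, ∫⁻ y, ψ y ∂κ n x ∂μ := fun n ψ hψ => by
    conv_lhs => rw [← hμ n]
    exact Measure.lintegral_bind (hκ n).aemeasurable hψ.aemeasurable
  have hmeas : ∀ n {ψ : X → ℝ≥0∞}, Measurable ψ → Measurable fun x => ∫⁻ y, ψ y ∂κ n x :=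
    fun n ψ hψ => (Measure.measurable_lintegral hψ).comp (hκ n)
  refine le_antisymm ?_ ?_
  · have h1 : ∀ M : ℕ, ∫⁻ x, min (φ x) M ∂μ ≤ L := fun M => by
      have h2 : ∀ n, ∫⁻ x, min (φ x) M ∂μ ≤ ∫⁻ x, min (∫⁻ y, φ y ∂κ n x) M ∂μ := fun n => by
        rw [hintg n (hφ.min measurable_const)]
        refine lintegral_mono fun x => le_min (lintegral_mono fun y => min_le_left _ _) ?_
        calc ∫⁻ y, min (φ y) M ∂κ n x ≤ ∫⁻ _, M ∂κ n x := lintegral_mono fun y => min_le_right _ _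
          _ = M := by simp
      have h3 : Tendsto (fun n => ∫⁻ x, min (∫⁻ y, φ y ∂κ n x) M ∂μ) atTop
          (𝓝 (∫⁻ _, min L M ∂μ)) := by
        refine tendsto_lintegral_of_dominated_convergence (fun _ => (M : ℝ≥0∞))
          (fun n => (hmeas n hφ).min measurable_const)
          (fun n => ae_of_all _ fun x => min_le_right _ _)
          (by simp) (ae_of_all _ fun x => (hL x).min tendsto_const_nhds)
      refine (ge_of_tendsto' h3 h2).trans ?_
      simp
    have h2 : ∫⁻ x, φ x ∂μ = ⨆ M : ℕ, ∫⁻ x, min (φ x) M ∂μ := by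
      rw [← lintegral_iSup (fun M => hφ.min measurable_const)
        (fun i j h x => min_le_min_left _ (by exact_mod_cast h))]
      refine lintegral_congr fun x => ?_
      have : (⨆ M : ℕ, min (φ x) (M : ℝ≥0∞)) = min (φ x) (⨆ M : ℕ, (M : ℝ≥0∞)) :=
        (inf_iSup_eq _ _).symm
      rw [this, ENNReal.iSup_natCast, min_eq_left le_top]
    rw [h2]
    exact iSup_le h1
  · calc L = ∫⁻ x, liminf (fun n => ∫⁻ y, φ y ∂κ n x) atTop ∂μ := by
          simp [(hL _).liminf_eq]
      _ ≤ liminf (fun n => ∫⁻ x, ∫⁻ y, φ y ∂κ n x ∂μ) atTop :=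
          lintegral_liminf_le fun n => hmeas n hφ
      _ = ∫⁻ x, φ x ∂μ := by simp [← hintg _ hφ]

end Averaging

namespace PrimeTup

section HeckeOperator

open scoped ENNReal

variable {S : PrimeTup} {d : ℕ}

/-- The diagonal embedding of `ℤ_S^d`. -/
noncomputable def dg (w : Fin d → S.Zs) : S.QS d := S.diag fun j => (w j : ℚ)

/-- Componentwise scaling on `ℚ_S^d` by a scalar of `ℚ_S`. -/
noncomputable def scale (t : ℝ × ((i : Fin S.s) → S.Qp i)) (x : S.QS d) : S.QS d :=
  (t.1 • x.1, fun i => t.2 i • x.2 i)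

/-- A scalar `t ∈ ℚ_S` with `t ^ d * p = 1`, positive at infinity and a unit at the
primes of `S`. -/
structure IsHeckeScalar (S : PrimeTup) (d p : ℕ) (t : ℝ × ((i : Fin S.s) → S.Qp i)) : Prop where
  pos : 0 < t.1
  pow_mul : t.1 ^ d * p = 1
  norm_eq : ∀ i, ‖t.2 i‖ = 1
  pow_mul' : ∀ i, t.2 i ^ d * (p : S.Qp i) = 1

variable {p : ℕ} [Fact p.Prime] {t : ℝ × ((i : Fin S.s) → S.Qp i)}

/-- The elements of `G_d` defining the Hecke operator at `p`. -/
noncomputable def heckeElt (hp : ∀ i, p ≠ S.p i) (ht : S.IsHeckeScalar d p t)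
    (c : {c : Fin d → ZMod p // c ≠ 0}) : S.G d :=
  (⟨t.1 • (heckeMatrix hp c).map ((Rat.castHom ℝ).comp S.Zs.subtype), by
      rw [det_smul, ← RingHom.mapMatrix_apply, ← RingHom.map_det, det_heckeMatrix, map_natCast,
        Fintype.card_fin, ht.pow_mul]⟩,
    fun i => ⟨t.2 i • (heckeMatrix hp c).map ((Rat.castHom (S.Qp i)).comp S.Zs.subtype), by
      rw [det_smul, ← RingHom.mapMatrix_apply, ← RingHom.map_det, det_heckeMatrix, map_natCast,
        Fintype.card_fin, ht.pow_mul']⟩)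

theorem act_mul (g h : S.G d) (x : S.QS d) : S.act (g * h) x = S.act g (S.act h x) := by
  refine Prod.ext ?_ (funext fun i => ?_)
  · exact (mulVec_mulVec x.1 (g.1 : Matrix (Fin d) (Fin d) ℝ) h.1).symm
  · exact (mulVec_mulVec (x.2 i) (g.2 i : Matrix (Fin d) (Fin d) (S.Qp i)) (h.2 i)).symm

theorem act_one (x : S.QS d) : S.act 1 x = x := by
  refine Prod.ext ?_ (funext fun i => ?_)
  · exact one_mulVec _
  · exact one_mulVec _

theorem act_scale (g : S.G d) (x : S.QS d) : S.act g (scale t x) = scale t (S.act g x) := by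
  refine Prod.ext ?_ (funext fun i => ?_)
  · exact mulVec_smul (g.1 : Matrix (Fin d) (Fin d) ℝ) t.1 x.1
  · exact mulVec_smul (g.2 i : Matrix (Fin d) (Fin d) (S.Qp i)) (t.2 i) (x.2 i)

theorem act_toG_dg (γ : SpecialLinearGroup (Fin d) S.Zs) (w : Fin d → S.Zs) :
    S.act (S.toG d γ) (dg w) = dg ((γ : Matrix (Fin d) (Fin d) S.Zs).mulVec w) := by
  refine Prod.ext ?_ (funext fun i => ?_)
  · exact funext fun j => (RingHom.map_mulVec ((Rat.castHom ℝ).comp S.Zs.subtype) γ.1 w j).symm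
  · exact funext fun j =>
      (RingHom.map_mulVec ((Rat.castHom (S.Qp i)).comp S.Zs.subtype) γ.1 w j).symm

theorem act_heckeElt_dg (hp : ∀ i, p ≠ S.p i) (ht : S.IsHeckeScalar d p t)
    (c : {c : Fin d → ZMod p // c ≠ 0}) (w : Fin d → S.Zs) :
    S.act (heckeElt hp ht c) (dg w) = scale t (dg ((heckeMatrix hp c).mulVec w)) := by
  refine Prod.ext ?_ (funext fun i => ?_)
  · refine funext fun j => ?_
    refine (congrFun (smul_mulVec t.1 ((heckeMatrix hp c).map
      ((Rat.castHom ℝ).comp S.Zs.subtype)) (dg w).1) j).trans (congrArg (t.1 * ·) ?_)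
    exact (RingHom.map_mulVec ((Rat.castHom ℝ).comp S.Zs.subtype) _ w j).symm
  · refine funext fun j => ?_
    refine (congrFun (smul_mulVec (t.2 i) ((heckeMatrix hp c).map
      ((Rat.castHom (S.Qp i)).comp S.Zs.subtype)) ((dg w).2 i)) j).trans (congrArg (t.2 i * ·) ?_)
    exact (RingHom.map_mulVec ((Rat.castHom (S.Qp i)).comp S.Zs.subtype) _ w j).symm

theorem toG_mul_heckeElt (hp : ∀ i, p ≠ S.p i) (ht : S.IsHeckeScalar d p t)
    (γ : SpecialLinearGroup (Fin d) S.Zs) (c : {c : Fin d → ZMod p // c ≠ 0}) :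
    ∃ δ : SpecialLinearGroup (Fin d) S.Zs, S.toG d γ * heckeElt hp ht c =
      heckeElt hp ht (hyperplaneEquiv hp γ c) * S.toG d δ := by
  obtain ⟨δ, hδ⟩ := exists_mul_heckeMatrix hp γ c
  refine ⟨δ, Prod.ext (Subtype.ext ?_) (funext fun i => Subtype.ext ?_)⟩
  · have h := congrArg (fun M => t.1 • ((Rat.castHom ℝ).comp S.Zs.subtype).mapMatrix M) hδ
    simp only [map_mul] at h
    refine (Matrix.mul_smul _ _ _).trans (h.trans (Matrix.smul_mul _ _ _).symm)
  · have h := congrArg (fun M => t.2 i • ((Rat.castHom (S.Qp i)).comp S.Zs.subtype).mapMatrix M) hδ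
    simp only [map_mul] at h
    refine (Matrix.mul_smul _ _ _).trans (h.trans (Matrix.smul_mul _ _ _).symm)

theorem heckeElt_equivariant (hp : ∀ i, p ≠ S.p i) (ht : S.IsHeckeScalar d p t) (g : S.G d)
    (γ : S.G d) (hγ : γ ∈ S.Gamma d) :
    ∃ e : {c : Fin d → ZMod p // c ≠ 0} ≃ {c : Fin d → ZMod p // c ≠ 0}, ∀ c,
      (QuotientGroup.mk (g * γ * heckeElt hp ht c) : S.G d ⧸ S.Gamma d) =
        QuotientGroup.mk (g * heckeElt hp ht (e c)) := by
  obtain ⟨γ, rfl⟩ := hγ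
  refine ⟨hyperplaneEquiv hp γ, fun c => ?_⟩
  obtain ⟨δ, hδ⟩ := toG_mul_heckeElt hp ht γ c
  rw [mul_assoc, hδ, ← mul_assoc]
  exact QuotientGroup.mk_mul_of_mem _ ⟨δ, rfl⟩

/-- The Markov kernel of the Hecke operator at `p`. -/
noncomputable def heckeKernel (hp : ∀ i, p ≠ S.p i) (ht : S.IsHeckeScalar d p t)
    (x : S.G d ⧸ S.Gamma d) : Measure (S.G d ⧸ S.Gamma d) :=
  (Fintype.card {c : Fin d → ZMod p // c ≠ 0} : ℝ≥0∞)⁻¹ •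
    cosetSum (S.Gamma d) (fun (c : {c : Fin d → ZMod p // c ≠ 0}) (g : S.G d) =>
      (QuotientGroup.mk (g * heckeElt hp ht c) : S.G d ⧸ S.Gamma d)) x

theorem measurable_heckeElt (hp : ∀ i, p ≠ S.p i) (ht : S.IsHeckeScalar d p t)
    (c : {c : Fin d → ZMod p // c ≠ 0}) : Measurable fun g : S.G d =>
      (QuotientGroup.mk (g * heckeElt hp ht c) : S.G d ⧸ S.Gamma d) :=
  measurable_quotient_mk''.comp (measurable_mul_const _)

theorem measurable_heckeKernel (hp : ∀ i, p ≠ S.p i) (ht : S.IsHeckeScalar d p t) :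
    Measurable (heckeKernel hp ht) :=
  Measure.measurable_of_measurable_coe _ fun _ hs => ((Measure.measurable_coe hs).comp
    (measurable_cosetSum _ (measurable_heckeElt hp ht) (heckeElt_equivariant hp ht))).const_mul _

theorem lintegral_heckeKernel (hp : ∀ i, p ≠ S.p i) (ht : S.IsHeckeScalar d p t)
    {φ : S.G d ⧸ S.Gamma d → ℝ≥0∞} (hφ : Measurable φ) (g : S.G d) :
    ∫⁻ y, φ y ∂heckeKernel hp ht (QuotientGroup.mk g) =
      (Fintype.card {c : Fin d → ZMod p // c ≠ 0} : ℝ≥0∞)⁻¹ *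
        ∑ c, φ (QuotientGroup.mk (g * heckeElt hp ht c)) := by
  rw [heckeKernel, lintegral_smul_measure, smul_eq_mul,
    lintegral_cosetSum_mk _ (heckeElt_equivariant hp ht) g hφ, tsum_fintype]

theorem isProbabilityMeasure_heckeKernel (hd : 0 < d) (hp : ∀ i, p ≠ S.p i)
    (ht : S.IsHeckeScalar d p t) (x : S.G d ⧸ S.Gamma d) :
    IsProbabilityMeasure (heckeKernel hp ht x) := by
  obtain ⟨g, rfl⟩ := QuotientGroup.mk_surjective x
  refine ⟨?_⟩
  rw [← lintegral_one, lintegral_heckeKernel hp ht measurable_const]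
  have h := card_subtype_ne_zero (p := p) d
  have h2 : 1 < p ^ d := Nat.one_lt_pow hd.ne' (Fact.out : p.Prime).one_lt
  rw [Finset.sum_const, Finset.card_univ, nsmul_one]
  refine ENNReal.inv_mul_cancel ?_ (ENNReal.natCast_ne_top _)
  exact_mod_cast (by omega)

theorem bind_heckeKernel (hd : 0 < d) (hp : ∀ i, p ≠ S.p i) (ht : S.IsHeckeScalar d p t)
    (μ : Measure (S.G d ⧸ S.Gamma d)) [IsProbabilityMeasure μ]
    [SMulInvariantMeasure (S.G d) (S.G d ⧸ S.Gamma d) μ] : μ.bind (heckeKernel hp ht) = μ := by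
  have hk := measurable_heckeKernel hp ht
  have hP := isProbabilityMeasure_heckeKernel hd hp ht
  have h1 : μ.bind (heckeKernel hp ht) =
      (Fintype.card {c : Fin d → ZMod p // c ≠ 0} : ℝ≥0∞)⁻¹ • μ.bind (cosetSum (S.Gamma d)
        (fun (c : {c : Fin d → ZMod p // c ≠ 0}) (g : S.G d) =>
          (QuotientGroup.mk (g * heckeElt hp ht c) : S.G d ⧸ S.Gamma d))) := by
    ext s hs
    rw [Measure.bind_apply hs hk.aemeasurable, Measure.smul_apply, Measure.bind_apply hs
      (measurable_cosetSum _ (measurable_heckeElt hp ht) (heckeElt_equivariant hp ht)).aemeasurable,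
      smul_eq_mul]
    exact lintegral_const_mul _ ((Measure.measurable_coe hs).comp
      (measurable_cosetSum _ (measurable_heckeElt hp ht) (heckeElt_equivariant hp ht)))
  have : IsProbabilityMeasure (μ.bind (heckeKernel hp ht)) := ⟨by
    rw [Measure.bind_apply MeasurableSet.univ hk.aemeasurable]
    simp⟩
  have : SMulInvariantMeasure (S.G d) (S.G d ⧸ S.Gamma d) (μ.bind (heckeKernel hp ht)) := by
    refine ⟨fun a s hs => ?_⟩
    have h2 := map_bind_cosetSum μ _ (measurable_heckeElt hp ht) (heckeElt_equivariant hp ht) a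
      (fun x => a • x) (measurable_smul_quotient a) (fun c g => by
        rw [MulAction.Quotient.smul_mk, smul_eq_mul, mul_assoc])
    conv_rhs => rw [h1, ← h2]
    rw [h1, Measure.smul_apply, Measure.smul_apply,
      Measure.map_apply (measurable_smul_quotient a) hs]
  exact admissible_unique

end HeckeOperator

end PrimeTup

namespace PrimeTup

section HeckeScalar

open Polynomial in
theorem exists_padic_root {q : ℕ} [Fact q.Prime] {d p : ℕ} (hd : 0 < d) (hqp : q ≠ p)
    (hp : p.Prime) (h : p ≡ 1 [MOD d ^ 2 * q]) :
    ∃ u : ℚ_[q], ‖u‖ = 1 ∧ u ^ d * (p : ℚ_[q]) = 1 := by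
  obtain ⟨z, hz, -⟩ := hensels_lemma (p := q) (R := ℤ_[q])
    (F := (X ^ d - C (p : ℤ_[q]))) (a := (1 : ℤ_[q])) (by
      obtain ⟨m, hm⟩ := (Nat.modEq_iff_dvd.1 h)
      have h1 : (aeval (1 : ℤ_[q])) (X ^ d - C (p : ℤ_[q])) = (d : ℤ_[q]) ^ 2 * q * m := by
        have : ((1 - p : ℤ) : ℤ_[q]) = ((d ^ 2 * q * m : ℤ) : ℤ_[q]) := by
          exact_mod_cast congrArg (fun x : ℤ => (x : ℤ_[q])) hm
        simpa using this
      have h2 : (aeval (1 : ℤ_[q])) (derivative (X ^ d - C (p : ℤ_[q]))) = (d : ℤ_[q]) := by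
        simp [derivative_X_pow]
      rw [h1, h2, norm_mul, norm_mul, norm_pow]
      have h3 : ‖(d : ℤ_[q])‖ ≠ 0 := norm_ne_zero_iff.2 (by exact_mod_cast hd.ne')
      have h4 : 0 < ‖(d : ℤ_[q])‖ ^ 2 := by positivity
      have h5 : ‖(q : ℤ_[q])‖ < 1 := by
        rw [PadicInt.norm_p]
        exact inv_lt_one_of_one_lt₀ (by exact_mod_cast (Fact.out : q.Prime).one_lt)
      calc _ ≤ ‖(d : ℤ_[q])‖ ^ 2 * ‖(q : ℤ_[q])‖ * 1 := by gcongr; exact PadicInt.norm_le_one _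
        _ < ‖(d : ℤ_[q])‖ ^ 2 := by rw [mul_one]; exact mul_lt_of_lt_one_right h4 h5)
  have h1 : (z : ℚ_[q]) ^ d = p := by
    have h2 : z ^ d - (p : ℤ_[q]) = 0 := by simpa using hz
    exact_mod_cast congrArg (fun y : ℤ_[q] => (y : ℚ_[q])) (sub_eq_zero.1 h2)
  have h2 : ‖(p : ℚ_[q])‖ = 1 :=
    Padic.norm_natCast_eq_one_iff.2 ((Nat.coprime_primes Fact.out hp).2 hqp)
  have h3 : ‖(z : ℚ_[q])‖ = 1 := by
    have := congrArg norm h1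
    rw [norm_pow, h2] at this
    exact (pow_eq_one_iff_of_nonneg (norm_nonneg _) hd.ne').1 this
  refine ⟨(z : ℚ_[q])⁻¹, by rw [norm_inv, h3, inv_one], ?_⟩
  rw [inv_pow, h1]
  exact inv_mul_cancel₀ (norm_ne_zero_iff.1 (by rw [h2]; exact one_ne_zero))

theorem exists_prime_isHeckeScalar (S : PrimeTup) {d : ℕ} (hd : 0 < d) (N : ℕ) :
    ∃ p, N < p ∧ p.Prime ∧ (∀ i, p ≠ S.p i) ∧ ∃ t, S.IsHeckeScalar d p t := by
  obtain ⟨p, hp, hN, hmod⟩ := Nat.exists_prime_gt_modEq_one (k := d ^ 2 * ∏ i, S.p i)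
    (N + ∑ i, S.p i) (mul_ne_zero (pow_ne_zero _ hd.ne')
      (Finset.prod_ne_zero_iff.2 fun i _ => (S.hp i).ne_zero))
  have hne : ∀ i, p ≠ S.p i := fun i h => by
    have := Finset.single_le_sum (f := S.p) (fun _ _ => Nat.zero_le _) (Finset.mem_univ i)
    omega
  choose u hu1 hu2 using fun i => exists_padic_root (q := S.p i) hd (hne i).symm hp
    (hmod.of_dvd (mul_dvd_mul_left _ (Finset.dvd_prod_of_mem _ (Finset.mem_univ i))))
  refine ⟨p, by omega, hp, hne, (((p : ℝ)⁻¹) ^ ((d : ℝ)⁻¹), u), ?_, ?_, hu1, hu2⟩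
  · have := hp.pos
    positivity
  · have h0 : (p : ℝ) ≠ 0 := by exact_mod_cast hp.ne_zero
    simp only
    rw [Real.rpow_inv_natCast_pow (by positivity) hd.ne', inv_mul_cancel₀ h0]

end HeckeScalar

end PrimeTup

section Characters

variable {K C : Type*} [Field K] [CommMonoid C] {d : ℕ}

theorem Matrix.SpecialLinearGroup.ext_mulVec {n R : Type*} [DecidableEq n] [Fintype n] [CommRing R]
    {A B : SpecialLinearGroup n R}
    (h : ∀ v, (A : Matrix n n R).mulVec v = (B : Matrix n n R).mulVec v) : A = B :=
  Subtype.ext (Matrix.mulVec_injective (funext h))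

theorem map_eq_one_of_mul_eq {G : Type*} [Group G] (χ : G →* C) {x y z : G}
    (h : x * y = z * (y * x)) : χ z = 1 := by
  have h1 : z = x * y * x⁻¹ * y⁻¹ := by rw [h]; group
  rw [h1, map_mul, map_mul, map_mul, mul_right_comm (χ x), mul_assoc, ← map_mul, ← map_mul,
    mul_inv_cancel, mul_inv_cancel, map_one, mul_one]

open SpecialLinearGroup in
theorem SpecialLinearGroup_char_eq_one (hd : 3 ≤ d) (χ : SpecialLinearGroup (Fin d) K →* C)
    (g : SpecialLinearGroup (Fin d) K) : χ g = 1 := by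
  have htr : ∀ (i j : Fin d) (hij : i ≠ j) (a : K), χ (transvection hij a) = 1 := by
    intro i j hij a
    obtain ⟨k, hk⟩ : ∃ k, k ∉ ({i, j} : Finset (Fin d)) := by
      by_contra! h
      have h1 : (Finset.univ : Finset (Fin d)) ⊆ {i, j} := fun k _ => h k
      have h2 := (Finset.card_le_card h1).trans Finset.card_le_two
      rw [Finset.card_univ, Fintype.card_fin] at h2
      omega
    simp only [Finset.mem_insert, Finset.mem_singleton, not_or] at hk
    refine map_eq_one_of_mul_eq χ (x := transvection (Ne.symm hk.1) a)
      (y := transvection hk.2 1) (ext_mulVec fun v => ?_)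
    have hki : k ≠ i := hk.1
    have hkj : k ≠ j := hk.2
    simp only [Matrix.SpecialLinearGroup.coe_mul, ← mulVec_mulVec, transvection_mulVec]
    ext l
    rcases eq_or_ne l i with rfl | hl
    · simp [hki, hij.symm, hki.symm, hkj.symm]
      ring
    rcases eq_or_ne l k with rfl | hl'
    · simp [hki, hij.symm, hki.symm, hkj.symm]
    · simp [hl, hl']
  have : Nontrivial (Fin d) := Fin.nontrivial_iff_two_le.2 (by omega)
  refine diagonal_transvection_induction' (fun g => χ g = 1) g (fun i j hij a ha => ?_) htr
    (fun A B hA hB => by rw [map_mul, hA, hB, one_mul])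
  have h1 : diag2n hij a ha = transvection hij a * transvection hij.symm (-a⁻¹) *
      transvection hij a * (transvection hij (-1) * transvection hij.symm 1 *
      transvection hij (-1)) := by
    refine ext_mulVec fun v => ?_
    simp only [Matrix.SpecialLinearGroup.coe_mul, ← mulVec_mulVec, transvection_mulVec, diag2n_coe]
    ext l
    rcases eq_or_ne l i with rfl | hl
    · simp [hij, hij.symm, mulVec_diagonal]
      field_simp
      ring
    rcases eq_or_ne l j with rfl | hl'
    · simp [hij, hij.symm, mulVec_diagonal]
      field_simp
      ring
    · simp [hl, hl', mulVec_diagonal]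
  rw [h1]
  simp [htr]

end Characters

namespace PrimeTup

section Modulus

open scoped NNReal

variable {S : PrimeTup} {d : ℕ}

theorem continuous_act (g : S.G d) : Continuous (S.act g) := by
  refine Continuous.prodMk (Continuous.matrix_mulVec continuous_const continuous_fst)
    (continuous_pi fun i => Continuous.matrix_mulVec continuous_const
      ((continuous_apply i).comp continuous_snd))

theorem act_add (g : S.G d) (x y : S.QS d) : S.act g (x + y) = S.act g x + S.act g y := by
  refine Prod.ext ?_ (funext fun i => ?_)
  · exact mulVec_add (g.1 : Matrix (Fin d) (Fin d) ℝ) x.1 y.1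
  · exact mulVec_add (g.2 i : Matrix (Fin d) (Fin d) (S.Qp i)) (x.2 i) (y.2 i)

/-- The action of `g` on `ℚ_S^d` as an automorphism of topological groups. -/
noncomputable def actEquiv (g : S.G d) : S.QS d ≃ₜ+ S.QS d where
  toFun := S.act g
  invFun := S.act g⁻¹
  left_inv x := by rw [← act_mul, inv_mul_cancel, act_one]
  right_inv x := by rw [← act_mul, mul_inv_cancel, act_one]
  map_add' := act_add g
  continuous_toFun := continuous_act g
  continuous_invFun := continuous_act g⁻¹

theorem char_eq_one (hd : 3 ≤ d) (χ : S.G d →* ℝ≥0) (g : S.G d) : χ g = 1 := by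
  have h1 : χ.comp (MonoidHom.inl _ _) = 1 :=
    MonoidHom.ext fun x => SpecialLinearGroup_char_eq_one hd _ x
  have h2 : χ.comp (MonoidHom.inr _ _) = 1 :=
    MonoidHom.pi_ext fun i x => SpecialLinearGroup_char_eq_one hd
      ((χ.comp (MonoidHom.inr _ _)).comp
        (MonoidHom.mulSingle (fun i => SpecialLinearGroup (Fin d) (S.Qp i)) i)) x
  have h3 : g = MonoidHom.inl _ _ g.1 * MonoidHom.inr _ _ g.2 := by simp
  rw [h3, map_mul]
  exact (congrArg₂ (· * ·) (DFunLike.congr_fun h1 g.1) (DFunLike.congr_fun h2 g.2)).trans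
    (one_mul _)

theorem addEquivAddHaarChar_actEquiv (hd : 3 ≤ d) (g : S.G d) :
    addEquivAddHaarChar (actEquiv g) = 1 :=
  char_eq_one hd
    { toFun := fun g : S.G d => addEquivAddHaarChar (actEquiv g)
      map_one' := by
        rw [← addEquivAddHaarChar_refl (G := S.QS d)]
        exact congrArg _ (ContinuousAddEquiv.ext fun x => act_one (S := S) x)
      map_mul' := fun g h => by
        rw [mul_comm, ← addEquivAddHaarChar_trans]
        exact congrArg _ (ContinuousAddEquiv.ext fun x => act_mul (S := S) g h x) } g

theorem measurePreserving_act (hd : 3 ≤ d) (v : Measure (S.QS d)) [v.IsAddHaarMeasure]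
    [v.Regular] (g : S.G d) : MeasurePreserving (S.act g) v v := by
  refine ⟨(continuous_act g).measurable, ?_⟩
  have h := addEquivAddHaarChar_smul_map v (actEquiv g)
  rwa [addEquivAddHaarChar_actEquiv hd, one_smul] at h

end Modulus

end PrimeTup

namespace PrimeTup

section Volume

open scoped ENNReal NNReal Pointwise

variable {S : PrimeTup} {d : ℕ}

/-- The compact open subgroup `∏ᵢ ℤ_{pᵢ}^d` of `∏ᵢ ℚ_{pᵢ}^d`. -/
noncomputable def padicBox (S : PrimeTup) (d : ℕ) :
    TopologicalSpace.PositiveCompacts ((i : Fin S.s) → Fin d → S.Qp i) where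
  carrier := Metric.closedBall 0 1
  isCompact' := isCompact_closedBall 0 1
  interior_nonempty' :=
    ⟨0, mem_interior.2 ⟨Metric.ball 0 1, Metric.ball_subset_closedBall, Metric.isOpen_ball,
      Metric.mem_ball_self one_pos⟩⟩

theorem mem_padicBox {x : (i : Fin S.s) → Fin d → S.Qp i} :
    x ∈ (padicBox S d : Set _) ↔ ∀ i j, ‖x i j‖ ≤ 1 := by
  change x ∈ Metric.closedBall 0 1 ↔ _
  rw [mem_closedBall_zero_iff, pi_norm_le_iff_of_nonneg zero_le_one]
  exact forall_congr' fun i => pi_norm_le_iff_of_nonneg zero_le_one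

/-- The model of `vol_S` as a product of Haar measures. -/
noncomputable def stdVol (S : PrimeTup) (d : ℕ) : Measure (S.QS d) :=
  (volume : Measure (Fin d → ℝ)).prod (Measure.addHaarMeasure (padicBox S d))

instance : (stdVol S d).IsAddHaarMeasure :=
  Measure.prod.instIsAddHaarMeasure _ _

theorem stdVol_prod (A : Set (Fin d → ℝ)) :
    stdVol S d (A ×ˢ (padicBox S d : Set _)) = volume A := by
  rw [stdVol, Measure.prod_prod, Measure.addHaarMeasure_self, mul_one]

theorem unitBox_eq : S.unitBox d =
    (Set.univ.pi fun _ : Fin d => Set.Icc (0:ℝ) 1) ×ˢ (padicBox S d : Set _) := by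
  ext x
  simp only [unitBox, Set.mem_ofPred_eq, Set.mem_prod, mem_padicBox, Set.mem_univ_pi]

theorem IsVolS.eq_stdVol {v : Measure (S.QS d)} (hv : S.IsVolS d v) : v = stdVol S d := by
  have := hv.1
  obtain ⟨c, hc⟩ : ∃ c : ℝ≥0, v = c • stdVol S d := ⟨_, Measure.isAddLeftInvariant_eq_smul v _⟩
  have h : v (S.unitBox d) = 1 := hv.2.2
  rw [hc, Measure.smul_apply, unitBox_eq, stdVol_prod, volume_pi_pi] at h
  have hc1 : c = 1 := by simpa [ENNReal.smul_def] using h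
  rw [hc, hc1, one_smul]

theorem continuous_scale (t : ℝ × ((i : Fin S.s) → S.Qp i)) :
    Continuous (scale t : S.QS d → S.QS d) :=
  Continuous.prodMk (continuous_fst.const_smul t.1)
    (continuous_pi fun i => ((continuous_apply i).comp continuous_snd).const_smul (t.2 i))

theorem scale_add (t : ℝ × ((i : Fin S.s) → S.Qp i)) (x y : S.QS d) :
    scale t (x + y) = scale t x + scale t y :=
  Prod.ext (smul_add _ _ _) (funext fun _ => smul_add _ _ _)

theorem scale_mul (t u : ℝ × ((i : Fin S.s) → S.Qp i)) (x : S.QS d) :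
    scale (t * u) x = scale t (scale u x) :=
  Prod.ext (mul_smul _ _ _) (funext fun _ => mul_smul _ _ _)

theorem scale_one (x : S.QS d) : scale 1 x = x :=
  Prod.ext (one_smul _ _) (funext fun _ => one_smul _ _)

/-- Scaling by an invertible scalar as an automorphism of `ℚ_S^d`. -/
noncomputable def scaleEquiv (u : (ℝ × ((i : Fin S.s) → S.Qp i))ˣ) : S.QS d ≃ₜ+ S.QS d where
  toFun := scale u
  invFun := scale (u⁻¹ : (ℝ × ((i : Fin S.s) → S.Qp i))ˣ)
  left_inv x := by rw [← scale_mul, Units.inv_mul, scale_one]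
  right_inv x := by rw [← scale_mul, Units.mul_inv, scale_one]
  map_add' := scale_add _
  continuous_toFun := continuous_scale _
  continuous_invFun := continuous_scale _

theorem map_scale {t : ℝ × ((i : Fin S.s) → S.Qp i)} (h0 : 0 < t.1) (h1 : ∀ i, ‖t.2 i‖ = 1) :
    (stdVol S d).map (scale t) = ENNReal.ofReal (t.1⁻¹ ^ d) • stdVol S d := by
  have hne : ∀ i, t.2 i ≠ 0 := fun i => norm_ne_zero_iff.1 (by rw [h1]; exact one_ne_zero)
  let u : (ℝ × ((i : Fin S.s) → S.Qp i))ˣ :=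
    ⟨t, (t.1⁻¹, fun i => (t.2 i)⁻¹),
      Prod.ext (mul_inv_cancel₀ h0.ne') (funext fun i => mul_inv_cancel₀ (hne i)),
      Prod.ext (inv_mul_cancel₀ h0.ne') (funext fun i => inv_mul_cancel₀ (hne i))⟩
  have : ((stdVol S d).map (scale t)).IsAddHaarMeasure :=
    (scaleEquiv u).toAddEquiv.isAddHaarMeasure_map (stdVol S d) (continuous_scale _)
      (scaleEquiv u).continuous_invFun
  obtain ⟨c, hc⟩ : ∃ c : ℝ≥0, (stdVol S d).map (scale t) = c • stdVol S d :=
    ⟨_, Measure.isAddLeftInvariant_eq_smul _ _⟩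
  have h := congrArg (· (S.unitBox d)) hc
  have hpre : scale t ⁻¹' S.unitBox d =
      (Set.univ.pi fun _ : Fin d => Set.Icc (0:ℝ) t.1⁻¹) ×ˢ (padicBox S d : Set _) := by
    ext x
    simp only [unitBox, Set.mem_preimage, Set.mem_ofPred_eq, Set.mem_prod, mem_padicBox,
      Set.mem_univ_pi, scale, Pi.smul_apply, smul_eq_mul, norm_mul, h1, one_mul, Set.mem_Icc,
      mul_nonneg_iff_of_pos_left h0, ← le_div_iff₀' h0, one_div]
  have hm : MeasurableSet (S.unitBox d) := by
    rw [unitBox_eq]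
    exact (MeasurableSet.univ_pi fun _ => measurableSet_Icc).prod
      (padicBox S d).isCompact.measurableSet
  simp only [Measure.smul_apply] at h
  rw [Measure.map_apply (continuous_scale t).measurable hm, hpre, unitBox_eq, stdVol_prod,
    stdVol_prod, volume_pi_pi, volume_pi_pi] at h
  simp only [Real.volume_Icc, sub_zero, Finset.prod_const, Finset.card_univ, Fintype.card_fin,
    ENNReal.ofReal_one, one_pow, ENNReal.smul_def, smul_eq_mul, mul_one] at h
  rw [hc, ENNReal.ofReal_pow (inv_nonneg.2 h0.le), h]
  rfl

end Volume

end PrimeTup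

namespace PrimeTup

section Count

variable {S : PrimeTup} {d : ℕ}

theorem exists_smooth_norm_lt (S : PrimeTup) {δ : ℝ} (hδ : 0 < δ) :
    ∃ N : ℕ, N ≠ 0 ∧ S.Smooth N ∧ ∀ i, ‖(N : S.Qp i)‖ < δ := by
  have h : ∀ᶠ n : ℕ in Filter.atTop, ∀ i, ‖((S.p i : ℕ) : S.Qp i)‖ ^ n < δ :=
    Filter.eventually_all.2 fun i =>
      (tendsto_pow_atTop_nhds_zero_of_lt_one (norm_nonneg _) Padic.norm_p_lt_one).eventually
        (gt_mem_nhds hδ)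
  obtain ⟨n, hn⟩ := h.exists
  have hsm : ∀ m : ℕ, ∀ x, S.Smooth x → S.Smooth (x ^ m) := fun m x hx => by
    induction m with
    | zero => simpa using S.smooth_one
    | succ m ih => rw [pow_succ]; exact ih.mul hx
  refine ⟨(∏ i, S.p i) ^ n, pow_ne_zero _ (Finset.prod_ne_zero_iff.2 fun i _ => (S.hp i).ne_zero),
    hsm n _ (Finset.prod_induction _ S.Smooth (fun _ _ h h' => h.mul h') S.smooth_one
      fun i _ => S.smooth_p i), fun i => lt_of_le_of_lt ?_ (hn i)⟩
  rw [Nat.cast_pow, norm_pow]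
  refine pow_le_pow_left₀ (norm_nonneg _) ?_ n
  rw [← Finset.mul_prod_erase _ _ (Finset.mem_univ i), Nat.cast_mul, norm_mul]
  exact mul_le_of_le_one_right (norm_nonneg _) (Padic.norm_int_le_one (p := S.p i)
    ((∏ x ∈ Finset.univ.erase i, S.p x : ℕ) : ℤ))

/-- The height of a rational number. -/
noncomputable def height (q : ℚ) : ℝ := max |(q.num : ℝ)| q.den

theorem height_pos (q : ℚ) : 0 < height q :=
  lt_max_of_lt_right (Nat.cast_pos.2 q.den_pos)

theorem norm_scale_dg_le_iff {t : ℝ × ((i : Fin S.s) → S.Qp i)} (h0 : 0 < t.1)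
    (h1 : ∀ i, ‖t.2 i‖ = 1) {R : ℝ} (hR : 0 ≤ R) (w : Fin d → S.Zs) :
    ‖scale t (dg w)‖ ≤ R ↔ (∀ j, |((w j : ℚ) : ℝ)| ≤ R / t.1) ∧
      ∀ i j, ‖((w j : ℚ) : S.Qp i)‖ ≤ R := by
  rw [norm_prod_le_iff, pi_norm_le_iff_of_nonneg hR, pi_norm_le_iff_of_nonneg hR]
  refine and_congr (forall_congr' fun j => ?_) (forall_congr' fun i => ?_)
  · change |t.1 * ((w j : ℚ) : ℝ)| ≤ R ↔ _
    rw [abs_mul, abs_of_pos h0, le_div_iff₀' h0]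
  · rw [pi_norm_le_iff_of_nonneg hR]
    refine forall_congr' fun j => ?_
    change ‖t.2 i * ((w j : ℚ) : S.Qp i)‖ ≤ R ↔ _
    rw [norm_mul, h1, one_mul]

theorem exists_int_of_norm_le {R : ℝ} {Q : ℕ} (hQ : ∀ i, ‖(Q : S.Qp i)‖ * R ≤ 1) {x : ℚ}
    (hx : x ∈ S.Zs) (k : (S.Zs)ˣ) (h : ∀ i, ‖(x : S.Qp i)‖ ≤ R)
    (h' : ∀ i, ‖((((k : S.Zs) : ℚ) * x : ℚ) : S.Qp i)‖ ≤ R) :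
    ∃ z : ℤ, (Q : ℚ) * x = ((k : S.Zs) : ℚ).den * z := by
  set q : ℚ := ((k : S.Zs) : ℚ) with hq
  have hden : (q.den : ℚ) ≠ 0 := Nat.cast_ne_zero.2 q.den_nz
  have hz : (Q : ℚ) * x * (q.den : ℚ)⁻¹ ∈ S.Zs :=
    S.Zs.mul_mem (S.Zs.mul_mem (natCast_mem _ _) hx)
      (inv_mem_Zs q.den_nz (mem_Zs_iff.1 (k : S.Zs).2))
  have hd1 := den_eq_one_of_norm_le_one hz fun i => by
    have hQx : ∀ y : ℚ, ‖(y : S.Qp i)‖ ≤ R → ‖(((Q : ℚ) * y : ℚ) : S.Qp i)‖ ≤ 1 := fun y hy => by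
      rw [Rat.cast_mul, norm_mul, Rat.cast_natCast]
      exact (mul_le_mul_of_nonneg_left hy (norm_nonneg _)).trans (hQ i)
    by_cases hb : S.p i ∣ q.den
    · have ha : ‖(q.num : S.Qp i)‖ = 1 := by
        refine le_antisymm (Padic.norm_int_le_one _) (not_lt.1 fun hlt => ?_)
        have h1 := Int.natCast_dvd.1 (Padic.norm_intCast_lt_one_iff.1 hlt)
        exact (S.hp i).one_lt.ne' (Nat.eq_one_of_dvd_coprimes q.reduced h1 hb)
      have e : (Q : ℚ) * (q * x) = q.num * ((Q : ℚ) * x * (q.den : ℚ)⁻¹) := by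
        conv_lhs => rw [← Rat.num_div_den q]
        field_simp
      have := hQx _ (h' i)
      rwa [e, Rat.cast_mul, norm_mul, Rat.cast_intCast, ha, one_mul] at this
    · have hb' : ‖(q.den : S.Qp i)‖ = 1 := by
        refine le_antisymm (Padic.norm_int_le_one (q.den : ℤ)) (not_lt.1 fun hlt => hb ?_)
        exact Int.natCast_dvd_natCast.1 (Padic.norm_intCast_lt_one_iff.1
          (by rwa [Int.cast_natCast]))
      rw [Rat.cast_mul, norm_mul, Rat.cast_inv, Rat.cast_natCast, norm_inv, hb', inv_one, mul_one]
      exact hQx _ (h i)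
  refine ⟨((Q : ℚ) * x * (q.den : ℚ)⁻¹).num, ?_⟩
  rw [Rat.coe_int_num_of_den_eq_one hd1]
  field_simp

theorem ncard_le_of_norm_le {t : ℝ × ((i : Fin S.s) → S.Qp i)} (h0 : 0 < t.1)
    (h1 : ∀ i, ‖t.2 i‖ = 1) {R : ℝ} (hR : 0 ≤ R) {Q : ℕ} (hQ0 : Q ≠ 0)
    (hQ : ∀ i, ‖(Q : S.Qp i)‖ * R ≤ 1) (k : (S.Zs)ˣ) :
    {w : Fin d → S.Zs | w ≠ 0 ∧ ‖scale t (dg w)‖ ≤ R ∧ ‖scale t (dg ((k : S.Zs) • w))‖ ≤ R}.Finite ∧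
    t.1 ^ d * ({w : Fin d → S.Zs | w ≠ 0 ∧ ‖scale t (dg w)‖ ≤ R ∧
      ‖scale t (dg ((k : S.Zs) • w))‖ ≤ R}.ncard : ℝ) ≤
        (3 * Q * R / height ((k : S.Zs) : ℚ)) ^ d := by
  set q : ℚ := ((k : S.Zs) : ℚ) with hq
  set W := {w : Fin d → S.Zs | w ≠ 0 ∧ ‖scale t (dg w)‖ ≤ R ∧
      ‖scale t (dg ((k : S.Zs) • w))‖ ≤ R} with hW
  have hH := height_pos q
  have hQpos : (0 : ℝ) < Q := Nat.cast_pos.2 (Nat.pos_of_ne_zero hQ0)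
  set M : ℝ := Q * R / (t.1 * height q) with hM
  have hM0 : 0 ≤ M := by positivity
  have hintg : ∀ w ∈ W, ∃ z : Fin d → ℤ, ∀ j, (Q : ℚ) * w j = q.den * z j := by
    rintro w ⟨-, hw, hw'⟩
    rw [norm_scale_dg_le_iff h0 h1 hR] at hw hw'
    choose z hz using fun j => exists_int_of_norm_le hQ (w j).2 k (fun i => hw.2 i j)
      fun i => by simpa using hw'.2 i j
    exact ⟨z, hz⟩
  choose! φ hφ using hintg
  have hbd : ∀ w ∈ W, ∀ j, |(φ w j : ℝ)| ≤ M := by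
    rintro w hwW j
    obtain ⟨-, hw, hw'⟩ := id hwW
    rw [norm_scale_dg_le_iff h0 h1 hR] at hw hw'
    have e : (Q : ℚ) * (q * w j) = q.num * φ w j := by
      rw [mul_left_comm, hφ w hwW j, ← mul_assoc, Rat.mul_den_eq_num]
    have e1 : (Q : ℝ) * ((w j : ℚ) : ℝ) = (q.den : ℝ) * φ w j := by exact_mod_cast hφ w hwW j
    have e2 : (Q : ℝ) * ((q * w j : ℚ) : ℝ) = (q.num : ℝ) * φ w j := by exact_mod_cast e
    have b1 : (q.den : ℝ) * |(φ w j : ℝ)| ≤ Q * (R / t.1) := by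
      have := mul_le_mul_of_nonneg_left (hw.1 j) hQpos.le
      rwa [← abs_of_pos hQpos, ← abs_mul, abs_of_pos hQpos, e1, abs_mul, Nat.abs_cast] at this
    have b2 : |(q.num : ℝ)| * |(φ w j : ℝ)| ≤ Q * (R / t.1) := by
      have h2 : |((q * w j : ℚ) : ℝ)| ≤ R / t.1 := by simpa using hw'.1 j
      have := mul_le_mul_of_nonneg_left h2 hQpos.le
      rwa [← abs_of_pos hQpos, ← abs_mul, abs_of_pos hQpos, e2, abs_mul] at this
    have b3 : height q * |(φ w j : ℝ)| ≤ Q * (R / t.1) := by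
      rw [height, max_mul_of_nonneg _ _ (abs_nonneg _)]
      exact max_le b2 b1
    rw [hM, le_div_iff₀ (by positivity)]
    calc |(φ w j : ℝ)| * (t.1 * height q) = t.1 * (height q * |(φ w j : ℝ)|) := by ring
      _ ≤ t.1 * (Q * (R / t.1)) := mul_le_mul_of_nonneg_left b3 h0.le
      _ = Q * R := by field_simp
  have hden : (q.den : ℚ) ≠ 0 := Nat.cast_ne_zero.2 q.den_nz
  have hQne : (Q : ℚ) ≠ 0 := Nat.cast_ne_zero.2 hQ0
  have hinj : Set.InjOn φ W := fun w hw w' hw' h => funext fun j => Subtype.ext <|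
    mul_left_cancel₀ hQne (by rw [hφ w hw, hφ w' hw', h])
  have hmaps : ∀ w ∈ W, φ w ∈ (Fintype.piFinset fun _ : Fin d => Finset.Icc (-⌊M⌋) ⌊M⌋) := by
    intro w hw
    refine Fintype.mem_piFinset.2 fun j => Finset.mem_Icc.2 (abs_le.1 (Int.le_floor.2 ?_))
    rw [Int.cast_abs]
    exact hbd w hw j
  have hfin : W.Finite := Set.Finite.of_injOn (f := φ) hmaps hinj (Finset.finite_toSet _)
  refine ⟨hfin, ?_⟩
  rcases W.eq_empty_or_nonempty with he | ⟨w, hw⟩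
  · rw [he, Set.ncard_empty, Nat.cast_zero, mul_zero]
    positivity
  have hM1 : 1 ≤ M := by
    obtain ⟨j, hj⟩ := Function.ne_iff.1 hw.1
    have hne : φ w j ≠ 0 := fun h => hj (Subtype.ext (by
      have := hφ w hw j
      rw [h, Int.cast_zero, mul_zero] at this
      exact (mul_eq_zero.1 this).resolve_left hQne))
    refine le_trans ?_ (hbd w hw j)
    exact_mod_cast Int.one_le_abs hne
  have hcard : W.ncard ≤ (2 * ⌊M⌋ + 1).toNat ^ d := by
    refine (Set.ncard_le_ncard_of_injOn φ hmaps hinj (Finset.finite_toSet _)).trans_eq ?_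
    rw [Set.ncard_coe_finset, Fintype.card_piFinset, Finset.prod_const, Finset.card_univ,
      Fintype.card_fin, Int.card_Icc]
    congr 2
    ring
  have hfl : (((2 * ⌊M⌋ + 1).toNat : ℕ) : ℝ) ≤ 3 * M := by
    have h3 : 0 ≤ ⌊M⌋ := Int.floor_nonneg.2 hM0
    have : (((2 * ⌊M⌋ + 1).toNat : ℤ) : ℝ) = ((2 * ⌊M⌋ + 1 : ℤ) : ℝ) := by
      rw [Int.toNat_of_nonneg (by linarith)]
    rw [Int.cast_natCast] at this
    rw [this]
    push_cast
    linarith [Int.floor_le M]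
  calc t.1 ^ d * (W.ncard : ℝ) ≤ t.1 ^ d * (3 * M) ^ d := by
        refine mul_le_mul_of_nonneg_left ?_ (pow_nonneg h0.le _)
        refine le_trans (Nat.cast_le.2 hcard) ?_
        rw [Nat.cast_pow]
        exact pow_le_pow_left₀ (Nat.cast_nonneg _) hfl d
    _ = (3 * Q * R / height q) ^ d := by
        rw [← mul_pow, hM]
        congr 1
        field_simp

end Count

end PrimeTup

namespace PrimeTup

section Lattice

open scoped ENNReal Pointwise

variable {S : PrimeTup} {d : ℕ}

theorem padic_norm_sub_le_max {p : ℕ} [Fact p.Prime] (x y : ℚ_[p]) : ‖x - y‖ ≤ max ‖x‖ ‖y‖ := by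
  simpa only [sub_eq_add_neg, norm_neg] using IsUltrametricDist.norm_add_le_max x (-y)

theorem exists_approx_one (i : Fin S.s) (b : S.Qp i) :
    ∃ z ∈ S.Zs, ‖b - (z : S.Qp i)‖ ≤ 1 ∧ ∀ j, j ≠ i → ‖(z : S.Qp j)‖ ≤ 1 := by
  have hp0 : (0 : ℝ) < S.p i := Nat.cast_pos.2 (S.hp i).pos
  obtain ⟨n, hn⟩ := pow_unbounded_of_one_lt ‖b‖
    (show (1 : ℝ) < S.p i from Nat.one_lt_cast.2 (S.hp i).one_lt)
  have hpn : ‖((S.p i : S.Qp i)) ^ n‖ = ((S.p i : ℝ) ^ n)⁻¹ := by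
    rw [norm_pow, Padic.norm_p, inv_pow]
  have hpne : ((S.p i : S.Qp i)) ^ n ≠ 0 := pow_ne_zero _ (Nat.cast_ne_zero.2 (S.hp i).ne_zero)
  have hb1 : ‖b * (S.p i : S.Qp i) ^ n‖ ≤ 1 := by
    rw [norm_mul, hpn, ← div_eq_mul_inv]
    exact (div_le_one (by positivity)).2 hn.le
  let y : ℤ_[S.p i] := ⟨b * (S.p i : S.Qp i) ^ n, hb1⟩
  have hy := (PadicInt.norm_le_pow_iff_mem_span_pow _ n).2 (PadicInt.appr_spec n y)
  refine ⟨(y.appr n : ℚ) * (S.p i : ℚ)⁻¹ ^ n, S.Zs.mul_mem (natCast_mem _ _)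
    (pow_mem (inv_mem_Zs (S.hp i).ne_zero (smooth_p i)) n), ?_, fun j hj => ?_⟩
  · have e : b - (((y.appr n : ℚ) * (S.p i : ℚ)⁻¹ ^ n : ℚ) : S.Qp i) =
        ((y - (y.appr n : ℤ_[S.p i]) : ℤ_[S.p i]) : S.Qp i) * ((S.p i : S.Qp i) ^ n)⁻¹ := by
      push_cast
      change _ = (b * (S.p i : S.Qp i) ^ n - _) * _
      rw [sub_mul, mul_inv_cancel_right₀ hpne, inv_pow]
    rw [e, norm_mul, norm_inv, hpn, inv_inv]
    calc _ ≤ (S.p i : ℝ) ^ (-n : ℤ) * (S.p i : ℝ) ^ n :=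
          mul_le_mul_of_nonneg_right hy (by positivity)
      _ = 1 := by rw [_root_.zpow_neg, zpow_natCast, inv_mul_cancel₀ (by positivity)]
  · rw [Rat.cast_mul, norm_mul, inv_norm_le_one_p hj.symm, mul_one, Rat.cast_natCast]
    exact Padic.norm_int_le_one (y.appr n : ℤ)

theorem exists_approx (b : (i : Fin S.s) → S.Qp i) :
    ∃ z ∈ S.Zs, ∀ i, ‖b i - (z : S.Qp i)‖ ≤ 1 := by
  choose z hz h1 h2 using fun i => exists_approx_one i (b i)
  refine ⟨∑ i, z i, sum_mem fun i _ => hz i, fun i => ?_⟩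
  rw [← Finset.add_sum_erase _ _ (Finset.mem_univ i), Rat.cast_add, ← sub_sub]
  refine (padic_norm_sub_le_max _ _).trans (max_le (h1 i) ?_)
  rw [Rat.cast_sum]
  exact IsUltrametricDist.norm_sum_le_of_forall_le_of_nonneg zero_le_one
    fun j hj => h2 j i (Finset.ne_of_mem_erase hj).symm

theorem eq_zero_of_norm_le {N : ℕ} (hN0 : N ≠ 0) (hN : S.Smooth N) {x : ℚ} (hx : x ∈ S.Zs)
    (h : |(x : ℝ)| < N) (h' : ∀ i, ‖(x : S.Qp i)‖ ≤ ‖(N : S.Qp i)‖) : x = 0 := by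
  have hNq : (0 : ℚ) < N := Nat.cast_pos.2 (Nat.pos_of_ne_zero hN0)
  have hd := den_eq_one_of_norm_le_one (S.Zs.mul_mem hx (inv_mem_Zs hN0 hN)) fun i => by
    rw [Rat.cast_mul, norm_mul, Rat.cast_inv, Rat.cast_natCast, norm_inv, ← div_eq_mul_inv]
    exact div_le_one_of_le₀ (h' i) (norm_nonneg _)
  obtain ⟨n, hn⟩ : ∃ n : ℤ, x * (N : ℚ)⁻¹ = n := ⟨_, (Rat.coe_int_num_of_den_eq_one hd).symm⟩
  have h1 : |x| < N := by exact_mod_cast h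
  have h2 : |(n : ℚ)| < 1 := by
    rw [← hn, ← div_eq_mul_inv, abs_div, abs_of_pos hNq]
    exact (div_lt_one hNq).2 h1
  have h3 : n = 0 := Int.abs_lt_one_iff.1 (by exact_mod_cast h2)
  rw [h3, Int.cast_zero] at hn
  exact (mul_eq_zero.1 hn).resolve_right (inv_ne_zero hNq.ne')

theorem existsUnique_sub_mem_box {N : ℕ} (hN0 : N ≠ 0) (hN : S.Smooth N) (a : ℝ)
    (b : (i : Fin S.s) → S.Qp i) :
    ∃! z : S.Zs, a - ((z : ℚ) : ℝ) ∈ Set.Ico (0 : ℝ) N ∧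
      ∀ i, ‖b i - ((z : ℚ) : S.Qp i)‖ ≤ ‖(N : S.Qp i)‖ := by
  have hNr : (0 : ℝ) < N := Nat.cast_pos.2 (Nat.pos_of_ne_zero hN0)
  have hNp : ∀ i, 0 < ‖(N : S.Qp i)‖ := fun i => norm_pos_iff.2 (Nat.cast_ne_zero.2 hN0)
  obtain ⟨z₀, hz₀, h⟩ := exists_approx fun i => b i / (N : S.Qp i)
  have hz₁ : (N : ℚ) * (z₀ + (⌊a / N - (z₀ : ℝ)⌋ : ℚ)) ∈ S.Zs :=
    S.Zs.mul_mem (natCast_mem _ _) (S.Zs.add_mem hz₀ (intCast_mem _ _))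
  refine existsUnique_of_exists_of_unique ⟨⟨_, hz₁⟩, ?_, fun i => ?_⟩ fun z z' hz hz' => ?_
  · have e : a - (((N : ℚ) * (z₀ + (⌊a / N - (z₀ : ℝ)⌋ : ℚ)) : ℚ) : ℝ) =
        N * Int.fract (a / N - (z₀ : ℝ)) := by
      rw [← Int.self_sub_floor]
      push_cast
      field_simp
      ring
    change a - (((N : ℚ) * (z₀ + (⌊a / N - (z₀ : ℝ)⌋ : ℚ)) : ℚ) : ℝ) ∈ _
    rw [e]
    exact ⟨mul_nonneg hNr.le (Int.fract_nonneg _), mul_lt_of_lt_one_right hNr (Int.fract_lt_one _)⟩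
  · have hNne : (N : S.Qp i) ≠ 0 := norm_pos_iff.1 (hNp i)
    have e : b i - (((N : ℚ) * (z₀ + (⌊a / N - (z₀ : ℝ)⌋ : ℚ)) : ℚ) : S.Qp i) =
        N * (b i / N - z₀ - (⌊a / N - (z₀ : ℝ)⌋ : ℤ)) := by
      push_cast
      field_simp
      ring
    change ‖b i - (((N : ℚ) * (z₀ + (⌊a / N - (z₀ : ℝ)⌋ : ℚ)) : ℚ) : S.Qp i)‖ ≤ _
    rw [e, norm_mul]
    exact mul_le_of_le_one_right (hNp i).le
      ((padic_norm_sub_le_max _ _).trans (max_le (h i) (Padic.norm_int_le_one _)))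
  · refine Subtype.ext (sub_eq_zero.1 (eq_zero_of_norm_le hN0 hN (z - z').2 ?_ fun i => ?_))
    · rw [abs_lt]
      have h1 := hz.1
      have h2 := hz'.1
      simp only [Set.mem_Ico] at h1 h2
      push_cast
      constructor <;> linarith
    · have e : (((z - z' : S.Zs) : ℚ) : S.Qp i) =
          (b i - ((z' : ℚ) : S.Qp i)) - (b i - ((z : ℚ) : S.Qp i)) := by
        push_cast
        ring
      exact (congrArg norm e).trans_le <| (padic_norm_sub_le_max _ _).trans
        (max_le (hz'.2 i) (hz.2 i))

/-- The diagonal embedding of `ℤ_S^d` as a homomorphism. -/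
noncomputable def dgHom (S : PrimeTup) (d : ℕ) : (Fin d → S.Zs) →+ S.QS d where
  toFun := dg
  map_zero' := by
    refine Prod.ext (funext fun j => ?_) (funext fun i => funext fun j => ?_) <;> simp [dg, diag]
  map_add' _ _ := by
    refine Prod.ext (funext fun j => ?_) (funext fun i => funext fun j => ?_) <;> simp [dg, diag]

theorem dg_injective : Function.Injective (dg : (Fin d → S.Zs) → S.QS d) := fun _ _ h =>
  funext fun j => Subtype.ext (Rat.cast_injective (α := ℝ) (congrFun (congrArg Prod.fst h) j))

/-- The box `[0, N)^d × ∏ᵢ (N ℤ_{pᵢ})^d`. -/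
def fundBox (S : PrimeTup) (d N : ℕ) : Set (S.QS d) :=
  {x | (∀ j, x.1 j ∈ Set.Ico (0 : ℝ) N) ∧ ∀ i j, ‖x.2 i j‖ ≤ ‖(N : S.Qp i)‖}

theorem measurableSet_fundBox (N : ℕ) : MeasurableSet (S.fundBox d N) := by
  have : S.fundBox d N = (⋂ j, {x | x.1 j ∈ Set.Ico (0 : ℝ) N}) ∩
      ⋂ i, ⋂ j, {x | ‖x.2 i j‖ ≤ ‖(N : S.Qp i)‖} := by
    ext x
    simp [fundBox]
  rw [this]
  refine MeasurableSet.inter ?_ ?_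
  · refine MeasurableSet.iInter fun j => ?_
    exact (measurable_pi_apply j |>.comp measurable_fst) measurableSet_Ico
  · refine MeasurableSet.iInter fun i => MeasurableSet.iInter fun j => ?_
    refine IsClosed.measurableSet (isClosed_le ?_ continuous_const)
    fun_prop

theorem existsUnique_sub_dg_mem {N : ℕ} (hN0 : N ≠ 0) (hN : S.Smooth N) (x : S.QS d) :
    ∃! w : Fin d → S.Zs, x - dg w ∈ S.fundBox d N := by
  choose w hw hw' using fun j => existsUnique_sub_mem_box hN0 hN (x.1 j) fun i => x.2 i j
  exact ⟨w, ⟨fun j => (hw j).1, fun i j => (hw j).2 i⟩, fun v hv => funext fun j =>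
    hw' j (v j) ⟨hv.1 j, fun i => hv.2 i j⟩⟩

theorem isAddFundamentalDomain_fundBox {N : ℕ} (hN0 : N ≠ 0) (hN : S.Smooth N) :
    IsAddFundamentalDomain (dgHom S d).range (S.fundBox d N) (stdVol S d) := by
  refine .mk' (measurableSet_fundBox N).nullMeasurableSet fun x => ?_
  obtain ⟨w, hw, hu⟩ := existsUnique_sub_dg_mem hN0 hN x
  refine ⟨⟨dg (-w), -w, rfl⟩, ?_, ?_⟩
  · change dg (-w) + x ∈ _
    rwa [show dg (-w) = -dg w from map_neg (dgHom S d) w, neg_add_eq_sub]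
  · rintro ⟨_, v, rfl⟩ hv
    refine Subtype.ext (congrArg dg (neg_eq_iff_eq_neg.1 (hu (-v) ?_)))
    change x - dgHom S d (-v) ∈ _
    rw [map_neg, sub_neg_eq_add, add_comm]
    exact hv

instance : MeasurableConstVAdd (dgHom S d).range (S.QS d) :=
  ⟨fun g => measurable_const_add (g : S.QS d)⟩

theorem stdVol_fundBox {N : ℕ} (hN0 : N ≠ 0) (hN : S.Smooth N) :
    stdVol S d (S.fundBox d N) = 1 := by
  have : Countable (dgHom S d).range := (Set.countable_range _).to_subtype
  rw [(isAddFundamentalDomain_fundBox hN0 hN).measure_eq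
    (isAddFundamentalDomain_fundBox one_ne_zero smooth_one)]
  have : S.fundBox d 1 =
      (Set.univ.pi fun _ : Fin d => Set.Ico (0:ℝ) 1) ×ˢ (padicBox S d : Set _) := by
    ext x
    simp only [fundBox, Set.mem_ofPred_eq, Set.mem_prod, mem_padicBox, Set.mem_univ_pi,
      Nat.cast_one, norm_one]
  rw [this, stdVol_prod, volume_pi_pi]
  simp

theorem integral_eq_tsum_fundBox {N : ℕ} (hN0 : N ≠ 0) (hN : S.Smooth N) {f : S.QS d → ℝ}
    (hf : Integrable f (stdVol S d)) :
    ∫ x, f x ∂(stdVol S d) =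
      ∑' w : Fin d → S.Zs, ∫ x in S.fundBox d N, f (dg w + x) ∂(stdVol S d) := by
  have : Countable (dgHom S d).range := (Set.countable_range _).to_subtype
  rw [(isAddFundamentalDomain_fundBox hN0 hN).integral_eq_tsum'' f hf]
  exact ((AddMonoidHom.ofInjective (f := dgHom S d) dg_injective).toEquiv.tsum_eq
    fun g : (dgHom S d).range => ∫ x in S.fundBox d N, f (g +ᵥ x) ∂(stdVol S d)).symm

end Lattice

end PrimeTup

namespace PrimeTup

section CountAll

open scoped ENNReal Pointwise Topology

variable {S : PrimeTup} {d : ℕ}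

theorem exists_norm_bound {f : S.QS d → ℝ} (hc : HasCompactSupport f) :
    ∃ R : ℝ, 0 ≤ R ∧ ∀ x, f x ≠ 0 → ‖x‖ ≤ R := by
  obtain ⟨R, hR⟩ := hc.isCompact.isBounded.exists_norm_le
  exact ⟨max R 0, le_max_right _ _, fun x hx =>
    (hR x (subset_tsupport f hx)).trans (le_max_left _ _)⟩

theorem integral_comp_scale {t : ℝ × ((i : Fin S.s) → S.Qp i)} (h0 : 0 < t.1)
    (h1 : ∀ i, ‖t.2 i‖ = 1) {f : S.QS d → ℝ} (hf : Continuous f) :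
    t.1 ^ d * ∫ x, f (scale t x) ∂(stdVol S d) = ∫ x, f x ∂(stdVol S d) := by
  rw [← integral_map (continuous_scale t).aemeasurable hf.aestronglyMeasurable, map_scale h0 h1,
    integral_smul_measure, ENNReal.toReal_ofReal (by positivity), smul_eq_mul, ← mul_assoc,
    ← mul_pow, mul_inv_cancel₀ h0.ne', one_pow, one_mul]

theorem norm_scale_lt_of_mem_fundBox {t : ℝ × ((i : Fin S.s) → S.Qp i)} (h0 : 0 < t.1)
    (h1 : ∀ i, ‖t.2 i‖ = 1) {N : ℕ} {δ : ℝ} (hδ : 0 < δ) (hN : ∀ i, ‖(N : S.Qp i)‖ < δ)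
    (ht : t.1 * N < δ) {x : S.QS d} (hx : x ∈ S.fundBox d N) : ‖scale t x‖ < δ := by
  refine max_lt_iff.2 ⟨(pi_norm_lt_iff hδ).2 fun j => ?_, (pi_norm_lt_iff hδ).2 fun i =>
    (pi_norm_lt_iff hδ).2 fun j => ?_⟩
  · change |t.1 * x.1 j| < δ
    rw [abs_mul, abs_of_pos h0, abs_of_nonneg (hx.1 j).1]
    exact (mul_le_mul_of_nonneg_left (hx.1 j).2.le h0.le).trans_lt ht
  · change ‖t.2 i * x.2 i j‖ < δ
    rw [norm_mul, h1, one_mul]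
    exact (hx.2 i j).trans_lt (hN i)

theorem card_norm_scale_le {t : ℝ × ((i : Fin S.s) → S.Qp i)} (h0 : 0 < t.1)
    (h1 : ∀ i, ‖t.2 i‖ = 1) {R : ℝ} (hR : 0 ≤ R) {Q : ℕ} (hQ0 : Q ≠ 0)
    (hQ : ∀ i, ‖(Q : S.Qp i)‖ * R ≤ 1) (ht : t.1 ≤ 1) :
    ∃ T : Finset (Fin d → S.Zs), (∀ w, ‖scale t (dg w)‖ ≤ R → w ∈ T) ∧
      t.1 ^ d * (T.card : ℝ) ≤ (3 * Q * R) ^ d + 1 := by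
  classical
  obtain ⟨hfin, hcard⟩ := ncard_le_of_norm_le (d := d) h0 h1 hR hQ0 hQ 1
  have hh : height ((((1 : (S.Zs)ˣ) : S.Zs)) : ℚ) = 1 := by simp [height]
  rw [hh, div_one, Set.ncard_eq_toFinset_card _ hfin] at hcard
  refine ⟨insert 0 hfin.toFinset, fun w hw => ?_, ?_⟩
  · refine Finset.mem_insert.2 (or_iff_not_imp_left.2 fun h => hfin.mem_toFinset.2 ⟨h, hw, ?_⟩)
    rwa [Units.val_one, one_smul]
  · refine (mul_le_mul_of_nonneg_left (Nat.cast_le.2 (Finset.card_insert_le _ _))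
      (pow_nonneg h0.le _)).trans ?_
    rw [Nat.cast_add, Nat.cast_one, mul_add, mul_one]
    exact add_le_add hcard (pow_le_one₀ h0.le ht)

theorem tendsto_sum_dg {f : S.QS d → ℝ} (hf : Continuous f) (hc : HasCompactSupport f)
    {t : ℕ → ℝ × ((i : Fin S.s) → S.Qp i)} (h0 : ∀ n, 0 < (t n).1) (h1 : ∀ n i, ‖(t n).2 i‖ = 1)
    (hlim : Filter.Tendsto (fun n => (t n).1) Filter.atTop (𝓝 0)) :
    Filter.Tendsto (fun n => (t n).1 ^ d * ∑' w : Fin d → S.Zs, f (scale (t n) (dg w)))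
      Filter.atTop (𝓝 (∫ x, f x ∂(stdVol S d))) := by
  obtain ⟨R, hR0, hR⟩ := exists_norm_bound hc
  have hR1 : (0 : ℝ) < R + 1 := by linarith
  obtain ⟨Q, hQ0, -, hQ⟩ := exists_smooth_norm_lt S (one_div_pos.2 hR1)
  have hQ' : ∀ i, ‖(Q : S.Qp i)‖ * (R + 1) ≤ 1 := fun i => by
    have := hQ i
    rw [lt_div_iff₀ hR1] at this
    exact this.le
  set C : ℝ := (3 * Q * (R + 1)) ^ d + 1 with hC
  have hC0 : 0 < C := by positivity
  refine Metric.tendsto_nhds.2 fun ε hε => ?_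
  obtain ⟨δ', hδ'0, hδ'⟩ := Metric.uniformContinuous_iff.1
    (hc.uniformContinuous_of_continuous hf) (ε / (2 * C)) (by positivity)
  set δ := min δ' 1 with hδ
  have hδ0 : 0 < δ := lt_min hδ'0 one_pos
  obtain ⟨N, hN0, hNs, hN⟩ := exists_smooth_norm_lt S hδ0
  have e1 : ∀ᶠ n in Filter.atTop, (t n).1 * N < δ :=
    (by simpa using hlim.mul_const (N : ℝ) :
      Filter.Tendsto (fun n => (t n).1 * N) Filter.atTop (𝓝 0)).eventually (gt_mem_nhds hδ0)
  filter_upwards [e1, hlim.eventually (gt_mem_nhds one_pos)] with n hn hn1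
  obtain ⟨T, hT, hTc⟩ := card_norm_scale_le (d := d) (h0 n) (h1 n) hR1.le hQ0 hQ' hn1.le
  have hfD : ∀ w : Fin d → S.Zs, ∀ x ∈ S.fundBox d N,
      |f (scale (t n) (dg w)) - f (scale (t n) (dg w + x))| ≤ ε / (2 * C) := fun w x hx => by
    have h2 := norm_scale_lt_of_mem_fundBox (h0 n) (h1 n) hδ0 hN hn hx
    refine (Real.dist_eq _ _ ▸ hδ' ?_).le
    rw [scale_add, dist_self_add_right]
    exact h2.trans_le (min_le_left _ _)
  have hzero : ∀ w ∉ T, ∀ x ∈ S.fundBox d N, f (scale (t n) (dg w + x)) = 0 := fun w hw x hx => by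
    by_contra hne
    have h2 := norm_scale_lt_of_mem_fundBox (h0 n) (h1 n) hδ0 hN hn hx
    refine hw (hT w ?_)
    have h3 := hR _ hne
    have h4 : scale (t n) (dg w) = scale (t n) (dg w + x) - scale (t n) x := by
      rw [scale_add, add_sub_cancel_right]
    rw [h4]
    exact (norm_sub_le _ _).trans (add_le_add h3 (h2.le.trans (min_le_right _ _)))
  have hintg : Integrable (fun x => f (scale (t n) x)) (stdVol S d) := by
    refine (integrable_map_measure hf.aestronglyMeasurable
      (continuous_scale (t n)).aemeasurable).1 ?_
    rw [map_scale (h0 n) (h1 n)]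
    exact (hf.integrable_of_hasCompactSupport hc).smul_measure ENNReal.ofReal_ne_top
  obtain ⟨B, hB⟩ := hc.exists_bound_of_continuous hf
  have hvol : (stdVol S d).real (S.fundBox d N) = 1 := by
    rw [Measure.real, stdVol_fundBox hN0 hNs, ENNReal.toReal_one]
  rw [Real.dist_eq, ← integral_comp_scale (h0 n) (h1 n) hf, ← mul_sub,
    integral_eq_tsum_fundBox hN0 hNs hintg,
    tsum_eq_sum (s := T) fun w hw => setIntegral_eq_zero_of_forall_eq_zero (hzero w hw),
    tsum_eq_sum (s := T) fun w hw => by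
      by_contra hne
      exact hw (hT w ((hR _ hne).trans (by linarith))),
    ← Finset.sum_sub_distrib, abs_mul, abs_of_pos (pow_pos (h0 n) d)]
  have hterm : ∀ w, |f (scale (t n) (dg w)) -
      ∫ x in S.fundBox d N, f (scale (t n) (dg w + x)) ∂(stdVol S d)| ≤ ε / (2 * C) := fun w => by
    have hfin : stdVol S d (S.fundBox d N) < ∞ := by
      rw [stdVol_fundBox hN0 hNs]
      exact ENNReal.one_lt_top
    have hi : IntegrableOn (fun x => f (scale (t n) (dg w + x))) (S.fundBox d N) (stdVol S d) :=
      Measure.integrableOn_of_bounded hfin.ne (Continuous.aestronglyMeasurable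
        (hf.comp ((continuous_scale _).comp (continuous_const.add continuous_id))))
        (Filter.Eventually.of_forall fun x => hB _)
    have h5 : f (scale (t n) (dg w)) =
        ∫ x in S.fundBox d N, f (scale (t n) (dg w)) ∂(stdVol S d) := by
      rw [setIntegral_const, hvol, one_smul]
    rw [h5, ← integral_sub (integrableOn_const (C := f (scale (t n) (dg w))) hfin.ne) hi]
    refine (norm_setIntegral_le_of_norm_le_const (f := fun x => f (scale (t n) (dg w)) -
      f (scale (t n) (dg w + x))) hfin (hfD w)).trans_eq ?_
    rw [hvol, mul_one]
  calc _ ≤ (t n).1 ^ d * ∑ w ∈ T, ε / (2 * C) :=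
        mul_le_mul_of_nonneg_left ((Finset.abs_sum_le_sum_abs _ _).trans
          (Finset.sum_le_sum fun w _ => hterm w)) (pow_nonneg (h0 n).le _)
    _ = ((t n).1 ^ d * T.card) * (ε / (2 * C)) := by
        rw [Finset.sum_const, nsmul_eq_mul]
        ring
    _ ≤ C * (ε / (2 * C)) := mul_le_mul_of_nonneg_right hTc (by positivity)
    _ = ε / 2 := by field_simp
    _ < ε := half_lt_self hε

end CountAll

end PrimeTup

section Moebius

open ArithmeticFunction

theorem sum_moebius_divisorsAntidiagonal (n : ℕ) :
    ∑ q ∈ n.divisorsAntidiagonal, (moebius q.1 : ℝ) = if n = 1 then 1 else 0 := by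
  have h := congrArg (fun f : ArithmeticFunction ℝ => f n) (coe_moebius_mul_coe_zeta (R := ℝ))
  simp only [ArithmeticFunction.mul_apply, ArithmeticFunction.one_apply] at h
  rw [← h]
  refine Finset.sum_congr rfl fun q hq => ?_
  have : q.2 ≠ 0 := (Nat.ne_zero_of_mem_divisorsAntidiagonal hq).2
  simp [natCoe_apply, zeta_apply, this]

theorem tsum_moebius_mul_tsum_mul {G : ℕ+ → ℝ} (hG : Summable fun q : ℕ+ × ℕ+ => G (q.1 * q.2)) :
    ∑' m : ℕ+, (moebius m : ℝ) * ∑' m', G (m * m') = G 1 := by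
  have hs : Summable fun q : ℕ+ × ℕ+ => (moebius q.1 : ℝ) * G (q.1 * q.2) := by
    refine Summable.of_norm_bounded hG.norm fun q => ?_
    rw [norm_mul]
    refine mul_le_of_le_one_left (norm_nonneg _) ?_
    rw [Real.norm_eq_abs, ← Int.cast_abs]
    exact_mod_cast abs_moebius_le_one
  have hx (x : Σ n : ℕ+, Nat.divisorsAntidiagonal n) :
      (sigmaAntidiagonalEquivProd x).1 * (sigmaAntidiagonalEquivProd x).2 = x.1 :=
    congrArg Sigma.fst (sigmaAntidiagonalEquivProd.symm_apply_apply x)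
  calc _ = ∑' m : ℕ+, ∑' m', (moebius m : ℝ) * G (m * m') := by simp_rw [tsum_mul_left]
    _ = ∑' q : ℕ+ × ℕ+, (moebius q.1 : ℝ) * G (q.1 * q.2) := hs.tsum_prod.symm
    _ = ∑' x : Σ n : ℕ+, Nat.divisorsAntidiagonal n, (moebius x.2.1.1 : ℝ) * G x.1 := by
        rw [← sigmaAntidiagonalEquivProd.tsum_eq]
        refine tsum_congr fun x => ?_
        rw [hx]
        rfl
    _ = ∑' n : ℕ+, ∑' q : Nat.divisorsAntidiagonal n, (moebius q.1.1 : ℝ) * G n := by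
        refine Summable.tsum_sigma' (fun n => Summable.of_finite) ?_
        rw [← sigmaAntidiagonalEquivProd.summable_iff] at hs
        refine hs.congr fun x => ?_
        simp only [Function.comp]
        rw [hx]
        rfl
    _ = ∑' n : ℕ+, (if n = 1 then G 1 else 0) := by
        refine tsum_congr fun n => ?_
        rw [Finset.tsum_subtype (Nat.divisorsAntidiagonal n) fun q => (moebius q.1 : ℝ) * G n,
          ← Finset.sum_mul, sum_moebius_divisorsAntidiagonal]
        by_cases h : n = 1
        · simp [h]
        · simp [h]
    _ = G 1 := tsum_ite_eq _ _

end Moebius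

theorem abs_tsum_le_ncard_mul {ι : Type*} {g : ι → ℝ} {s : Set ι} (hs : s.Finite)
    (hg : ∀ i, g i ≠ 0 → i ∈ s) {M : ℝ} (hM : ∀ i, |g i| ≤ M) :
    |∑' i, g i| ≤ s.ncard * M := by
  rw [tsum_eq_sum (s := hs.toFinset) fun i hi => by
    by_contra h
    exact hi (hs.mem_toFinset.2 (hg i h))]
  refine (Finset.abs_sum_le_sum_abs _ _).trans ((Finset.sum_le_card_nsmul _ _ M
    fun i _ => hM i).trans_eq ?_)
  rw [Set.ncard_eq_toFinset_card s hs, nsmul_eq_mul]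

namespace PrimeTup

section CountPrimitive

open scoped ENNReal Topology
open Filter

variable {S : PrimeTup} {d : ℕ}

theorem norm_natCast_of_mem_NS {m : ℕ} (hm : m ∈ S.NS) (i : Fin S.s) : ‖(m : S.Qp i)‖ = 1 := by
  rw [Padic.norm_natCast_eq_one_iff]
  exact ((S.hp i).coprime_iff_not_dvd.2 (hm.2 i))

theorem mul_mem_NS_iff {m n : ℕ} : m * n ∈ S.NS ↔ m ∈ S.NS ∧ n ∈ S.NS := by
  refine ⟨fun h => ⟨⟨Nat.pos_of_mul_pos_right h.1, fun i hi => h.2 i (hi.mul_right _)⟩,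
    ⟨Nat.pos_of_mul_pos_left h.1, fun i hi => h.2 i (hi.mul_left _)⟩⟩, fun h =>
    ⟨Nat.mul_pos h.1.1 h.2.1, fun i hi => ?_⟩⟩
  exact ((S.hp i).dvd_mul.1 hi).elim (h.1.2 i) (h.2.2 i)

theorem exists_ncard_norm_le (S : PrimeTup) (d : ℕ) {R : ℝ} (hR : 0 ≤ R) :
    ∃ C : ℝ, 0 ≤ C ∧ ∀ (k : (S.Zs)ˣ) (t : ℝ × ((i : Fin S.s) → S.Qp i)), 0 < t.1 →
      (∀ i, ‖t.2 i‖ = 1) →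
      {w : Fin d → S.Zs | w ≠ 0 ∧ ‖scale t (dg w)‖ ≤ R ∧
        ‖scale t (dg ((k : S.Zs) • w))‖ ≤ R}.Finite ∧
      t.1 ^ d * ({w : Fin d → S.Zs | w ≠ 0 ∧ ‖scale t (dg w)‖ ≤ R ∧
        ‖scale t (dg ((k : S.Zs) • w))‖ ≤ R}.ncard : ℝ) ≤ C / height ((k : S.Zs) : ℚ) ^ d := by
  obtain ⟨Q, hQ0, -, hQ⟩ := exists_smooth_norm_lt S (δ := 1 / (R + 1)) (by positivity)
  have hQ' : ∀ i, ‖(Q : S.Qp i)‖ * R ≤ 1 := fun i =>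
    calc ‖(Q : S.Qp i)‖ * R ≤ 1 / (R + 1) * (R + 1) :=
          mul_le_mul (hQ i).le (by linarith) hR (by positivity)
      _ = 1 := by field_simp
  refine ⟨(3 * Q * R) ^ d, by positivity, fun k t h0 h1 => ?_⟩
  rw [← div_pow]
  exact ncard_le_of_norm_le h0 h1 hR hQ0 hQ' k

theorem scale_natCast_mul_dg (m : ℕ) (t : ℝ × ((i : Fin S.s) → S.Qp i)) (w : Fin d → S.Zs) :
    scale ((m : ℝ × ((i : Fin S.s) → S.Qp i)) * t) (dg w) = scale t (dg ((m : S.Zs) • w)) := by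
  refine Prod.ext (funext fun j => ?_) (funext fun i => funext fun j => ?_)
  · change (m * t.1) * ((w j : ℚ) : ℝ) = t.1 * (((m : S.Zs) * w j : S.Zs) : ℚ)
    push_cast
    ring
  · change (m * t.2 i) * ((w j : ℚ) : S.Qp i) = t.2 i * (((m : S.Zs) * w j : S.Zs) : ℚ)
    push_cast
    ring

/-- The sum of `f` over the primitive vectors scaled by `t`. -/
noncomputable def primSum (f : S.QS d → ℝ) (t : ℝ × ((i : Fin S.s) → S.Qp i)) : ℝ :=
  ∑' v : S.primZs d, f (scale t (dg v.1))

/-- The sum of `f` over the nonzero vectors of `ℤ_S^d` scaled by `t`. -/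
noncomputable def nonzeroSum (f : S.QS d → ℝ) (t : ℝ × ((i : Fin S.s) → S.Qp i)) : ℝ :=
  ∑' w : Fin d → S.Zs, {w | w ≠ 0}.indicator (fun w => f (scale t (dg w))) w

theorem exists_nonzeroSum_bound {f : S.QS d → ℝ} {R M : ℝ} (hR : 0 ≤ R)
    (hfR : ∀ x, f x ≠ 0 → ‖x‖ ≤ R) (hM : ∀ x, |f x| ≤ M) :
    ∃ C : ℝ, ∀ t : ℝ × ((i : Fin S.s) → S.Qp i), 0 < t.1 → (∀ i, ‖t.2 i‖ = 1) →
      |t.1 ^ d * nonzeroSum f t| ≤ C := by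
  obtain ⟨C, hC, h⟩ := exists_ncard_norm_le S d hR
  have hM0 : 0 ≤ M := (abs_nonneg _).trans (hM 0)
  refine ⟨C * M, fun t h0 h1 => ?_⟩
  obtain ⟨hfin, hle⟩ := h 1 t h0 h1
  have h1h : height ((1 : S.Zs) : ℚ) = 1 := by simp [height]
  rw [Units.val_one, h1h, one_pow, div_one] at hle
  rw [abs_mul, abs_of_pos (pow_pos h0 d)]
  refine (mul_le_mul_of_nonneg_left (abs_tsum_le_ncard_mul hfin ?_ (M := M) ?_)
    (pow_nonneg h0.le _)).trans ?_
  · intro w hw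
    have hw' := Set.indicator_apply_ne_zero.1 hw
    exact ⟨hw'.1, hfR _ hw'.2, by simpa using hfR _ hw'.2⟩
  · intro w
    by_cases hw : w ∈ {w : Fin d → S.Zs | w ≠ 0}
    · rw [Set.indicator_of_mem hw]
      exact hM _
    · rw [Set.indicator_of_notMem hw, abs_zero]
      exact hM0
  · rw [← mul_assoc]
    exact mul_le_mul_of_nonneg_right hle hM0

theorem tendsto_nonzeroSum (hd : 0 < d) {f : S.QS d → ℝ} (hf : Continuous f)
    (hc : HasCompactSupport f) (t : ℕ → ℝ × ((i : Fin S.s) → S.Qp i)) (h0 : ∀ n, 0 < (t n).1)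
    (h1 : ∀ n i, ‖(t n).2 i‖ = 1) (hlim : Tendsto (fun n => (t n).1) atTop (𝓝 0)) :
    Tendsto (fun n => (t n).1 ^ d * nonzeroSum f (t n)) atTop
      (𝓝 (∫ x, f x ∂(stdVol S d))) := by
  have h := tendsto_sum_dg hf hc h0 h1 hlim
  have h2 : Tendsto (fun n => (t n).1 ^ d * f 0) atTop (𝓝 0) := by
    simpa [hd.ne'] using (hlim.pow d).mul_const (f 0)
  rw [← sub_zero (∫ x, f x ∂(stdVol S d))]
  refine (h.sub h2).congr fun n => ?_
  obtain ⟨R, hR, hfR⟩ := exists_norm_bound hc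
  obtain ⟨C, hC, hfin⟩ := exists_ncard_norm_le S d hR
  have hs : Summable fun w : Fin d → S.Zs => f (scale (t n) (dg w)) := by
    refine summable_of_hasFiniteSupport (((hfin 1 _ (h0 n) (h1 n)).1.union
      (Set.finite_singleton 0)).subset fun w hw => ?_)
    by_cases hw0 : w = 0
    · exact Or.inr hw0
    · exact Or.inl ⟨hw0, hfR _ hw, by simpa using hfR _ hw⟩
  have hz : scale (t n) (dg (0 : Fin d → S.Zs)) = 0 := by
    refine Prod.ext (funext fun j => ?_) (funext fun i => funext fun j => ?_)
    · change (t n).1 * ((0 : ℚ) : ℝ) = 0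
      simp
    · change (t n).2 i * ((0 : ℚ) : S.Qp i) = 0
      simp
  rw [← mul_sub, nonzeroSum, hs.tsum_eq_add_tsum_ite 0, hz, add_sub_cancel_left]
  congr 1
  refine tsum_congr fun w => ?_
  by_cases hw0 : w = 0 <;> simp [hw0]

end CountPrimitive

end PrimeTup

namespace PrimeTup

section CountPrimitive

open scoped ENNReal Topology
open Filter

variable {S : PrimeTup} {d : ℕ}

theorem scale_natCast_good {m : ℕ} (hm : m ∈ S.NS) {t : ℝ × ((i : Fin S.s) → S.Qp i)}
    (h0 : 0 < t.1) (h1 : ∀ i, ‖t.2 i‖ = 1) :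
    0 < ((m : ℝ × ((i : Fin S.s) → S.Qp i)) * t).1 ∧
      ∀ i, ‖((m : ℝ × ((i : Fin S.s) → S.Qp i)) * t).2 i‖ = 1 := by
  refine ⟨mul_pos (Nat.cast_pos.2 hm.1) h0, fun i => ?_⟩
  change ‖(m : S.Qp i) * t.2 i‖ = 1
  rw [norm_mul, norm_natCast_of_mem_NS hm, h1, one_mul]

theorem nonzeroSum_eq_tsum_primSum (hd : 2 ≤ d) {f : S.QS d → ℝ} {R : ℝ} (hR : 0 ≤ R)
    (hfR : ∀ x, f x ≠ 0 → ‖x‖ ≤ R) {t : ℝ × ((i : Fin S.s) → S.Qp i)} (h0 : 0 < t.1)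
    (h1 : ∀ i, ‖t.2 i‖ = 1) :
    nonzeroSum f t = ∑' m : ℕ+, {m : ℕ+ | (m : ℕ) ∈ S.NS}.indicator
      (fun m => primSum f (((m : ℕ) : ℝ × ((i : Fin S.s) → S.Qp i)) * t)) m := by
  obtain ⟨C, hC, hfin⟩ := exists_ncard_norm_le S d hR
  set A : Set ℕ+ := {m : ℕ+ | (m : ℕ) ∈ S.NS} with hA
  let φ : A × S.primZs d → Fin d → S.Zs := fun q => ((q.1.1 : ℕ) : S.Zs) • q.2.1
  have hφ : Function.Injective φ := by
    rintro ⟨⟨m, hm⟩, v, hv⟩ ⟨⟨m', hm'⟩, v', hv'⟩ h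
    obtain ⟨h2, h3⟩ := NS_smul_prim_unique (by omega) hm hm' hv hv' h
    have h4 := PNat.coe_injective h2
    subst h4 h3
    rfl
  set g : (Fin d → S.Zs) → ℝ := {w | w ≠ 0}.indicator (fun w => f (scale t (dg w))) with hg
  have hgs : Function.support g ⊆ Set.range φ := by
    intro w hw
    obtain ⟨m, hm, v, hv, rfl⟩ := exists_NS_smul_prim hd (Set.indicator_apply_ne_zero.1 hw).1
    exact ⟨(⟨⟨m, hm.1⟩, hm⟩, ⟨v, hv⟩), rfl⟩
  have hgfin : (Function.support g).Finite := by
    refine ((hfin 1 t h0 h1).1).subset fun w hw => ?_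
    have hw' := Set.indicator_apply_ne_zero.1 hw
    exact ⟨hw'.1, hfR _ hw'.2, by simpa using hfR _ hw'.2⟩
  have hsum : Summable fun q => g (φ q) :=
    summable_of_hasFiniteSupport ((hgfin.preimage hφ.injOn).subset fun q hq => hq)
  rw [← tsum_subtype A, nonzeroSum, ← hφ.tsum_eq hgs, hsum.tsum_prod]
  refine tsum_congr fun m => tsum_congr fun v => ?_
  have hne : φ (m, v) ≠ 0 := smul_ne_zero (NS_ne_zero m.2) (ne_zero_of_mem_primZs (by omega) v.2)
  rw [hg, Set.indicator_of_mem (show φ (m, v) ∈ {w | w ≠ 0} from hne), scale_natCast_mul_dg]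

theorem primSum_eq_zero_of_lt {f : S.QS d → ℝ} {R : ℝ} (hd : 0 < d) (hR : 0 ≤ R)
    (hfR : ∀ x, f x ≠ 0 → ‖x‖ ≤ R) : ∃ C : ℝ, ∀ t : ℝ × ((i : Fin S.s) → S.Qp i), 0 < t.1 →
      (∀ i, ‖t.2 i‖ = 1) → C < t.1 ^ d → primSum f t = 0 := by
  obtain ⟨C, hC, hfin⟩ := exists_ncard_norm_le S d hR
  refine ⟨C, fun t h0 h1 ht => ?_⟩
  obtain ⟨hf, hle⟩ := hfin 1 t h0 h1
  rw [show height (((1 : (S.Zs)ˣ) : S.Zs) : ℚ) = 1 by simp [height], one_pow, div_one] at hle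
  refine (tsum_congr fun v => ?_).trans tsum_zero
  by_contra hv
  have h2 : 1 ≤ Set.ncard _ := (Set.ncard_pos hf).2
    ⟨v.1, ne_zero_of_mem_primZs hd v.2, hfR _ hv, by simpa using hfR _ hv⟩
  have h3 := mul_le_mul_of_nonneg_left (Nat.one_le_cast (α := ℝ).2 h2) (pow_nonneg h0.le d)
  rw [mul_one] at h3
  exact absurd (h3.trans hle) (not_le.2 ht)

theorem primSum_eq_tsum_moebius (hd : 2 ≤ d) {f : S.QS d → ℝ} {R : ℝ} (hR : 0 ≤ R)
    (hfR : ∀ x, f x ≠ 0 → ‖x‖ ≤ R) {t : ℝ × ((i : Fin S.s) → S.Qp i)} (h0 : 0 < t.1)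
    (h1 : ∀ i, ‖t.2 i‖ = 1) :
    primSum f t = ∑' m : ℕ+, (ArithmeticFunction.moebius m : ℝ) *
      {m : ℕ+ | (m : ℕ) ∈ S.NS}.indicator
        (fun m => nonzeroSum f (((m : ℕ) : ℝ × ((i : Fin S.s) → S.Qp i)) * t)) m := by
  set A : Set ℕ+ := {m : ℕ+ | (m : ℕ) ∈ S.NS} with hA
  set G : ℕ+ → ℝ := A.indicator
    (fun m => primSum f (((m : ℕ) : ℝ × ((i : Fin S.s) → S.Qp i)) * t)) with hG
  obtain ⟨C, hC⟩ := primSum_eq_zero_of_lt (S := S) (d := d) (by omega) hR hfR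
  obtain ⟨N, hN⟩ := exists_nat_gt (C / t.1 ^ d)
  have hGN : ∀ m : ℕ+, N < (m : ℕ) → G m = 0 := by
    intro m hm
    by_contra h
    obtain ⟨hmA, h⟩ := Set.indicator_apply_ne_zero.1 h
    obtain ⟨h0', h1'⟩ := scale_natCast_good hmA h0 h1
    refine h (hC _ h0' h1' ?_)
    change C < (((m : ℕ) : ℝ) * t.1) ^ d
    rw [mul_pow, ← div_lt_iff₀ (pow_pos h0 d)]
    refine hN.trans_le ((Nat.cast_le.2 hm.le).trans (le_self_pow₀ ?_ (by omega)))
    exact Nat.one_le_cast.2 m.pos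
  have hGs : Summable fun q : ℕ+ × ℕ+ => G (q.1 * q.2) := by
    refine summable_of_hasFiniteSupport (((Set.finite_Iic (N.succPNat)).prod
      (Set.finite_Iic (N.succPNat))).subset fun q hq => ?_)
    have h2 : ((q.1 * q.2 : ℕ+) : ℕ) ≤ N := not_lt.1 fun h => hq (hGN _ h)
    rw [PNat.mul_coe] at h2
    have h3 := Nat.le_mul_of_pos_right (q.1 : ℕ) q.2.pos
    have h4 := Nat.le_mul_of_pos_left (q.2 : ℕ) q.1.pos
    constructor <;> rw [Set.mem_Iic, ← PNat.coe_le_coe, Nat.succPNat_coe] <;> omega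
  have h1A : (1 : ℕ+) ∈ A := by
    refine ⟨one_pos, fun i hi => (S.hp i).one_lt.ne' (Nat.dvd_one.1 hi)⟩
  have h := tsum_moebius_mul_tsum_mul hGs
  rw [hG, Set.indicator_of_mem h1A] at h
  simp only [PNat.one_coe, Nat.cast_one, one_mul] at h
  rw [← h]
  have hmulA (m n : ℕ+) : m * n ∈ A ↔ m ∈ A ∧ n ∈ A := by
    simp only [hA, Set.mem_ofPred_eq, PNat.mul_coe, mul_mem_NS_iff]
  refine tsum_congr fun m => ?_
  congr 1
  by_cases hm : m ∈ A
  · obtain ⟨h0', h1'⟩ := scale_natCast_good hm h0 h1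
    rw [Set.indicator_of_mem hm, nonzeroSum_eq_tsum_primSum hd hR hfR h0' h1']
    refine tsum_congr fun n => ?_
    by_cases hn : n ∈ A
    · rw [Set.indicator_of_mem hn, Set.indicator_of_mem ((hmulA m n).2 ⟨hm, hn⟩), PNat.mul_coe,
        Nat.cast_mul, ← mul_assoc,
        mul_comm ((m : ℕ) : ℝ × ((i : Fin S.s) → S.Qp i))]
    · rw [Set.indicator_of_notMem hn, Set.indicator_of_notMem fun h =>
        hn ((hmulA m n).1 h).2]
  · rw [Set.indicator_of_notMem hm]
    refine ((tsum_congr fun n => ?_).trans tsum_zero)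
    exact Set.indicator_of_notMem (fun h => hm ((hmulA m n).1 h).1) _

theorem summable_indicator_NS (hd : 2 ≤ d) : Summable ({m : ℕ+ | (m : ℕ) ∈ S.NS}.indicator
    fun m : ℕ+ => 1 / ((m : ℕ) : ℝ) ^ d) :=
  (((Real.summable_one_div_nat_pow.2 (by omega)).comp_injective PNat.coe_injective)).indicator _

theorem tsum_indicator_NS : ∑' m : ℕ+, {m : ℕ+ | (m : ℕ) ∈ S.NS}.indicator
    (fun m : ℕ+ => 1 / ((m : ℕ) : ℝ) ^ d) m = S.zetaS d := by
  rw [← tsum_subtype, zetaS]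
  refine Equiv.tsum_eq (⟨fun m => ⟨m.1, m.2⟩, fun m => ⟨⟨m.1, m.2.1⟩, m.2⟩, fun _ => rfl,
    fun _ => rfl⟩ : {m : ℕ+ | (m : ℕ) ∈ S.NS} ≃ S.NS) fun m => 1 / ((m : ℕ) : ℝ) ^ d

theorem zetaS_ne_zero (hd : 2 ≤ d) : S.zetaS d ≠ 0 := by
  rw [← tsum_indicator_NS]
  have h1A : (1 : ℕ+) ∈ {m : ℕ+ | (m : ℕ) ∈ S.NS} := by
    refine ⟨one_pos, fun i hi => (S.hp i).one_lt.ne' (Nat.dvd_one.1 hi)⟩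
  refine ((summable_indicator_NS hd).tsum_pos (fun m => Set.indicator_nonneg
    (fun m _ => by positivity) _) 1 ?_).ne'
  rw [Set.indicator_of_mem h1A]
  simp

theorem tsum_moebius_NS (hd : 2 ≤ d) : ∑' m : ℕ+, (ArithmeticFunction.moebius m : ℝ) *
    {m : ℕ+ | (m : ℕ) ∈ S.NS}.indicator (fun m : ℕ+ => 1 / ((m : ℕ) : ℝ) ^ d) m =
      1 / S.zetaS d := by
  set A : Set ℕ+ := {m : ℕ+ | (m : ℕ) ∈ S.NS} with hA
  set G : ℕ+ → ℝ := A.indicator (fun m : ℕ+ => 1 / ((m : ℕ) : ℝ) ^ d) with hG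
  have hmul (m n : ℕ+) : G (m * n) = G m * G n := by
    have h : m * n ∈ A ↔ m ∈ A ∧ n ∈ A := by
      simp only [hA, Set.mem_ofPred_eq, PNat.mul_coe, mul_mem_NS_iff]
    by_cases hm : m ∈ A <;> by_cases hn : n ∈ A <;> simp [hG, h, hm, hn, mul_pow, mul_comm]
  have hs := summable_indicator_NS (S := S) hd
  have h1A : (1 : ℕ+) ∈ A := by
    refine ⟨one_pos, fun i hi => (S.hp i).one_lt.ne' (Nat.dvd_one.1 hi)⟩
  have h := tsum_moebius_mul_tsum_mul (G := G) (by
    simp_rw [hmul]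
    exact hs.mul_of_nonneg hs (fun m => Set.indicator_nonneg (fun m _ => by positivity) _)
      (fun m => Set.indicator_nonneg (fun m _ => by positivity) _))
  simp_rw [hmul, tsum_mul_left] at h
  rw [show ∑' n, G n = S.zetaS d from tsum_indicator_NS] at h
  simp_rw [← mul_assoc] at h
  rw [tsum_mul_right, show G 1 = 1 by rw [hG, Set.indicator_of_mem h1A]; simp] at h
  exact eq_one_div_of_mul_eq_one_left h

theorem tendsto_primSum (hd : 2 ≤ d) {f : S.QS d → ℝ} (hf : Continuous f)
    (hc : HasCompactSupport f) (t : ℕ → ℝ × ((i : Fin S.s) → S.Qp i)) (h0 : ∀ n, 0 < (t n).1)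
    (h1 : ∀ n i, ‖(t n).2 i‖ = 1) (hlim : Tendsto (fun n => (t n).1) atTop (𝓝 0)) :
    Tendsto (fun n => (t n).1 ^ d * primSum f (t n)) atTop
      (𝓝 (1 / S.zetaS d * ∫ x, f x ∂(stdVol S d))) := by
  obtain ⟨R, hR, hfR⟩ := exists_norm_bound hc
  obtain ⟨M, hM⟩ := hc.exists_bound_of_continuous hf
  obtain ⟨C, hC⟩ := exists_nonzeroSum_bound hR hfR hM
  rw [← tsum_moebius_NS hd, ← tsum_mul_right]
  have hμ (m : ℕ+) : |(ArithmeticFunction.moebius m : ℝ)| ≤ 1 := by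
    rw [← Int.cast_abs]
    exact_mod_cast ArithmeticFunction.abs_moebius_le_one
  have hkey (m : ℕ+) (u : ℝ × ((i : Fin S.s) → S.Qp i)) : u.1 ^ d *
      nonzeroSum f (((m : ℕ) : ℝ × ((i : Fin S.s) → S.Qp i)) * u) = 1 / ((m : ℕ) : ℝ) ^ d *
      ((((m : ℕ) : ℝ × ((i : Fin S.s) → S.Qp i)) * u).1 ^ d *
        nonzeroSum f (((m : ℕ) : ℝ × ((i : Fin S.s) → S.Qp i)) * u)) := by
    have : ((m : ℕ) : ℝ) ≠ 0 := by simp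
    change _ = 1 / ((m : ℕ) : ℝ) ^ d * ((((m : ℕ) : ℝ) * u.1) ^ d * _)
    field_simp
    ring
  have h := tendsto_tsum_of_dominated_convergence (β := ℕ+) (𝓕 := atTop)
    (f := fun n m => (ArithmeticFunction.moebius m : ℝ) *
      {m : ℕ+ | (m : ℕ) ∈ S.NS}.indicator (fun m => (t n).1 ^ d *
        nonzeroSum f (((m : ℕ) : ℝ × ((i : Fin S.s) → S.Qp i)) * t n)) m)
    (g := fun m => (ArithmeticFunction.moebius m : ℝ) *
      {m : ℕ+ | (m : ℕ) ∈ S.NS}.indicator (fun m : ℕ+ => 1 / ((m : ℕ) : ℝ) ^ d) m *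
        ∫ x, f x ∂(stdVol S d))
    (bound := fun m => {m : ℕ+ | (m : ℕ) ∈ S.NS}.indicator
      (fun m : ℕ+ => 1 / ((m : ℕ) : ℝ) ^ d) m * C)
    ((summable_indicator_NS hd).mul_right C) ?_ ?_
  · refine h.congr fun n => ?_
    rw [primSum_eq_tsum_moebius hd hR hfR (h0 n) (h1 n), ← tsum_mul_left]
    refine tsum_congr fun m => ?_
    by_cases hm : m ∈ {m : ℕ+ | (m : ℕ) ∈ S.NS}
    · rw [Set.indicator_of_mem hm, Set.indicator_of_mem hm]
      ring
    · rw [Set.indicator_of_notMem hm, Set.indicator_of_notMem hm]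
      ring
  · intro m
    by_cases hm : m ∈ {m : ℕ+ | (m : ℕ) ∈ S.NS}
    · simp_rw [Set.indicator_of_mem hm, mul_assoc]
      refine Tendsto.const_mul _ ?_
      simp_rw [hkey]
      refine Tendsto.const_mul _ ?_
      refine tendsto_nonzeroSum (by omega) hf hc _
        (fun n => (scale_natCast_good hm (h0 n) (h1 n)).1)
        (fun n => (scale_natCast_good hm (h0 n) (h1 n)).2) ?_
      have := hlim.const_mul ((m : ℕ) : ℝ)
      rw [mul_zero] at this
      exact this
    · simp_rw [Set.indicator_of_notMem hm, mul_zero, zero_mul]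
      exact tendsto_const_nhds
  · refine Eventually.of_forall fun n m => ?_
    rw [norm_mul]
    refine (mul_le_of_le_one_left (norm_nonneg _) (hμ m)).trans ?_
    by_cases hm : m ∈ {m : ℕ+ | (m : ℕ) ∈ S.NS}
    · rw [Set.indicator_of_mem hm, Set.indicator_of_mem hm, hkey, norm_mul,
        Real.norm_of_nonneg (by positivity)]
      exact mul_le_mul_of_nonneg_left (hC _ (scale_natCast_good hm (h0 n) (h1 n)).1
        (scale_natCast_good hm (h0 n) (h1 n)).2) (by positivity)
    · rw [Set.indicator_of_notMem hm, Set.indicator_of_notMem hm, norm_zero, zero_mul]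

end CountPrimitive

end PrimeTup

namespace PrimeTup

section CountDependent

open scoped ENNReal Topology
open Filter

variable {S : PrimeTup} {d : ℕ}

theorem one_div_height_pow_le (hd : 3 ≤ d) {q : ℚ} (hq : q ≠ 0) :
    1 / height q ^ d ≤ |(q.num : ℝ)| ^ (-(3 / 2) : ℝ) * |((q.den : ℤ) : ℝ)| ^ (-(3 / 2) : ℝ) := by
  have h0 := height_pos q
  have h1 : 1 ≤ height q := (Nat.one_le_cast.2 q.den_pos).trans (le_max_right _ _)
  have hn : 0 < |(q.num : ℝ)| := abs_pos.2 (Int.cast_ne_zero.2 (Rat.num_ne_zero.2 hq))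
  have hd0 : 0 < (q.den : ℝ) := Nat.cast_pos.2 q.den_pos
  calc 1 / height q ^ d ≤ 1 / height q ^ 3 :=
        one_div_le_one_div_of_le (by positivity) (pow_le_pow_right₀ h1 hd)
    _ = height q ^ (-(3 / 2) : ℝ) * height q ^ (-(3 / 2) : ℝ) := by
        rw [← Real.rpow_add h0, ← Real.rpow_natCast, one_div, ← Real.rpow_neg h0.le]
        norm_num
    _ ≤ _ := by
        rw [Int.cast_natCast, abs_of_pos hd0]
        exact mul_le_mul
          (Real.rpow_le_rpow_of_nonpos hn (le_max_left _ _) (by norm_num))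
          (Real.rpow_le_rpow_of_nonpos hd0 (le_max_right _ _) (by norm_num))
          (by positivity) (by positivity)

theorem summable_one_div_height_pow (hd : 3 ≤ d) :
    Summable fun k : (S.Zs)ˣ => 1 / height ((k : S.Zs) : ℚ) ^ d := by
  have h1 : Summable fun n : ℤ => |(n : ℝ)| ^ (-(3 / 2) : ℝ) :=
    Real.summable_abs_int_rpow (by norm_num)
  have h2 := h1.mul_of_nonneg h1 (fun n => by positivity) (fun n => by positivity)
  have hinj : Function.Injective fun k : (S.Zs)ˣ =>
      ((((k : S.Zs) : ℚ).num, (((k : S.Zs) : ℚ).den : ℤ)) : ℤ × ℤ) := by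
    intro k l h
    have h3 := congrArg Prod.fst h
    have h4 := congrArg Prod.snd h
    exact Units.ext (Subtype.ext (Rat.ext h3 (Nat.cast_injective (R := ℤ) h4)))
  refine Summable.of_nonneg_of_le (fun k => by positivity [height_pos ((k : S.Zs) : ℚ)])
    (fun k => ?_) (h2.comp_injective hinj)
  exact one_div_height_pow_le hd fun h => k.ne_zero (Subtype.ext h)

theorem continuous_ratSMul (q : ℚ) : Continuous (S.ratSMul q : S.QS d → S.QS d) :=
  continuous_scale ((q : ℝ), fun i => (q : S.Qp i))

theorem ratSMul_scale_dg (k : (S.Zs)ˣ) (t : ℝ × ((i : Fin S.s) → S.Qp i)) (w : Fin d → S.Zs) :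
    S.ratSMul ((k : S.Zs) : ℚ) (scale t (dg w)) = scale t (dg ((k : S.Zs) • w)) := by
  refine Prod.ext (funext fun j => ?_) (funext fun i => funext fun j => ?_)
  · change (((k : S.Zs) : ℚ) : ℝ) * (t.1 * ((w j : ℚ) : ℝ)) =
      t.1 * ((((k : S.Zs) * w j : S.Zs) : ℚ) : ℝ)
    push_cast
    ring
  · change (((k : S.Zs) : ℚ) : S.Qp i) * (t.2 i * ((w j : ℚ) : S.Qp i)) =
      t.2 i * ((((k : S.Zs) * w j : S.Zs) : ℚ) : S.Qp i)
    push_cast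
    ring

/-- The function `x ↦ f₁ x * f₂ (k x)`. -/
noncomputable def twist (f₁ f₂ : S.QS d → ℝ) (k : (S.Zs)ˣ) (x : S.QS d) : ℝ :=
  f₁ x * f₂ (S.ratSMul ((k : S.Zs) : ℚ) x)

theorem continuous_twist {f₁ f₂ : S.QS d → ℝ} (h₁ : Continuous f₁) (h₂ : Continuous f₂)
    (k : (S.Zs)ˣ) : Continuous (twist f₁ f₂ k) :=
  h₁.mul (h₂.comp (continuous_ratSMul _))

theorem hasCompactSupport_twist {f₁ : S.QS d → ℝ} (h₁ : HasCompactSupport f₁) (f₂ : S.QS d → ℝ)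
    (k : (S.Zs)ˣ) : HasCompactSupport (twist f₁ f₂ k) :=
  h₁.mul_right

theorem exists_primSum_twist_bound (hd : 0 < d) {f₁ f₂ : S.QS d → ℝ} (h₁ : Continuous f₁)
    (h₂ : Continuous f₂) (hc₁ : HasCompactSupport f₁) (hc₂ : HasCompactSupport f₂) :
    ∃ C : ℝ, ∀ (k : (S.Zs)ˣ) (t : ℝ × ((i : Fin S.s) → S.Qp i)), 0 < t.1 → (∀ i, ‖t.2 i‖ = 1) →
      |t.1 ^ d * primSum (twist f₁ f₂ k) t| ≤ 1 / height ((k : S.Zs) : ℚ) ^ d * C := by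
  obtain ⟨R₁, hR₁, hfR₁⟩ := exists_norm_bound hc₁
  obtain ⟨R₂, hR₂, hfR₂⟩ := exists_norm_bound hc₂
  obtain ⟨M₁, hM₁⟩ := hc₁.exists_bound_of_continuous h₁
  obtain ⟨M₂, hM₂⟩ := hc₂.exists_bound_of_continuous h₂
  obtain ⟨C, hC, hfin⟩ := exists_ncard_norm_le S d (R := max R₁ R₂) (le_max_of_le_left hR₁)
  have hM1 : 0 ≤ M₁ := (norm_nonneg _).trans (hM₁ 0)
  have hM2 : 0 ≤ M₂ := (norm_nonneg _).trans (hM₂ 0)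
  refine ⟨C * (M₁ * M₂), fun k t h0 h1 => ?_⟩
  obtain ⟨hf, hle⟩ := hfin k t h0 h1
  rw [abs_mul, abs_of_pos (pow_pos h0 d)]
  set W := {w : Fin d → S.Zs | w ≠ 0 ∧ ‖scale t (dg w)‖ ≤ max R₁ R₂ ∧
        ‖scale t (dg ((k : S.Zs) • w))‖ ≤ max R₁ R₂} with hW
  have hf' : ((↑) ⁻¹' W : Set (S.primZs d)).Finite := hf.preimage Subtype.val_injective.injOn
  have hb : |primSum (twist f₁ f₂ k) t| ≤ ((↑) ⁻¹' W : Set (S.primZs d)).ncard * (M₁ * M₂) := by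
    refine abs_tsum_le_ncard_mul hf' (fun v hv => ?_) fun v => ?_
    · rw [twist, ratSMul_scale_dg] at hv
      exact ⟨ne_zero_of_mem_primZs hd v.2, le_max_of_le_left (hfR₁ _ (left_ne_zero_of_mul hv)),
        le_max_of_le_right (hfR₂ _ (right_ne_zero_of_mul hv))⟩
    · rw [twist, abs_mul]
      exact mul_le_mul (hM₁ _) (hM₂ _) (abs_nonneg _) hM1
  have hn : (((↑) ⁻¹' W : Set (S.primZs d)).ncard : ℝ) ≤ W.ncard := by
    rw [← Set.ncard_image_of_injective _ Subtype.val_injective]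
    exact Nat.cast_le.2 (Set.ncard_le_ncard (Set.image_preimage_subset _ _) hf)
  calc _ ≤ t.1 ^ d * (W.ncard * (M₁ * M₂)) := mul_le_mul_of_nonneg_left
        (hb.trans (mul_le_mul_of_nonneg_right hn (by positivity))) (by positivity)
    _ = (t.1 ^ d * W.ncard) * (M₁ * M₂) := by ring
    _ ≤ C / height ((k : S.Zs) : ℚ) ^ d * (M₁ * M₂) :=
        mul_le_mul_of_nonneg_right hle (by positivity)
    _ = _ := by ring

theorem summable_primSum_twist (hd : 3 ≤ d) {f₁ f₂ : S.QS d → ℝ} (h₁ : Continuous f₁)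
    (h₂ : Continuous f₂) (hc₁ : HasCompactSupport f₁) (hc₂ : HasCompactSupport f₂)
    {t : ℝ × ((i : Fin S.s) → S.Qp i)} (h0 : 0 < t.1) (h1 : ∀ i, ‖t.2 i‖ = 1) :
    Summable fun k : (S.Zs)ˣ => primSum (twist f₁ f₂ k) t := by
  obtain ⟨C, hC⟩ := exists_primSum_twist_bound (by omega) h₁ h₂ hc₁ hc₂
  rw [← summable_mul_left_iff (pow_pos h0 d).ne']
  exact Summable.of_norm_bounded ((summable_one_div_height_pow hd).mul_right C)
    fun k => hC k t h0 h1

theorem tendsto_tsum_primSum_twist (hd : 3 ≤ d) {f₁ f₂ : S.QS d → ℝ} (h₁ : Continuous f₁)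
    (h₂ : Continuous f₂) (hc₁ : HasCompactSupport f₁) (hc₂ : HasCompactSupport f₂)
    (t : ℕ → ℝ × ((i : Fin S.s) → S.Qp i)) (h0 : ∀ n, 0 < (t n).1)
    (h1 : ∀ n i, ‖(t n).2 i‖ = 1) (hlim : Tendsto (fun n => (t n).1) atTop (𝓝 0)) :
    (Summable fun k : (S.Zs)ˣ => ∫ x, twist f₁ f₂ k x ∂(stdVol S d)) ∧
    Tendsto (fun n => (t n).1 ^ d * ∑' k : (S.Zs)ˣ, primSum (twist f₁ f₂ k) (t n)) atTop
      (𝓝 (1 / S.zetaS d * ∑' k : (S.Zs)ˣ, ∫ x, twist f₁ f₂ k x ∂(stdVol S d))) := by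
  obtain ⟨C, hC⟩ := exists_primSum_twist_bound (by omega) h₁ h₂ hc₁ hc₂
  have hs := (summable_one_div_height_pow (S := S) hd).mul_right C
  have hlk (k : (S.Zs)ˣ) := tendsto_primSum (by omega) (continuous_twist h₁ h₂ k)
    (hasCompactSupport_twist hc₁ f₂ k) t h0 h1 hlim
  constructor
  · rw [← summable_mul_left_iff (one_div_ne_zero (zetaS_ne_zero (S := S) (d := d) (by omega)))]
    exact Summable.of_norm_bounded hs fun k =>
      le_of_tendsto (hlk k).norm (Eventually.of_forall fun n => hC k _ (h0 n) (h1 n))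
  · simp_rw [← tsum_mul_left]
    exact tendsto_tsum_of_dominated_convergence hs hlk
      (Eventually.of_forall fun n k => hC k _ (h0 n) (h1 n))

end CountDependent

end PrimeTup

namespace PrimeTup

section HeckeSum

open scoped ENNReal Topology Classical
open Filter

theorem IsHeckeScalar.one_le_pow_mul {S : PrimeTup} {d p : ℕ}
    {t : ℝ × ((i : Fin S.s) → S.Qp i)} (ht : S.IsHeckeScalar d p t) {n : ℕ} (hn : n ≤ d)
    (h1 : t.1 ≤ 1) : 1 ≤ t.1 ^ n * p := by
  rw [← ht.pow_mul]
  exact mul_le_mul_of_nonneg_right (pow_le_pow_of_le_one ht.pos.le h1 hn) (Nat.cast_nonneg _)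

variable {S : PrimeTup} {d : ℕ} {p : ℕ} [Fact p.Prime] {t : ℝ × ((i : Fin S.s) → S.Qp i)}

theorem exists_int_vec_of_norm_le (h0 : 0 < t.1) (h1 : ∀ i, ‖t.2 i‖ = 1) {R : ℝ} (hR : 0 ≤ R)
    {Q : ℕ} (hQ : ∀ i, ‖(Q : S.Qp i)‖ * R ≤ 1) {w : Fin d → S.Zs} (hw : ‖scale t (dg w)‖ ≤ R) :
    ∃ z : Fin d → ℤ, (∀ j, (Q : S.Zs) * w j = z j) ∧ ∀ j, t.1 * |(z j : ℝ)| ≤ Q * R := by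
  rw [norm_scale_dg_le_iff h0 h1 hR] at hw
  choose z hz using fun j => exists_int_of_norm_le hQ (w j).2 1 (fun i => hw.2 i j)
    fun i => by simpa using hw.2 i j
  have hz' : ∀ j, (Q : ℚ) * w j = z j := fun j => by simpa using hz j
  refine ⟨z, fun j => Subtype.ext (by push_cast; exact hz' j), fun j => ?_⟩
  have h2 : (z j : ℝ) = Q * ((w j : ℚ) : ℝ) := by exact_mod_cast (hz' j).symm
  rw [h2, abs_mul, Nat.abs_cast, mul_left_comm]
  refine mul_le_mul_of_nonneg_left ?_ (Nat.cast_nonneg _)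
  rw [← le_div_iff₀' h0]
  exact hw.1 j

theorem norm_scale_dg_smul_gt (hd : 2 ≤ d) (hp : ∀ i, p ≠ S.p i) (ht : S.IsHeckeScalar d p t)
    {R : ℝ} (hR : 0 ≤ R) {Q : ℕ} (hQ0 : Q ≠ 0) (hQ : ∀ i, ‖(Q : S.Qp i)‖ * R ≤ 1) (h1 : t.1 ≤ 1)
    (h2 : t.1 * (Q * R) < 1) {w : Fin d → S.Zs} (hw : w ≠ 0) :
    ¬ ‖scale t (dg ((p : S.Zs) • w))‖ ≤ R := by
  intro h
  rw [← scale_natCast_mul_dg] at h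
  obtain ⟨h0', h1'⟩ := scale_natCast_good (mem_NS_of_ne hp) ht.pos ht.norm_eq
  obtain ⟨z, hz, hz'⟩ := exists_int_vec_of_norm_le h0' h1' hR hQ h
  obtain ⟨j, hj⟩ := Function.ne_iff.1 hw
  have hzj : z j ≠ 0 := by
    intro h3
    have h4 := hz j
    rw [h3, Int.cast_zero] at h4
    have h5 : (Q : S.Zs) ≠ 0 := by exact_mod_cast hQ0
    exact (mul_ne_zero h5 hj) h4
  have h6 : (1 : ℝ) ≤ |(z j : ℝ)| := by exact_mod_cast Int.one_le_abs hzj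
  have h7 : (p : ℝ) * t.1 ≤ Q * R :=
    (le_mul_of_one_le_right (mul_nonneg (Nat.cast_nonneg _) ht.pos.le) h6).trans (hz' j)
  have h8 := ht.one_le_pow_mul hd h1
  have h9 := mul_le_mul_of_nonneg_left h7 ht.pos.le
  nlinarith

theorem minor_eq_zero_of_red (hd : 3 ≤ d) (hp : ∀ i, p ≠ S.p i) (ht : S.IsHeckeScalar d p t)
    {R : ℝ} (hR : 0 ≤ R) {Q : ℕ} (hQ0 : Q ≠ 0) (hQ : ∀ i, ‖(Q : S.Qp i)‖ * R ≤ 1) (h1 : t.1 ≤ 1)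
    (h2 : t.1 * (2 * (Q * R) ^ 2) < 1) {v w : Fin d → S.Zs} (hv : ‖scale t (dg v)‖ ≤ R)
    (hw : ‖scale t (dg w)‖ ≤ R) {i j : Fin d}
    (h : red hp (v i) * red hp (w j) = red hp (v j) * red hp (w i)) : v i * w j = v j * w i := by
  obtain ⟨z, hz, hzR⟩ := exists_int_vec_of_norm_le ht.pos ht.norm_eq hR hQ hv
  obtain ⟨y, hy, hyR⟩ := exists_int_vec_of_norm_le ht.pos ht.norm_eq hR hQ hw
  have hQ' : (Q : S.Zs) ≠ 0 := by exact_mod_cast hQ0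
  have e1 : ((z i * y j - z j * y i : ℤ) : S.Zs) = (Q : S.Zs) ^ 2 * (v i * w j - v j * w i) := by
    push_cast
    rw [← hz, ← hz, ← hy, ← hy]
    ring
  have e2 : ((z i * y j - z j * y i : ℤ) : ZMod p) = 0 := by
    rw [← map_intCast (red hp), e1, map_mul, map_sub, map_mul, map_mul, h, sub_self, mul_zero]
  have e3 : z i * y j - z j * y i = 0 := by
    refine Int.eq_zero_of_abs_lt_dvd ((ZMod.intCast_zmod_eq_zero_iff_dvd _ p).1 e2) ?_
    have hB (a b : Fin d) : t.1 ^ 2 * |(z a * y b : ℝ)| ≤ (Q * R) ^ 2 := by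
      rw [abs_mul, sq, sq, mul_mul_mul_comm]
      exact mul_le_mul (hzR a) (hyR b) (mul_nonneg ht.pos.le (abs_nonneg _)) (by positivity)
    have h3 : t.1 ^ 2 * |(z i * y j - z j * y i : ℝ)| ≤ 2 * (Q * R) ^ 2 := by
      have := abs_sub (z i * y j : ℝ) (z j * y i)
      nlinarith [hB i j, hB j i, mul_le_mul_of_nonneg_left this (sq_nonneg t.1)]
    have h4 := ht.one_le_pow_mul hd h1
    have h5 : t.1 ^ 3 * |(z i * y j - z j * y i : ℝ)| < t.1 ^ 3 * p := by
      refine lt_of_lt_of_le ?_ h4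
      calc _ = t.1 * (t.1 ^ 2 * |(z i * y j - z j * y i : ℝ)|) := by ring
        _ ≤ t.1 * (2 * (Q * R) ^ 2) := mul_le_mul_of_nonneg_left h3 ht.pos.le
        _ < 1 := h2
    have h6 := lt_of_mul_lt_mul_left h5 (pow_nonneg ht.pos.le 3)
    exact_mod_cast h6
  rw [e3, Int.cast_zero] at e1
  exact sub_eq_zero.1 ((mul_eq_zero.1 e1.symm).resolve_left (pow_ne_zero 2 hQ'))

theorem tsum_heckeMatrix (hd : 2 ≤ d) (hp : ∀ i, p ≠ S.p i) (ht : S.IsHeckeScalar d p t)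
    {R : ℝ} (hR : 0 ≤ R) {Q : ℕ} (hQ0 : Q ≠ 0) (hQ : ∀ i, ‖(Q : S.Qp i)‖ * R ≤ 1) (h1 : t.1 ≤ 1)
    (h2 : t.1 * (Q * R) < 1) {a : S.QS d → ℝ≥0∞} (ha : ∀ x, a x ≠ 0 → ‖x‖ ≤ R)
    (c : {c : Fin d → ZMod p // c ≠ 0}) :
    ∑' v : S.primZs d, a (scale t (dg ((heckeMatrix hp c).mulVec v.1))) =
      ∑' v : S.primZs d, if c.1 ⬝ᵥ (fun j => red hp (v.1 j)) = 0
        then a (scale t (dg v.1)) else 0 := by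
  set P := {w | ∃ v ∈ S.primZs d, w = (heckeMatrix hp c).mulVec v} with hP
  set g : (Fin d → S.Zs) → ℝ≥0∞ := P.indicator fun w => a (scale t (dg w)) with hg
  have hinj : Function.Injective fun v : S.primZs d => (heckeMatrix hp c).mulVec v.1 :=
    (heckeMatrix_mulVec_injective hp c).comp Subtype.val_injective
  rw [tsum_subtype (S.primZs d) fun v => if c.1 ⬝ᵥ (fun j => red hp (v j)) = 0
        then a (scale t (dg v)) else 0]
  have hL : ∑' v : S.primZs d, g ((heckeMatrix hp c).mulVec v.1) = ∑' w, g w := by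
    refine hinj.tsum_eq fun w hw => ?_
    obtain ⟨v, hv, rfl⟩ := (Set.indicator_apply_ne_zero.1 hw).1
    exact ⟨⟨v, hv⟩, rfl⟩
  refine (tsum_congr fun v => ?_).trans (hL.trans (tsum_congr fun w => ?_))
  · rw [hg, Set.indicator_of_mem (show _ ∈ P from ⟨v.1, v.2, rfl⟩)]
  · by_cases hw : a (scale t (dg w)) = 0
    · simp [hg, Set.indicator_apply, hw]
    · have key : w ∈ P ↔ w ∈ S.primZs d ∧ c.1 ⬝ᵥ (fun j => red hp (w j)) = 0 := by
        constructor
        · rintro ⟨v, hv, rfl⟩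
          refine ⟨(prim_or_eq_smul_of_heckeMatrix_mulVec hd hp c hv).resolve_right ?_,
            (exists_eq_heckeMatrix_mulVec_iff hp c _).1 ⟨v, rfl⟩⟩
          rintro ⟨w, hw0, h⟩
          rw [h] at hw
          exact norm_scale_dg_smul_gt hd hp ht hR hQ0 hQ h1 h2 hw0 (ha _ hw)
        · rintro ⟨hw, hc⟩
          exact exists_prim_eq_heckeMatrix_mulVec hd hp c hw hc
      by_cases h3 : w ∈ P
      · rw [hg, Set.indicator_of_mem h3, Set.indicator_of_mem (key.1 h3).1, if_pos (key.1 h3).2]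
      · rw [hg, Set.indicator_of_notMem h3]
        by_cases h4 : w ∈ S.primZs d
        · rw [Set.indicator_of_mem h4, if_neg fun h5 => h3 (key.2 ⟨h4, h5⟩)]
        · rw [Set.indicator_of_notMem h4]

theorem card_dotProduct_red (hd : 3 ≤ d) (hp : ∀ i, p ≠ S.p i) (ht : S.IsHeckeScalar d p t)
    {R : ℝ} (hR : 0 ≤ R) {Q : ℕ} (hQ0 : Q ≠ 0) (hQ : ∀ i, ‖(Q : S.Qp i)‖ * R ≤ 1) (h1 : t.1 ≤ 1)
    (h2 : t.1 * (2 * (Q * R) ^ 2) < 1) {v w : Fin d → S.Zs} (hvP : v ∈ S.primZs d)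
    (hwP : w ∈ S.primZs d) (hv : ‖scale t (dg v)‖ ≤ R) (hw : ‖scale t (dg w)‖ ≤ R) :
    (Finset.univ.filter fun c : {c : Fin d → ZMod p // c ≠ 0} =>
      c.1 ⬝ᵥ (fun j => red hp (v j)) = 0 ∧ c.1 ⬝ᵥ (fun j => red hp (w j)) = 0).card =
      (p ^ (d - 2) - 1) +
        if ∃ k : (S.Zs)ˣ, w = (k : S.Zs) • v then p ^ (d - 1) - p ^ (d - 2) else 0 := by
  have hpp : 1 ≤ p ^ (d - 2) := Nat.one_le_pow _ _ (Fact.out : p.Prime).pos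
  have hpp' : p ^ (d - 2) ≤ p ^ (d - 1) :=
    Nat.pow_le_pow_right (Fact.out : p.Prime).pos (by omega)
  split_ifs with hk
  · obtain ⟨k, rfl⟩ := hk
    have hv0 : (fun j => red hp (v j)) ≠ 0 := red_ne_zero_of_mem_primZs (by omega) hp hvP
    have h3 := card_dotProduct_eq_zero (by omega) hv0
    have h4 : ∀ c : {c : Fin d → ZMod p // c ≠ 0}, (c.1 ⬝ᵥ (fun j => red hp (v j)) = 0 ∧
        c.1 ⬝ᵥ (fun j => red hp (((k : S.Zs) • v) j)) = 0) ↔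
        c.1 ⬝ᵥ (fun j => red hp (v j)) = 0 := fun c => by
      refine and_iff_left_of_imp fun h => ?_
      have : (fun j => red hp (((k : S.Zs) • v) j)) = red hp k • fun j => red hp (v j) :=
        funext fun j => map_mul _ _ _
      rw [this, dotProduct_smul, h, smul_zero]
    simp_rw [h4]
    omega
  · obtain ⟨i, j, hij⟩ : ∃ i j, v i * w j ≠ v j * w i := by
      by_contra! h
      exact hk (exists_unit_of_minors_eq_zero (by omega) hvP hwP h)
    have h3 := card_dotProduct_eq_zero_and (by omega) (a := fun j => red hp (v j))
      (b := fun j => red hp (w j)) (i := i) (j := j)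
      fun h => hij (minor_eq_zero_of_red hd hp ht hR hQ0 hQ h1 h2 hv hw h)
    omega

end HeckeSum

end PrimeTup

namespace PrimeTup

section PairMeasure

open scoped ENNReal Topology
open Filter

variable {S : PrimeTup} {d : ℕ}

/-- The action of `SL_d(ℤ_S)` on the primitive vectors. -/
noncomputable def primEquiv (γ : SpecialLinearGroup (Fin d) S.Zs) : S.primZs d ≃ S.primZs d where
  toFun v := ⟨(γ : Matrix (Fin d) (Fin d) S.Zs).mulVec v.1, mulVec_mem_primZs γ v.2⟩
  invFun v := ⟨((γ⁻¹ : SpecialLinearGroup (Fin d) S.Zs) : Matrix (Fin d) (Fin d) S.Zs).mulVec v.1,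
    mulVec_mem_primZs _ v.2⟩
  left_inv v := Subtype.ext (SpecialLinearGroup.inv_mulVec_mulVec γ v.1)
  right_inv v := Subtype.ext (SpecialLinearGroup.mulVec_inv_mulVec γ v.1)

/-- The pair of vectors `(g v, g w)`. -/
noncomputable def pairMap (q : S.primZs d × S.primZs d) (g : S.G d) : S.QS d × S.QS d :=
  (S.act g (dg q.1.1), S.act g (dg q.2.1))

theorem pairMap_equivariant (g : S.G d) (γ : S.G d) (hγ : γ ∈ S.Gamma d) :
    ∃ e : S.primZs d × S.primZs d ≃ S.primZs d × S.primZs d,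
      ∀ q, pairMap q (g * γ) = pairMap (e q) g := by
  obtain ⟨δ, rfl⟩ := hγ
  refine ⟨(primEquiv δ).prodCongr (primEquiv δ), fun q => ?_⟩
  refine Prod.ext ?_ ?_
  · exact (act_mul g _ _).trans (congrArg (S.act g) (act_toG_dg δ q.1.1))
  · exact (act_mul g _ _).trans (congrArg (S.act g) (act_toG_dg δ q.2.1))

theorem continuous_act_left (x : S.QS d) : Continuous fun g : S.G d => S.act g x :=
  Continuous.prodMk (Continuous.matrix_mulVec (continuous_subtype_val.comp continuous_fst)
    continuous_const) (continuous_pi fun i => Continuous.matrix_mulVec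
      (continuous_subtype_val.comp ((continuous_apply i).comp continuous_snd)) continuous_const)

theorem measurable_pairMap (q : S.primZs d × S.primZs d) : Measurable (pairMap q) :=
  (continuous_act_left _).measurable.prodMk (continuous_act_left _).measurable

/-- The counting measure of the pairs of primitive vectors of the lattice `g ℤ_S^d`. -/
noncomputable def pairMeasure (S : PrimeTup) (d : ℕ) :
    S.G d ⧸ S.Gamma d → Measure (S.QS d × S.QS d) :=
  cosetSum (S.Gamma d) pairMap

theorem measurable_pairMeasure : Measurable (pairMeasure S d) :=
  measurable_cosetSum _ measurable_pairMap pairMap_equivariant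

theorem lintegral_pairMeasure_mk {f : S.QS d × S.QS d → ℝ≥0∞} (hf : Measurable f) (g : S.G d) :
    ∫⁻ y, f y ∂pairMeasure S d (QuotientGroup.mk g) = ∑' q, f (pairMap q g) :=
  lintegral_cosetSum_mk _ pairMap_equivariant g hf

theorem lintegral_pairMeasure_mk_mul {a b : S.QS d → ℝ≥0∞} (ha : Measurable a)
    (hb : Measurable b) (g : S.G d) :
    ∫⁻ y, a y.1 * b y.2 ∂pairMeasure S d (QuotientGroup.mk g) =
      (∑' v : S.primZs d, a (S.act g (dg v.1))) * ∑' v : S.primZs d, b (S.act g (dg v.1)) := by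
  rw [lintegral_pairMeasure_mk (f := fun y => a y.1 * b y.2)
      ((ha.comp measurable_fst).mul (hb.comp measurable_snd)),
    ← ENNReal.tsum_mul_right]
  simp_rw [← ENNReal.tsum_mul_left]
  exact ENNReal.tsum_prod (f := fun v w : S.primZs d => a (S.act g (dg v.1)) * b (S.act g (dg w.1)))

end PairMeasure

section HeckeSum

open scoped ENNReal Topology Classical
open Filter

variable {S : PrimeTup} {d : ℕ} {p : ℕ} [Fact p.Prime] {t : ℝ × ((i : Fin S.s) → S.Qp i)}

theorem tsum_unit_smul (hd : 2 ≤ d) {v : Fin d → S.Zs} (hv : v ∈ S.primZs d)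
    (b : (Fin d → S.Zs) → ℝ≥0∞) :
    (∑' w : S.primZs d, if ∃ k : (S.Zs)ˣ, w.1 = (k : S.Zs) • v then b w.1 else 0) =
      ∑' k : (S.Zs)ˣ, b ((k : S.Zs) • v) := by
  have hinj : Function.Injective fun k : (S.Zs)ˣ =>
      (⟨(k : S.Zs) • v, unit_smul_mem_primZs hd k hv⟩ : S.primZs d) := by
    intro k l h
    obtain ⟨i, hi⟩ := Function.ne_iff.1 (ne_zero_of_mem_primZs (by omega) hv)
    exact Units.ext (mul_right_cancel₀ hi (congrFun (congrArg Subtype.val h) i))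
  rw [← hinj.tsum_eq (f := fun w : S.primZs d =>
    if ∃ k : (S.Zs)ˣ, w.1 = (k : S.Zs) • v then b w.1 else 0)]
  · exact tsum_congr fun k => if_pos ⟨k, rfl⟩
  · intro w hw
    obtain ⟨k, hk⟩ : ∃ k : (S.Zs)ˣ, w.1 = (k : S.Zs) • v := by
      by_contra h
      exact hw (if_neg h)
    exact ⟨k, Subtype.ext hk.symm⟩

theorem sum_hecke_mul (hd : 3 ≤ d) (hp : ∀ i, p ≠ S.p i) (ht : S.IsHeckeScalar d p t)
    {R : ℝ} (hR : 0 ≤ R) {Q : ℕ} (hQ0 : Q ≠ 0) (hQ : ∀ i, ‖(Q : S.Qp i)‖ * R ≤ 1) (h1 : t.1 ≤ 1)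
    (h2 : t.1 * (Q * R) < 1) (h3 : t.1 * (2 * (Q * R) ^ 2) < 1) {a b : S.QS d → ℝ≥0∞}
    (ha : ∀ x, a x ≠ 0 → ‖x‖ ≤ R) (hb : ∀ x, b x ≠ 0 → ‖x‖ ≤ R) :
    ∑ c, (∑' v : S.primZs d, a (scale t (dg ((heckeMatrix hp c).mulVec v.1)))) *
      (∑' v : S.primZs d, b (scale t (dg ((heckeMatrix hp c).mulVec v.1)))) =
    ((p ^ (d - 2) - 1 : ℕ) : ℝ≥0∞) * ((∑' v : S.primZs d, a (scale t (dg v.1))) *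
        ∑' v : S.primZs d, b (scale t (dg v.1))) +
      ((p ^ (d - 1) - p ^ (d - 2) : ℕ) : ℝ≥0∞) * ∑' k : (S.Zs)ˣ, ∑' v : S.primZs d,
        a (scale t (dg v.1)) * b (scale t (dg ((k : S.Zs) • v.1))) := by
  simp_rw [tsum_heckeMatrix (by omega) hp ht hR hQ0 hQ h1 h2 ha,
    tsum_heckeMatrix (by omega) hp ht hR hQ0 hQ h1 h2 hb]
  have e1 (c : {c : Fin d → ZMod p // c ≠ 0}) :
      (∑' v : S.primZs d, if c.1 ⬝ᵥ (fun j => red hp (v.1 j)) = 0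
        then a (scale t (dg v.1)) else 0) *
      (∑' v : S.primZs d, if c.1 ⬝ᵥ (fun j => red hp (v.1 j)) = 0
        then b (scale t (dg v.1)) else 0) =
      ∑' (v : S.primZs d) (w : S.primZs d), a (scale t (dg v.1)) * b (scale t (dg w.1)) *
        if c.1 ⬝ᵥ (fun j => red hp (v.1 j)) = 0 ∧ c.1 ⬝ᵥ (fun j => red hp (w.1 j)) = 0
          then 1 else 0 := by
    rw [← ENNReal.tsum_mul_right]
    refine tsum_congr fun v => ?_
    rw [← ENNReal.tsum_mul_left]
    refine tsum_congr fun w => ?_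
    by_cases h4 : c.1 ⬝ᵥ (fun j => red hp (v.1 j)) = 0 <;>
      by_cases h5 : c.1 ⬝ᵥ (fun j => red hp (w.1 j)) = 0 <;> simp [h4, h5]
  simp_rw [e1]
  have e2 (v w : S.primZs d) : ∑ c : {c : Fin d → ZMod p // c ≠ 0},
      a (scale t (dg v.1)) * b (scale t (dg w.1)) *
        (if c.1 ⬝ᵥ (fun j => red hp (v.1 j)) = 0 ∧ c.1 ⬝ᵥ (fun j => red hp (w.1 j)) = 0
          then 1 else 0) =
      ((p ^ (d - 2) - 1 : ℕ) : ℝ≥0∞) * (a (scale t (dg v.1)) * b (scale t (dg w.1))) +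
      ((p ^ (d - 1) - p ^ (d - 2) : ℕ) : ℝ≥0∞) * (a (scale t (dg v.1)) *
        if ∃ k : (S.Zs)ˣ, w.1 = (k : S.Zs) • v.1 then b (scale t (dg w.1)) else 0) := by
    rw [← Finset.mul_sum, Finset.sum_boole]
    by_cases hv : a (scale t (dg v.1)) = 0
    · simp [hv]
    by_cases hw : b (scale t (dg w.1)) = 0
    · simp [hw]
    rw [card_dotProduct_red hd hp ht hR hQ0 hQ h1 h3 v.2 w.2 (ha _ hv) (hb _ hw)]
    split_ifs <;> push_cast <;> ring
  rw [← Summable.tsum_finsetSum fun c _ => ENNReal.summable]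
  simp_rw [← Summable.tsum_finsetSum fun c _ => ENNReal.summable, e2, ENNReal.tsum_add,
    ENNReal.tsum_mul_left, ENNReal.tsum_mul_right]
  congr 2
  rw [ENNReal.tsum_comm]
  refine tsum_congr fun v => ?_
  rw [tsum_unit_smul (by omega) v.2 fun w => b (scale t (dg w)), ENNReal.tsum_mul_left]

end HeckeSum

end PrimeTup

namespace PrimeTup

section HeckeLimit

open scoped ENNReal Topology
open Filter

variable {S : PrimeTup} {d : ℕ}

theorem ofReal_primSum (hd : 0 < d) {f : S.QS d → ℝ} (hc : HasCompactSupport f)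
    (hf : ∀ x, 0 ≤ f x) {t : ℝ × ((i : Fin S.s) → S.Qp i)} (h0 : 0 < t.1)
    (h1 : ∀ i, ‖t.2 i‖ = 1) :
    ENNReal.ofReal (primSum f t) = ∑' v : S.primZs d, ENNReal.ofReal (f (scale t (dg v.1))) := by
  obtain ⟨R, hR, hfR⟩ := exists_norm_bound hc
  obtain ⟨C, -, hfin⟩ := exists_ncard_norm_le S d hR
  refine ENNReal.ofReal_tsum_of_nonneg (fun v => hf _) (summable_of_hasFiniteSupport ?_)
  refine ((hfin 1 t h0 h1).1.preimage Subtype.val_injective.injOn).subset fun v hv => ?_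
  refine ⟨ne_zero_of_mem_primZs hd v.2, hfR _ hv, ?_⟩
  rw [Units.val_one, one_smul]
  exact hfR _ hv

theorem primSum_nonneg {f : S.QS d → ℝ} (hf : ∀ x, 0 ≤ f x)
    (t : ℝ × ((i : Fin S.s) → S.Qp i)) : 0 ≤ primSum f t :=
  tsum_nonneg fun _ => hf _

theorem twist_nonneg {f₁ f₂ : S.QS d → ℝ} (h₁ : ∀ x, 0 ≤ f₁ x) (h₂ : ∀ x, 0 ≤ f₂ x)
    (k : (S.Zs)ˣ) (x : S.QS d) : 0 ≤ twist f₁ f₂ k x :=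
  mul_nonneg (h₁ _) (h₂ _)

theorem heckeAverage_eq {p e : ℕ} (hp : 1 < p) {u : ℝ} (hu : u * p = 1) (A B D : ℝ) (he : 0 < e) :
    (((p ^ e - 1 : ℕ) : ℝ) * (A * B) + ((p ^ (e + 1) - p ^ e : ℕ) : ℝ) * D) /
      ((p ^ (e + 2) - 1 : ℕ) : ℝ) = (1 - u ^ e) / (1 - u ^ (e + 2)) * ((u * A) * (u * B)) +
      (1 - u) / (1 - u ^ (e + 2)) * (u * D) := by
  have hp0 : (p : ℝ) ≠ 0 := Nat.cast_ne_zero.2 (by omega)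
  have h1 : (p : ℝ) ^ (e + 2) - 1 ≠ 0 :=
    sub_ne_zero.2 (one_lt_pow₀ (Nat.one_lt_cast.2 hp) (by omega)).ne'
  obtain rfl : u = (p : ℝ)⁻¹ := eq_inv_of_mul_eq_one_left hu
  rw [Nat.cast_sub (Nat.one_le_pow _ _ (by omega)), Nat.cast_sub (Nat.pow_le_pow_right (by omega)
    (by omega)), Nat.cast_sub (Nat.one_le_pow _ _ (by omega))]
  have h2 : 1 - ((p : ℝ)⁻¹) ^ (e + 2) = (p ^ (e + 2) - 1) / (p : ℝ) ^ (e + 2) := by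
    rw [inv_pow]
    field_simp
  rw [h2, inv_pow]
  push_cast
  field_simp
  ring

theorem heckeSum_eq_ofReal (hd : 3 ≤ d) {p : ℕ} [Fact p.Prime]
    {t : ℝ × ((i : Fin S.s) → S.Qp i)} (hp : ∀ i, p ≠ S.p i) (ht : S.IsHeckeScalar d p t)
    {R : ℝ} (hR : 0 ≤ R) {Q : ℕ} (hQ0 : Q ≠ 0) (hQ : ∀ i, ‖(Q : S.Qp i)‖ * R ≤ 1) (h1 : t.1 ≤ 1)
    (h2 : t.1 * (Q * R) < 1) (h3 : t.1 * (2 * (Q * R) ^ 2) < 1) {f₁ f₂ : S.QS d → ℝ}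
    (hf₁ : Continuous f₁) (hf₂ : Continuous f₂)
    (hc₁ : HasCompactSupport f₁) (hc₂ : HasCompactSupport f₂) (h₁ : ∀ x, 0 ≤ f₁ x)
    (h₂ : ∀ x, 0 ≤ f₂ x) (hR₁ : ∀ x, f₁ x ≠ 0 → ‖x‖ ≤ R) (hR₂ : ∀ x, f₂ x ≠ 0 → ‖x‖ ≤ R) :
    (Fintype.card {c : Fin d → ZMod p // c ≠ 0} : ℝ≥0∞)⁻¹ *
      ∑ c, (∑' v : S.primZs d,
          ENNReal.ofReal (f₁ (scale t (dg ((heckeMatrix hp c).mulVec v.1))))) *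
        (∑' v : S.primZs d, ENNReal.ofReal (f₂ (scale t (dg ((heckeMatrix hp c).mulVec v.1))))) =
    ENNReal.ofReal ((1 - (t.1 ^ d) ^ (d - 2)) / (1 - (t.1 ^ d) ^ d) *
        ((t.1 ^ d * primSum f₁ t) * (t.1 ^ d * primSum f₂ t)) +
      (1 - t.1 ^ d) / (1 - (t.1 ^ d) ^ d) *
        (t.1 ^ d * ∑' k : (S.Zs)ˣ, primSum (twist f₁ f₂ k) t)) := by
  have hne {f : S.QS d → ℝ} (hfR : ∀ x, f x ≠ 0 → ‖x‖ ≤ R) (x : S.QS d)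
      (hx : ENNReal.ofReal (f x) ≠ 0) : ‖x‖ ≤ R :=
    hfR x fun h => hx (by rw [h, ENNReal.ofReal_zero])
  have hp1 : 1 < p := (Fact.out : p.Prime).one_lt
  rw [sum_hecke_mul hd hp ht hR hQ0 hQ h1 h2 h3 (a := fun x => ENNReal.ofReal (f₁ x))
    (b := fun x => ENNReal.ofReal (f₂ x)) (hne hR₁) (hne hR₂),
    ← ofReal_primSum (by omega) hc₁ h₁ ht.pos ht.norm_eq,
    ← ofReal_primSum (by omega) hc₂ h₂ ht.pos ht.norm_eq]
  have hk (k : (S.Zs)ˣ) : ∑' v : S.primZs d, ENNReal.ofReal (f₁ (scale t (dg v.1))) *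
      ENNReal.ofReal (f₂ (scale t (dg ((k : S.Zs) • v.1)))) =
      ENNReal.ofReal (primSum (twist f₁ f₂ k) t) := by
    rw [ofReal_primSum (by omega) (hasCompactSupport_twist hc₁ f₂ k) (twist_nonneg h₁ h₂ k)
      ht.pos ht.norm_eq]
    refine tsum_congr fun v => ?_
    rw [twist, ratSMul_scale_dg, ENNReal.ofReal_mul (h₁ _)]
  simp_rw [hk]
  have hA := primSum_nonneg h₁ t
  have hB := primSum_nonneg h₂ t
  have hD : 0 ≤ ∑' k : (S.Zs)ˣ, primSum (twist f₁ f₂ k) t :=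
    tsum_nonneg fun k => primSum_nonneg (twist_nonneg h₁ h₂ k) t
  rw [← ENNReal.ofReal_tsum_of_nonneg (fun k => primSum_nonneg (twist_nonneg h₁ h₂ k) t)
    (summable_primSum_twist hd hf₁ hf₂ hc₁ hc₂ ht.pos ht.norm_eq), ← ENNReal.ofReal_mul hA,
    ← ENNReal.ofReal_natCast, ← ENNReal.ofReal_natCast, ← ENNReal.ofReal_natCast,
    ← ENNReal.ofReal_mul (Nat.cast_nonneg _), ← ENNReal.ofReal_mul (Nat.cast_nonneg _),
    ← ENNReal.ofReal_add (by positivity) (by positivity)]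
  have hcard : Fintype.card {c : Fin d → ZMod p // c ≠ 0} = p ^ d - 1 :=
    Nat.eq_sub_of_add_eq (card_subtype_ne_zero d)
  have hpos : 0 < p ^ d - 1 := by
    have := Nat.one_lt_pow (show d ≠ 0 by omega) hp1
    omega
  rw [hcard, ← ENNReal.ofReal_inv_of_pos (Nat.cast_pos.2 hpos),
    ← ENNReal.ofReal_mul (by positivity), ← div_eq_inv_mul]
  obtain ⟨e, rfl⟩ : ∃ e, d = e + 2 := ⟨d - 2, by omega⟩
  exact congrArg _ (heckeAverage_eq hp1 ht.pow_mul _ _ _ (by omega))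

theorem tendsto_heckeAverage (hd : 3 ≤ d) {f₁ f₂ : S.QS d → ℝ} (hf₁ : Continuous f₁)
    (hf₂ : Continuous f₂) (hc₁ : HasCompactSupport f₁) (hc₂ : HasCompactSupport f₂)
    (h₁ : ∀ x, 0 ≤ f₁ x) (h₂ : ∀ x, 0 ≤ f₂ x) {p : ℕ → ℕ} [∀ n, Fact (p n).Prime]
    (hp : ∀ n i, p n ≠ S.p i) {t : ℕ → ℝ × ((i : Fin S.s) → S.Qp i)}
    (ht : ∀ n, S.IsHeckeScalar d (p n) (t n)) (hpn : ∀ n, n < p n) :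
    (Summable fun k : (S.Zs)ˣ => ∫ x, twist f₁ f₂ k x ∂(stdVol S d)) ∧
    Tendsto (fun n => (Fintype.card {c : Fin d → ZMod (p n) // c ≠ 0} : ℝ≥0∞)⁻¹ *
      ∑ c, (∑' v : S.primZs d,
          ENNReal.ofReal (f₁ (scale (t n) (dg ((heckeMatrix (hp n) c).mulVec v.1))))) *
        (∑' v : S.primZs d,
          ENNReal.ofReal (f₂ (scale (t n) (dg ((heckeMatrix (hp n) c).mulVec v.1))))))
      atTop (𝓝 (ENNReal.ofReal (1 / S.zetaS d ^ 2 *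
        ((∫ x, f₁ x ∂(stdVol S d)) * ∫ x, f₂ x ∂(stdVol S d)) +
        1 / S.zetaS d * ∑' k : (S.Zs)ˣ, ∫ x, twist f₁ f₂ k x ∂(stdVol S d)))) := by
  have hu : Tendsto (fun n => (t n).1 ^ d) atTop (𝓝 0) := by
    have he : ∀ n, (t n).1 ^ d = (p n : ℝ)⁻¹ := fun n => eq_inv_of_mul_eq_one_left (ht n).pow_mul
    simp_rw [he]
    exact tendsto_inv_atTop_zero.comp (tendsto_natCast_atTop_atTop.comp
      (tendsto_atTop_mono (fun n => (hpn n).le) tendsto_id))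
  have hlim : Tendsto (fun n => (t n).1) atTop (𝓝 0) := by
    have h := hu.rpow_const (p := (d : ℝ)⁻¹) (Or.inr (by positivity))
    rw [Real.zero_rpow (by positivity)] at h
    exact h.congr fun n => Real.pow_rpow_inv_natCast (ht n).pos.le (by omega)
  obtain ⟨hs, hD⟩ := tendsto_tsum_primSum_twist hd hf₁ hf₂ hc₁ hc₂ t (fun n => (ht n).pos)
    (fun n => (ht n).norm_eq) hlim
  refine ⟨hs, ?_⟩
  have hA := tendsto_primSum (by omega) hf₁ hc₁ t (fun n => (ht n).pos) (fun n => (ht n).norm_eq)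
    hlim
  have hB := tendsto_primSum (by omega) hf₂ hc₂ t (fun n => (ht n).pos) (fun n => (ht n).norm_eq)
    hlim
  obtain ⟨R₁, hR₁, hfR₁⟩ := exists_norm_bound hc₁
  obtain ⟨R₂, hR₂, hfR₂⟩ := exists_norm_bound hc₂
  have hR : 0 < max R₁ R₂ + 1 := by positivity
  obtain ⟨Q, hQ0, -, hQ⟩ := exists_smooth_norm_lt S (one_div_pos.2 hR)
  have hlim' (C : ℝ) : ∀ᶠ n in atTop, (t n).1 * C < 1 := by
    have h := hlim.mul_const C
    rw [zero_mul] at h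
    exact h.eventually_lt_const one_pos
  have hq (e : ℕ) (he : e ≠ 0) : Tendsto (fun n => 1 - ((t n).1 ^ d) ^ e) atTop (𝓝 1) := by
    simpa [he] using (hu.pow e).const_sub 1
  have hL := (((hq (d - 2) (by omega)).div (hq d (by omega)) one_ne_zero).mul (hA.mul hB)).add
    (((hq 1 one_ne_zero).div (hq d (by omega)) one_ne_zero).mul hD)
  have he : (1 : ℝ) / 1 * (1 / S.zetaS d * (∫ x, f₁ x ∂(stdVol S d)) *
        (1 / S.zetaS d * ∫ x, f₂ x ∂(stdVol S d))) +
      1 / 1 * (1 / S.zetaS d * ∑' k : (S.Zs)ˣ, ∫ x, twist f₁ f₂ k x ∂(stdVol S d)) =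
      1 / S.zetaS d ^ 2 * ((∫ x, f₁ x ∂(stdVol S d)) * ∫ x, f₂ x ∂(stdVol S d)) +
        1 / S.zetaS d * ∑' k : (S.Zs)ˣ, ∫ x, twist f₁ f₂ k x ∂(stdVol S d) := by
    ring
  rw [he] at hL
  refine (ENNReal.tendsto_ofReal hL).congr' ?_
  filter_upwards [hlim' 1, hlim' (Q * (max R₁ R₂ + 1)), hlim' (2 * (Q * (max R₁ R₂ + 1)) ^ 2)]
    with n hn1 hn2 hn3
  rw [mul_one] at hn1
  rw [heckeSum_eq_ofReal hd (hp n) (ht n) hR.le hQ0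
    (fun i => ((lt_div_iff₀ hR).1 (hQ i)).le) hn1.le hn2 hn3 hf₁ hf₂ hc₁ hc₂ h₁ h₂
    (fun x hx => (hfR₁ x hx).trans ((le_max_left _ _).trans (by linarith)))
    (fun x hx => (hfR₂ x hx).trans ((le_max_right _ _).trans (by linarith)))]
  simp only [Pi.div_apply, pow_one]

end HeckeLimit

end PrimeTup

namespace PrimeTup

section ProductFormula

open scoped ENNReal Topology
open Filter

variable {S : PrimeTup} {d : ℕ}

theorem act_ratSMul (g : S.G d) (q : ℚ) (x : S.QS d) :
    S.act g (S.ratSMul q x) = S.ratSMul q (S.act g x) :=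
  act_scale (t := ((q : ℝ), fun i => (q : S.Qp i))) g x

theorem hasCompactSupport_comp_act {f : S.QS d → ℝ} (hc : HasCompactSupport f) (g : S.G d) :
    HasCompactSupport fun x => f (S.act g x) :=
  hc.comp_homeomorph (actEquiv g).toHomeomorph

instance : (stdVol S d).Regular :=
  Measure.Regular.of_sigmaCompactSpace_of_isLocallyFiniteMeasure _

theorem integral_comp_act (hd : 3 ≤ d) (f : S.QS d → ℝ) (g : S.G d) :
    ∫ x, f (S.act g x) ∂(stdVol S d) = ∫ x, f x ∂(stdVol S d) :=
  (measurePreserving_act hd (stdVol S d) g).integral_comp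
    (actEquiv g).toHomeomorph.measurableEmbedding f

theorem tendsto_lintegral_heckeKernel (hd : 3 ≤ d) {f₁ f₂ : S.QS d → ℝ} (hf₁ : Continuous f₁)
    (hf₂ : Continuous f₂) (hc₁ : HasCompactSupport f₁) (hc₂ : HasCompactSupport f₂)
    (h₁ : ∀ x, 0 ≤ f₁ x) (h₂ : ∀ x, 0 ≤ f₂ x) {p : ℕ → ℕ} [∀ n, Fact (p n).Prime]
    (hp : ∀ n i, p n ≠ S.p i) {t : ℕ → ℝ × ((i : Fin S.s) → S.Qp i)}
    (ht : ∀ n, S.IsHeckeScalar d (p n) (t n)) (hpn : ∀ n, n < p n) (x : S.G d ⧸ S.Gamma d) :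
    Tendsto (fun n => ∫⁻ y, ∫⁻ z, ENNReal.ofReal (f₁ z.1) * ENNReal.ofReal (f₂ z.2)
        ∂pairMeasure S d y ∂heckeKernel (hp n) (ht n) x)
      atTop (𝓝 (ENNReal.ofReal (1 / S.zetaS d ^ 2 *
        ((∫ x, f₁ x ∂(stdVol S d)) * ∫ x, f₂ x ∂(stdVol S d)) +
        1 / S.zetaS d * ∑' k : (S.Zs)ˣ, ∫ x, twist f₁ f₂ k x ∂(stdVol S d)))) := by
  obtain ⟨g, rfl⟩ := QuotientGroup.mk_surjective x
  have hm : Measurable fun y : S.G d ⧸ S.Gamma d =>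
      ∫⁻ z, ENNReal.ofReal (f₁ z.1) * ENNReal.ofReal (f₂ z.2) ∂pairMeasure S d y :=
    (Measure.measurable_lintegral ((hf₁.measurable.comp measurable_fst).ennreal_ofReal.mul
      (hf₂.measurable.comp measurable_snd).ennreal_ofReal)).comp measurable_pairMeasure
  have h := (tendsto_heckeAverage hd (hf₁.comp (continuous_act g)) (hf₂.comp (continuous_act g))
    (hasCompactSupport_comp_act hc₁ g) (hasCompactSupport_comp_act hc₂ g) (fun x => h₁ _)
    (fun x => h₂ _) hp ht hpn).2
  have e (k : (S.Zs)ˣ) (x : S.QS d) :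
      twist (f₁ ∘ S.act g) (f₂ ∘ S.act g) k x = twist f₁ f₂ k (S.act g x) := by
    simp only [twist, Function.comp_apply, act_ratSMul]
  simp_rw [e, Function.comp_apply, integral_comp_act hd f₁ g, integral_comp_act hd f₂ g,
    integral_comp_act hd (twist f₁ f₂ _) g] at h
  refine h.congr fun n => ?_
  rw [lintegral_heckeKernel (hp n) (ht n) hm]
  refine congrArg _ ?_
  refine Finset.sum_congr rfl fun c _ => ?_
  rw [lintegral_pairMeasure_mk_mul hf₁.measurable.ennreal_ofReal hf₂.measurable.ennreal_ofReal]
  simp_rw [act_mul, act_heckeElt_dg]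

theorem lintegral_pairMeasure (hd : 3 ≤ d) (μ : Measure (S.G d ⧸ S.Gamma d))
    [IsProbabilityMeasure μ] [SMulInvariantMeasure (S.G d) (S.G d ⧸ S.Gamma d) μ]
    {f₁ f₂ : S.QS d → ℝ} (hf₁ : Continuous f₁)
    (hf₂ : Continuous f₂) (hc₁ : HasCompactSupport f₁) (hc₂ : HasCompactSupport f₂)
    (h₁ : ∀ x, 0 ≤ f₁ x) (h₂ : ∀ x, 0 ≤ f₂ x) :
    (Summable fun k : (S.Zs)ˣ => ∫ x, twist f₁ f₂ k x ∂(stdVol S d)) ∧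
    ∫⁻ x, ∫⁻ z, ENNReal.ofReal (f₁ z.1) * ENNReal.ofReal (f₂ z.2) ∂pairMeasure S d x ∂μ =
      ENNReal.ofReal (1 / S.zetaS d ^ 2 *
        ((∫ x, f₁ x ∂(stdVol S d)) * ∫ x, f₂ x ∂(stdVol S d)) +
        1 / S.zetaS d * ∑' k : (S.Zs)ˣ, ∫ x, twist f₁ f₂ k x ∂(stdVol S d)) := by
  choose p hpn hpp hp t ht using fun n => exists_prime_isHeckeScalar S (show 0 < d by omega) n
  have : ∀ n, Fact (p n).Prime := fun n => ⟨hpp n⟩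
  have hP : ∀ n x, IsProbabilityMeasure (heckeKernel (hp n) (ht n) x) :=
    fun n x => isProbabilityMeasure_heckeKernel (by omega) (hp n) (ht n) x
  refine ⟨(tendsto_heckeAverage hd hf₁ hf₂ hc₁ hc₂ h₁ h₂ hp ht hpn).1, ?_⟩
  exact lintegral_eq_of_tendsto_average μ (fun n => heckeKernel (hp n) (ht n))
    (fun n => measurable_heckeKernel (hp n) (ht n))
    (fun n => bind_heckeKernel (by omega) (hp n) (ht n) μ)
    ((Measure.measurable_lintegral ((hf₁.measurable.comp measurable_fst).ennreal_ofReal.mul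
      (hf₂.measurable.comp measurable_snd).ennreal_ofReal)).comp measurable_pairMeasure)
    (tendsto_lintegral_heckeKernel hd hf₁ hf₂ hc₁ hc₂ h₁ h₂ hp ht hpn)

end ProductFormula

end PrimeTup

section ProductTest

open scoped ENNReal NNReal BoundedContinuousFunction

theorem MeasureTheory.ext_of_lintegral_mul_boundedContinuousFunction {X Y : Type*}
    [TopologicalSpace X] [MeasurableSpace X] [BorelSpace X] [HasOuterApproxClosed X]
    [TopologicalSpace Y] [MeasurableSpace Y] [BorelSpace Y] [HasOuterApproxClosed Y]
    {μ ν : Measure (X × Y)} [IsFiniteMeasure μ]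
    (h : ∀ (f : X →ᵇ ℝ≥0) (g : Y →ᵇ ℝ≥0), ∫⁻ p, (f p.1 : ℝ≥0∞) * g p.2 ∂μ =
      ∫⁻ p, (f p.1 : ℝ≥0∞) * g p.2 ∂ν) : μ = ν := by
  let e : (X × Y) ≃ᵐ ((Unit → X) × (Unit → Y)) :=
    .symm <| .prodCongr (.funUnique ..) (.funUnique ..)
  rw [← e.map_measurableEquiv_injective.eq_iff]
  have : IsFiniteMeasure (μ.map e) := Measure.isFiniteMeasure_map μ e
  refine Measure.ext_of_lintegral_prod_mul_prod_boundedContinuousFunction fun f g => ?_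
  rw [lintegral_map_equiv, lintegral_map_equiv]
  simpa [e] using! h (f ()) (g ())

variable {E : Type*} [NormedAddCommGroup E]

/-- A continuous cutoff function on a normed group, at least one on the ball of radius `R`. -/
noncomputable def normCutoff (E : Type*) [NormedAddCommGroup E] (R : ℝ) (x : E) : ℝ≥0 :=
  Real.toNNReal (R + 1 - ‖x‖)

theorem continuous_normCutoff (R : ℝ) : Continuous (normCutoff E R) :=
  continuous_real_toNNReal.comp (continuous_const.sub continuous_norm)

theorem hasCompactSupport_normCutoff [ProperSpace E] (R : ℝ) :
    HasCompactSupport (normCutoff E R) := by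
  refine HasCompactSupport.intro (isCompact_closedBall (0 : E) (R + 1)) fun x hx => ?_
  rw [mem_closedBall_zero_iff, not_le] at hx
  exact Real.toNNReal_of_nonpos (by linarith)

theorem one_le_normCutoff {R : ℝ} {x : E} (hx : ‖x‖ ≤ R) : 1 ≤ normCutoff E R x :=
  Real.one_le_toNNReal.2 (by linarith)

variable [ProperSpace E] [MeasurableSpace E] [BorelSpace E]

theorem restrict_closedBall_prod_eq {μ ν : Measure (E × E)}
    (h : ∀ f g : E → ℝ≥0, Continuous f → Continuous g → HasCompactSupport f →
      HasCompactSupport g → ∫⁻ p, (f p.1 : ℝ≥0∞) * g p.2 ∂μ = ∫⁻ p, (f p.1 : ℝ≥0∞) * g p.2 ∂ν)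
    (hfin : ∀ f g : E → ℝ≥0, Continuous f → Continuous g → HasCompactSupport f →
      HasCompactSupport g → ∫⁻ p, (f p.1 : ℝ≥0∞) * g p.2 ∂μ ≠ ∞) (R : ℝ) :
    μ.restrict (Metric.closedBall 0 R ×ˢ Metric.closedBall 0 R) =
      ν.restrict (Metric.closedBall 0 R ×ˢ Metric.closedBall 0 R) := by
  have hψ := continuous_normCutoff (E := E) R
  have hψc := hasCompactSupport_normCutoff (E := E) R
  have hm {f g : E → ℝ≥0} (hf : Continuous f) (hg : Continuous g) :
      Measurable fun p : E × E => (f p.1 : ℝ≥0∞) * g p.2 :=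
    (hf.measurable.comp measurable_fst).coe_nnreal_ennreal.mul
      (hg.measurable.comp measurable_snd).coe_nnreal_ennreal
  set w : E × E → ℝ≥0∞ := fun p => (normCutoff E R p.1 : ℝ≥0∞) * normCutoff E R p.2 with hw
  have hwm : Measurable w := hm hψ hψ
  have : IsFiniteMeasure (μ.withDensity w) := isFiniteMeasure_withDensity (hfin _ _ hψ hψ hψc hψc)
  have heq : μ.withDensity w = ν.withDensity w := by
    refine ext_of_lintegral_mul_boundedContinuousFunction fun f g => ?_
    rw [lintegral_withDensity_eq_lintegral_mul _ hwm (hm f.continuous g.continuous),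
      lintegral_withDensity_eq_lintegral_mul _ hwm (hm f.continuous g.continuous)]
    have h1 : w * (fun p : E × E => (f p.1 : ℝ≥0∞) * g p.2) = fun p : E × E =>
        (((normCutoff E R * f) p.1 : ℝ≥0) : ℝ≥0∞) * ((normCutoff E R * g) p.2 : ℝ≥0) := by
      ext p
      simp only [hw, Pi.mul_apply, ENNReal.coe_mul]
      ring
    rw [h1]
    exact h _ _ (hψ.mul f.continuous) (hψ.mul g.continuous) hψc.mul_right hψc.mul_right
  have hK : MeasurableSet ((Metric.closedBall (0 : E) R) ×ˢ (Metric.closedBall (0 : E) R)) :=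
    measurableSet_closedBall.prod measurableSet_closedBall
  ext s hs
  rw [Measure.restrict_apply hs, Measure.restrict_apply hs]
  set A := s ∩ Metric.closedBall (0 : E) R ×ˢ Metric.closedBall (0 : E) R with hA
  have hAm : MeasurableSet A := hs.inter hK
  have key (ρ : Measure (E × E)) : ρ A = ∫⁻ p, A.indicator w⁻¹ p
      ∂ρ.withDensity w := by
    rw [lintegral_withDensity_eq_lintegral_mul _ hwm (hwm.inv.indicator hAm),
      ← lintegral_indicator_one hAm]
    refine lintegral_congr fun p => ?_
    rw [Pi.mul_apply]
    by_cases hp : p ∈ A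
    · rw [Set.indicator_of_mem hp, Set.indicator_of_mem hp, Pi.one_apply, Pi.inv_apply,
        ENNReal.mul_inv_cancel]
      · refine mul_ne_zero ?_ ?_
        · exact ENNReal.coe_ne_zero.2 (zero_lt_one.trans_le
            (one_le_normCutoff (mem_closedBall_zero_iff.1 hp.2.1))).ne'
        · exact ENNReal.coe_ne_zero.2 (zero_lt_one.trans_le
            (one_le_normCutoff (mem_closedBall_zero_iff.1 hp.2.2))).ne'
      · exact ENNReal.mul_ne_top ENNReal.coe_ne_top ENNReal.coe_ne_top
    · rw [Set.indicator_of_notMem hp, Set.indicator_of_notMem hp, mul_zero]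
  rw [key μ, key ν, heq]

theorem ext_of_lintegral_mul_compactSupport {μ ν : Measure (E × E)}
    (h : ∀ f g : E → ℝ≥0, Continuous f → Continuous g → HasCompactSupport f →
      HasCompactSupport g → ∫⁻ p, (f p.1 : ℝ≥0∞) * g p.2 ∂μ = ∫⁻ p, (f p.1 : ℝ≥0∞) * g p.2 ∂ν)
    (hfin : ∀ f g : E → ℝ≥0, Continuous f → Continuous g → HasCompactSupport f →
      HasCompactSupport g → ∫⁻ p, (f p.1 : ℝ≥0∞) * g p.2 ∂μ ≠ ∞) : μ = ν := by
  refine Measure.ext_of_iUnion_eq_univ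
    (s := fun n : ℕ => Metric.closedBall 0 (n : ℝ) ×ˢ Metric.closedBall 0 (n : ℝ))
    (Set.eq_univ_of_forall fun p => ?_) fun n => restrict_closedBall_prod_eq h hfin n
  obtain ⟨n, hn⟩ := exists_nat_ge ‖p‖
  refine Set.mem_iUnion.2 ⟨n, ?_, ?_⟩
  · exact mem_closedBall_zero_iff.2 ((norm_fst_le p).trans hn)
  · exact mem_closedBall_zero_iff.2 ((norm_snd_le p).trans hn)

theorem measure_lt_top_of_isCompact {μ : Measure (E × E)}
    (hfin : ∀ f g : E → ℝ≥0, Continuous f → Continuous g → HasCompactSupport f →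
      HasCompactSupport g → ∫⁻ p, (f p.1 : ℝ≥0∞) * g p.2 ∂μ ≠ ∞) {K : Set (E × E)}
    (hK : IsCompact K) : μ K < ∞ := by
  obtain ⟨R, hR⟩ := hK.isBounded.exists_norm_le
  have hψ := continuous_normCutoff (E := E) R
  have hψc := hasCompactSupport_normCutoff (E := E) R
  refine lt_of_le_of_lt ?_ (hfin _ _ hψ hψ hψc hψc).lt_top
  rw [← lintegral_indicator_one hK.measurableSet]
  refine lintegral_mono (Set.indicator_le fun p hp => ?_)
  exact one_le_mul (ENNReal.one_le_coe_iff.2 (one_le_normCutoff ((norm_fst_le p).trans (hR p hp))))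
    (ENNReal.one_le_coe_iff.2 (one_le_normCutoff ((norm_snd_le p).trans (hR p hp))))

end ProductTest

namespace PrimeTup

section MomentMeasure

open scoped ENNReal NNReal

variable {S : PrimeTup} {d : ℕ}

/-- The measure `ζ⁻² vol ⊗ vol + ζ⁻¹ ∑ₖ (x ↦ (x, k x))_* vol`. -/
noncomputable def momentMeasure (S : PrimeTup) (d : ℕ) : Measure (S.QS d × S.QS d) :=
  ENNReal.ofReal (1 / S.zetaS d ^ 2) • (stdVol S d).prod (stdVol S d) +
    ENNReal.ofReal (1 / S.zetaS d) • Measure.sum fun k : (S.Zs)ˣ =>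
      (stdVol S d).map fun x => (x, S.ratSMul ((k : S.Zs) : ℚ) x)

theorem zetaS_nonneg (S : PrimeTup) (d : ℕ) : 0 ≤ S.zetaS d :=
  tsum_nonneg fun _ => by positivity

theorem measurable_prodMk_ratSMul (q : ℚ) : Measurable fun x : S.QS d => (x, S.ratSMul q x) :=
  measurable_id.prodMk (continuous_ratSMul q).measurable

theorem lintegral_momentMeasure {f₁ f₂ : S.QS d → ℝ} (hf₁ : Continuous f₁)
    (hf₂ : Continuous f₂) (hc₁ : HasCompactSupport f₁) (hc₂ : HasCompactSupport f₂)
    (h₁ : ∀ x, 0 ≤ f₁ x) (h₂ : ∀ x, 0 ≤ f₂ x)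
    (hs : Summable fun k : (S.Zs)ˣ => ∫ x, twist f₁ f₂ k x ∂(stdVol S d)) :
    ∫⁻ z, ENNReal.ofReal (f₁ z.1) * ENNReal.ofReal (f₂ z.2) ∂momentMeasure S d =
      ENNReal.ofReal (1 / S.zetaS d ^ 2 *
        ((∫ x, f₁ x ∂(stdVol S d)) * ∫ x, f₂ x ∂(stdVol S d)) +
        1 / S.zetaS d * ∑' k : (S.Zs)ˣ, ∫ x, twist f₁ f₂ k x ∂(stdVol S d)) := by
  have hz := zetaS_nonneg S d
  have hi₁ := integral_nonneg (μ := stdVol S d) (f := f₁) h₁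
  have hi₂ := integral_nonneg (μ := stdVol S d) (f := f₂) h₂
  have ht (k : (S.Zs)ˣ) := integral_nonneg (μ := stdVol S d) (f := twist f₁ f₂ k)
    (twist_nonneg h₁ h₂ k)
  have hm : Measurable fun z : S.QS d × S.QS d =>
      ENNReal.ofReal (f₁ z.1) * ENNReal.ofReal (f₂ z.2) :=
    (hf₁.measurable.comp measurable_fst).ennreal_ofReal.mul
      (hf₂.measurable.comp measurable_snd).ennreal_ofReal
  have hof {f : S.QS d → ℝ} (hf : Continuous f) (hc : HasCompactSupport f) (h : ∀ x, 0 ≤ f x) :=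
    ofReal_integral_eq_lintegral_ofReal (hf.integrable_of_hasCompactSupport (μ := stdVol S d) hc)
      (Filter.Eventually.of_forall h)
  have hk (k : (S.Zs)ˣ) : ∫⁻ z, ENNReal.ofReal (f₁ z.1) * ENNReal.ofReal (f₂ z.2)
      ∂(stdVol S d).map (fun x => (x, S.ratSMul ((k : S.Zs) : ℚ) x)) =
      ENNReal.ofReal (∫ x, twist f₁ f₂ k x ∂(stdVol S d)) := by
    rw [lintegral_map hm (measurable_prodMk_ratSMul _),
      hof (continuous_twist hf₁ hf₂ k) (hasCompactSupport_twist hc₁ f₂ k) (twist_nonneg h₁ h₂ k)]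
    exact lintegral_congr fun x => (ENNReal.ofReal_mul (h₁ x)).symm
  rw [momentMeasure, lintegral_add_measure, lintegral_smul_measure, lintegral_smul_measure,
    lintegral_sum_measure, lintegral_prod_mul hf₁.measurable.ennreal_ofReal.aemeasurable
      hf₂.measurable.ennreal_ofReal.aemeasurable, ← hof hf₁ hc₁ h₁, ← hof hf₂ hc₂ h₂,
    ← ENNReal.ofReal_mul hi₁]
  simp_rw [hk]
  rw [← ENNReal.ofReal_tsum_of_nonneg ht hs, smul_eq_mul, smul_eq_mul,
    ← ENNReal.ofReal_mul (by positivity), ← ENNReal.ofReal_mul (by positivity),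
    ← ENNReal.ofReal_add (by positivity) (mul_nonneg (by positivity) (tsum_nonneg ht))]

theorem lintegral_bind_pairMeasure (hd : 3 ≤ d) (μ : Measure (S.G d ⧸ S.Gamma d))
    [IsProbabilityMeasure μ] [SMulInvariantMeasure (S.G d) (S.G d ⧸ S.Gamma d) μ]
    {f g : S.QS d → ℝ≥0} (hf : Continuous f) (hg : Continuous g)
    (hfc : HasCompactSupport f) (hgc : HasCompactSupport g) :
    ∫⁻ p, (f p.1 : ℝ≥0∞) * g p.2 ∂μ.bind (pairMeasure S d) =
      ∫⁻ p, (f p.1 : ℝ≥0∞) * g p.2 ∂momentMeasure S d ∧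
    ∫⁻ p, (f p.1 : ℝ≥0∞) * g p.2 ∂μ.bind (pairMeasure S d) ≠ ∞ := by
  have hcoe {f : S.QS d → ℝ≥0} (hf : Continuous f) : Continuous fun x => (f x : ℝ) :=
    NNReal.continuous_coe.comp hf
  have hcoec {f : S.QS d → ℝ≥0} (hf : HasCompactSupport f) :
      HasCompactSupport fun x => (f x : ℝ) :=
    hf.comp_left NNReal.coe_zero
  obtain ⟨hs, h⟩ := lintegral_pairMeasure hd μ (hcoe hf) (hcoe hg) (hcoec hfc) (hcoec hgc)
    (fun x => (f x).2) (fun x => (g x).2)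
  have h' := lintegral_momentMeasure (hcoe hf) (hcoe hg) (hcoec hfc) (hcoec hgc)
    (fun x => (f x).2) (fun x => (g x).2) hs
  simp only [ENNReal.ofReal_coe_nnreal] at h h'
  have hm : Measurable fun p : S.QS d × S.QS d => (f p.1 : ℝ≥0∞) * g p.2 :=
    (hf.measurable.comp measurable_fst).coe_nnreal_ennreal.mul
      (hg.measurable.comp measurable_snd).coe_nnreal_ennreal
  rw [Measure.lintegral_bind measurable_pairMeasure.aemeasurable hm.aemeasurable, h, h']
  exact ⟨rfl, ENNReal.ofReal_ne_top⟩

theorem bind_pairMeasure (hd : 3 ≤ d) (μ : Measure (S.G d ⧸ S.Gamma d))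
    [IsProbabilityMeasure μ] [SMulInvariantMeasure (S.G d) (S.G d ⧸ S.Gamma d) μ] :
    μ.bind (pairMeasure S d) = momentMeasure S d :=
  ext_of_lintegral_mul_compactSupport
    (fun _ _ hf hg hfc hgc => (lintegral_bind_pairMeasure hd μ hf hg hfc hgc).1)
    (fun _ _ hf hg hfc hgc => (lintegral_bind_pairMeasure hd μ hf hg hfc hgc).2)

theorem momentMeasure_lt_top (hd : 3 ≤ d) (μ : Measure (S.G d ⧸ S.Gamma d))
    [IsProbabilityMeasure μ] [SMulInvariantMeasure (S.G d) (S.G d ⧸ S.Gamma d) μ]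
    {K : Set (S.QS d × S.QS d)} (hK : IsCompact K) : momentMeasure S d K < ∞ := by
  rw [← bind_pairMeasure hd μ]
  exact measure_lt_top_of_isCompact
    (fun _ _ hf hg hfc hgc => (lintegral_bind_pairMeasure hd μ hf hg hfc hgc).2) hK

theorem integral_momentMeasure {F : S.QS d × S.QS d → ℝ} (hF : Measurable F) (hz : S.zetaS d ≠ 0)
    (hi : Integrable F (momentMeasure S d)) :
    ∫ z, F z ∂momentMeasure S d =
      (1 / S.zetaS d ^ 2) * (∫ x, F x ∂((stdVol S d).prod (stdVol S d))) +
        (1 / S.zetaS d) *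
          ∑' k : (S.Zs)ˣ, ∫ x, F (x, S.ratSMul ((k : S.Zs) : ℚ) x) ∂(stdVol S d) := by
  have hz := lt_of_le_of_ne (zetaS_nonneg S d) hz.symm
  have hne : ENNReal.ofReal (1 / S.zetaS d) ≠ 0 := (ENNReal.ofReal_pos.2 (by positivity)).ne'
  obtain ⟨hi1, hi2⟩ := integrable_add_measure.1 hi
  have hi3 := (integrable_smul_measure hne ENNReal.ofReal_ne_top).1 hi2
  rw [momentMeasure, integral_add_measure hi1 hi2, integral_smul_measure, integral_smul_measure,
    integral_sum_measure hi3, ENNReal.toReal_ofReal (by positivity),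
    ENNReal.toReal_ofReal (by positivity), smul_eq_mul, smul_eq_mul]
  congr 2
  exact tsum_congr fun k => integral_map (measurable_prodMk_ratSMul _).aemeasurable
    hF.aestronglyMeasurable

end MomentMeasure

end PrimeTup

namespace PrimeTup

open scoped ENNReal

variable {S : PrimeTup} {d : ℕ}

theorem measurable_of_semicontinuous {F : S.QS d × S.QS d → ℝ}
    (hF : UpperSemicontinuous F ∨ LowerSemicontinuous F) : Measurable F :=
  have : OpensMeasurableSpace (S.QS d × S.QS d) := Prod.opensMeasurableSpace
  hF.elim UpperSemicontinuous.measurable LowerSemicontinuous.measurable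

theorem integrable_momentMeasure (hd : 3 ≤ d) (μ : Measure (S.G d ⧸ S.Gamma d))
    [IsProbabilityMeasure μ] [SMulInvariantMeasure (S.G d) (S.G d ⧸ S.Gamma d) μ]
    {F : S.QS d × S.QS d → ℝ} (hF : Measurable F) (hb : ∃ M, ∀ x, |F x| ≤ M)
    (hc : HasCompactSupport F) : Integrable F (momentMeasure S d) := by
  obtain ⟨M, hM⟩ := hb
  rw [← integrableOn_iff_integrable_of_support_subset (subset_tsupport F)]
  exact Measure.integrableOn_of_bounded (momentMeasure_lt_top hd μ hc).ne
    hF.aestronglyMeasurable (Filter.Eventually.of_forall hM)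

theorem tsum_prim (F : S.QS d × S.QS d → ℝ) (g : S.G d) :
    ∑' v : S.prim d × S.prim d, F (S.act g v.1, S.act g v.2) =
      ∑' q : S.primZs d × S.primZs d, F (pairMap q g) := by
  let e : S.primZs d ≃ S.prim d := Equiv.Set.image _ _ dg_injective
  exact ((e.prodCongr e).tsum_eq fun v : S.prim d × S.prim d =>
    F (S.act g v.1, S.act g v.2)).symm

theorem tsum_eq_toReal_sub_toReal {ι : Type*} (f : ι → ℝ)
    (hp : ∑' i, ENNReal.ofReal (f i) ≠ ∞) (hm : ∑' i, ENNReal.ofReal (-f i) ≠ ∞) :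
    ∑' i, f i =
      (∑' i, ENNReal.ofReal (f i)).toReal - (∑' i, ENNReal.ofReal (-f i)).toReal := by
  rw [ENNReal.tsum_toReal_eq fun _ => ENNReal.ofReal_ne_top,
    ENNReal.tsum_toReal_eq fun _ => ENNReal.ofReal_ne_top,
    ← (ENNReal.summable_toReal hp).tsum_sub (ENNReal.summable_toReal hm)]
  refine tsum_congr fun i => ?_
  rw [ENNReal.toReal_ofReal', ENNReal.toReal_ofReal']
  exact (max_zero_sub_eq_self (f i)).symm

theorem integrable_and_integral_of_tsum (μ : Measure (S.G d ⧸ S.Gamma d))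
    {F : S.QS d × S.QS d → ℝ} (hF : Measurable F)
    (hi : Integrable F (μ.bind (pairMeasure S d))) (Fhat : S.G d ⧸ S.Gamma d → ℝ)
    (hFhat : ∀ g : S.G d, Fhat (QuotientGroup.mk g) =
      ∑' q : S.primZs d × S.primZs d, F (pairMap q g)) :
    Integrable Fhat μ ∧ ∫ x, Fhat x ∂μ = ∫ z, F z ∂μ.bind (pairMeasure S d) := by
  have hmp : Measurable fun z => ENNReal.ofReal (F z) := hF.ennreal_ofReal
  have hmm : Measurable fun z => ENNReal.ofReal (-F z) := hF.neg.ennreal_ofReal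
  have hm {f : S.QS d × S.QS d → ℝ≥0∞} (hf : Measurable f) :
      Measurable fun x => ∫⁻ z, f z ∂pairMeasure S d x :=
    (Measure.measurable_lintegral hf).comp measurable_pairMeasure
  have hbind {f : S.QS d × S.QS d → ℝ≥0∞} (hf : Measurable f) :=
    Measure.lintegral_bind (m := μ) measurable_pairMeasure.aemeasurable hf.aemeasurable
  have hpt := hi.lintegral_lt_top
  have hmt := hi.neg.lintegral_lt_top
  simp only [Pi.neg_apply] at hmt
  rw [hbind hmp] at hpt
  rw [hbind hmm] at hmt
  have hap := ae_lt_top (hm hmp) hpt.ne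
  have ham := ae_lt_top (hm hmm) hmt.ne
  have hae : Fhat =ᵐ[μ] fun x => (∫⁻ z, ENNReal.ofReal (F z) ∂pairMeasure S d x).toReal -
      (∫⁻ z, ENNReal.ofReal (-F z) ∂pairMeasure S d x).toReal := by
    filter_upwards [hap, ham] with x hxp hxm
    obtain ⟨g, rfl⟩ := QuotientGroup.mk_surjective x
    rw [lintegral_pairMeasure_mk hmp] at hxp ⊢
    rw [lintegral_pairMeasure_mk hmm] at hxm ⊢
    rw [hFhat, tsum_eq_toReal_sub_toReal _ hxp.ne hxm.ne]
  have hip := integrable_toReal_of_lintegral_ne_top (hm hmp).aemeasurable hpt.ne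
  have him := integrable_toReal_of_lintegral_ne_top (hm hmm).aemeasurable hmt.ne
  refine ⟨(hip.sub him).congr hae.symm, ?_⟩
  rw [integral_congr_ae hae, integral_sub hip him, integral_toReal (hm hmp).aemeasurable hap,
    integral_toReal (hm hmm).aemeasurable ham,
    integral_eq_lintegral_pos_part_sub_lintegral_neg_part hi, hbind hmp, hbind hmm]

end PrimeTup

open PrimeTup in
/-- **S-arithmetic primitive second moment formula for `d ≥ 3`** (Theorem 1.2).
For `F : ℚ_S^d × ℚ_S^d → ℝ` bounded, compactly supported and semicontinuous, the transform
`F̂(gΓ_d) = ∑_{(v¹,v²) ∈ P(ℤ_S^d)²} F(g·v¹, g·v²)` is integrable on `G_d/Γ_d` and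
`∫ F̂ dμ = ζ_S(d)⁻² ∬ F dvol_S dvol_S + ζ_S(d)⁻¹ ∑_{k ∈ ℤ_S^×} ∫ F(x, k·x) dvol_S(x)`. -/
theorem primitive_second_moment_formula_of_three_le
    (S : PrimeTup) (d : ℕ) (hd : 3 ≤ d)
    (volS : Measure (S.QS d)) (hvolS : S.IsVolS d volS)
    (μ : Measure (S.G d ⧸ S.Gamma d)) (hμ : S.Admissible d μ)
    (F : S.QS d × S.QS d → ℝ)
    (hbdd : ∃ M, ∀ x, |F x| ≤ M)
    (hcpt : HasCompactSupport F)
    (hsc : UpperSemicontinuous F ∨ LowerSemicontinuous F)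
    (Fhat : (S.G d ⧸ S.Gamma d) → ℝ)
    (hFhat : ∀ g : S.G d,
      Fhat (QuotientGroup.mk g) = ∑' v : S.prim d × S.prim d,
        F (S.act g v.1, S.act g v.2)) :
    Integrable Fhat μ ∧
      ∫ x, Fhat x ∂μ =
        (1 / S.zetaS d ^ 2) * (∫ x, F x ∂(volS.prod volS)) +
        (1 / S.zetaS d) *
          ∑' k : (S.Zs)ˣ, ∫ x, F (x, S.ratSMul ((k : S.Zs) : ℚ) x) ∂volS := by
  have := hμ.1
  have := hμ.2.2
  obtain rfl := hvolS.eq_stdVol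
  have hF := measurable_of_semicontinuous hsc
  have hi := integrable_momentMeasure hd μ hF hbdd hcpt
  obtain ⟨h1, h2⟩ := integrable_and_integral_of_tsum μ hF (by rwa [bind_pairMeasure hd μ]) Fhat
    fun g => (hFhat g).trans (tsum_prim F g)
  refine ⟨h1, h2.trans ?_⟩
  rw [bind_pairMeasure hd μ, integral_momentMeasure hF (zetaS_ne_zero (by omega)) hi]
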